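/- Let S be a finite nonempty set of primes. The set of triples (x, y, z) of S-units satisfying 1 + x = y + z which are nondegenerate — i.e. (x, y, z) is not of the form (x, 1, x), not of the form (x, x, 1), and not of the form (−1, y, −y) — is finite. -/

import Mathlib

/-- A rational number `u` is an `S`-unit if `u ≠ 0` and every prime dividing
its numerator or its denominator (in lowest terms) lies in `S`. -/
def IsSUnit (S : Finset ℕ) (u : ℚ) : Prop :=
  u ≠ 0 ∧ ∀ p : ℕ, p.Prime → ((p : ℤ) ∣ u.num ∨ p ∣ u.den) → p ∈ S

namespace SUnitEquation

open MvPolynomial Finset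

/-! ### The length of a polynomial -/

section Length

variable {σ τ ι R : Type*} [NormedCommRing R]

/-- The sum of the norms of the coefficients. -/
noncomputable def length (P : MvPolynomial σ R) : ℝ :=
  ∑ e ∈ P.support, ‖P.coeff e‖

lemma length_eq_sum_of_subset (P : MvPolynomial σ R) {s : Finset (σ →₀ ℕ)} (hs : P.support ⊆ s) :
    length P = ∑ e ∈ s, ‖P.coeff e‖ := by
  refine Finset.sum_subset hs fun e _ he => ?_
  rw [MvPolynomial.notMem_support_iff.1 he, norm_zero]

lemma length_nonneg (P : MvPolynomial σ R) : 0 ≤ length P :=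
  Finset.sum_nonneg fun _ _ => norm_nonneg _

@[simp] lemma length_zero : length (0 : MvPolynomial σ R) = 0 := by simp [length]

lemma norm_coeff_le_length (P : MvPolynomial σ R) (e : σ →₀ ℕ) : ‖P.coeff e‖ ≤ length P := by
  by_cases he : e ∈ P.support
  · exact Finset.single_le_sum (f := fun e => ‖P.coeff e‖) (fun _ _ => norm_nonneg _) he
  · rw [MvPolynomial.notMem_support_iff.1 he, norm_zero]
    exact length_nonneg P

lemma length_add_le (P Q : MvPolynomial σ R) : length (P + Q) ≤ length P + length Q := by
  classical
  rw [length_eq_sum_of_subset _ MvPolynomial.support_add,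
    length_eq_sum_of_subset P (Finset.subset_union_left (s₂ := Q.support)),
    length_eq_sum_of_subset Q (Finset.subset_union_right (s₁ := P.support)),
    ← Finset.sum_add_distrib]
  exact Finset.sum_le_sum fun e _ => by rw [coeff_add]; exact norm_add_le _ _

lemma length_sum_le (s : Finset ι) (P : ι → MvPolynomial σ R) :
    length (∑ i ∈ s, P i) ≤ ∑ i ∈ s, length (P i) := by
  classical
  induction s using Finset.induction_on with
  | empty => simp
  | insert a s ha ih =>
    rw [Finset.sum_insert ha, Finset.sum_insert ha]
    exact (length_add_le _ _).trans (by gcongr)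

lemma length_monomial (e : σ →₀ ℕ) (a : R) : length (monomial e a) = ‖a‖ := by
  classical
  rw [length_eq_sum_of_subset _ (MvPolynomial.support_monomial_subset (s := e) (a := a))]
  simp

lemma length_C (a : R) : length (C a : MvPolynomial σ R) = ‖a‖ := length_monomial 0 a

lemma length_X [NormOneClass R] (i : σ) : length (X i : MvPolynomial σ R) = 1 := by
  rw [X, length_monomial, norm_one]

lemma length_neg (P : MvPolynomial σ R) : length (-P) = length P := by
  simp [length, MvPolynomial.support_neg]

lemma length_mul_le (P Q : MvPolynomial σ R) : length (P * Q) ≤ length P * length Q := by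
  classical
  have h : P * Q = ∑ e ∈ P.support, ∑ f ∈ Q.support, monomial (e + f) (P.coeff e * Q.coeff f) := by
    conv_lhs => rw [P.as_sum, Q.as_sum]
    rw [Finset.sum_mul_sum]
    simp only [monomial_mul]
  have h' : length P * length Q =
      ∑ e ∈ P.support, ∑ f ∈ Q.support, ‖P.coeff e‖ * ‖Q.coeff f‖ := Finset.sum_mul_sum ..
  rw [h, h']
  refine (length_sum_le _ _).trans (Finset.sum_le_sum fun e _ => ?_)
  refine (length_sum_le _ _).trans (Finset.sum_le_sum fun f _ => ?_)
  rw [length_monomial]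
  exact norm_mul_le _ _

lemma length_one [NormOneClass R] : length (1 : MvPolynomial σ R) = 1 := by
  rw [← C_1, length_C, norm_one]

lemma length_prod_le [NormOneClass R] (s : Finset ι) (P : ι → MvPolynomial σ R) :
    length (∏ i ∈ s, P i) ≤ ∏ i ∈ s, length (P i) := by
  classical
  induction s using Finset.induction_on with
  | empty => simp [length_one]
  | insert a s ha ih =>
    rw [Finset.prod_insert ha, Finset.prod_insert ha]
    exact (length_mul_le _ _).trans (mul_le_mul_of_nonneg_left ih (length_nonneg _))

lemma length_pow_le [NormOneClass R] (P : MvPolynomial σ R) (k : ℕ) :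
    length (P ^ k) ≤ length P ^ k := by
  simpa using length_prod_le (Finset.range k) fun _ => P

lemma length_pos {P : MvPolynomial σ R} (hP : P ≠ 0) : 0 < length P := by
  obtain ⟨e, he⟩ := MvPolynomial.ne_zero_iff.1 hP
  exact (norm_pos_iff.2 he).trans_le (norm_coeff_le_length P e)


end Length

lemma one_le_length {σ : Type*} {P : MvPolynomial σ ℤ} (hP : P ≠ 0) : 1 ≤ length P := by
  obtain ⟨e, he⟩ := MvPolynomial.ne_zero_iff.1 hP
  refine le_trans ?_ (norm_coeff_le_length P e)
  rw [Int.norm_eq_abs]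
  exact_mod_cast Int.one_le_abs he

end SUnitEquation

namespace SUnitEquation

open MvPolynomial Finset

/-! ### Divided derivatives and the index -/

section Hasse

variable {σ R : Type*} [Fintype σ] [CommRing R]

/-- The divided partial derivative of multi-order `μ`. -/
noncomputable def hasse (μ : σ →₀ ℕ) : MvPolynomial σ R →ₗ[R] MvPolynomial σ R :=
  (basisMonomials σ R).constr R fun e => monomial (e - μ) (∏ i, ((e i).choose (μ i) : R))

lemma hasse_monomial (μ e : σ →₀ ℕ) (a : R) :
    hasse μ (monomial e a) = monomial (e - μ) (a * ∏ i, ((e i).choose (μ i) : R)) := by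
  have h : monomial e a = a • basisMonomials σ R e := by
    rw [coe_basisMonomials, smul_monomial, smul_eq_mul, mul_one]
  rw [h, map_smul, hasse, Module.Basis.constr_basis, smul_monomial, smul_eq_mul]

lemma hasse_hasse (J μ : σ →₀ ℕ) (P : MvPolynomial σ R) :
    hasse J (hasse μ P) = (∏ i, (((J + μ) i).choose (μ i) : R)) • hasse (J + μ) P := by
  induction P using MvPolynomial.induction_on' with
  | add p q hp hq => simp only [map_add, smul_add, hp, hq]
  | monomial e a =>
    simp only [hasse_monomial, smul_monomial, smul_eq_mul]
    rw [show e - μ - J = e - (J + μ) by rw [tsub_tsub, add_comm]]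
    congr 1
    rw [mul_assoc, ← Finset.prod_mul_distrib, mul_left_comm, ← Finset.prod_mul_distrib]
    congr 1
    refine Finset.prod_congr rfl fun i _ => ?_
    have h := Nat.choose_mul (n := e i) (k := (J + μ) i) (s := μ i) (by simp)
    rw [Finsupp.add_apply, Nat.add_sub_cancel] at h
    rw [Finsupp.tsub_apply, Finsupp.add_apply, mul_comm (((J i + μ i).choose _ : ℕ) : R)]
    exact_mod_cast congrArg (Nat.cast (R := R)) h.symm

lemma hasse_zero (P : MvPolynomial σ R) : hasse 0 P = P := by
  induction P using MvPolynomial.induction_on' with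
  | add p q hp hq => simp only [map_add, hp, hq]
  | monomial e a => simp [hasse_monomial]

lemma pderiv_eq_hasse (l : σ) (P : MvPolynomial σ R) :
    pderiv l P = hasse (Finsupp.single l 1) P := by
  classical
  induction P using MvPolynomial.induction_on' with
  | add p q hp hq => simp only [map_add, hp, hq]
  | monomial e a =>
    rw [pderiv_monomial, hasse_monomial]
    congr 2
    rw [Finset.prod_eq_single l]
    · simp
    · intro i _ hi
      simp [Finsupp.single_eq_of_ne hi]
    · simp

lemma pderiv_hasse (l : σ) (μ : σ →₀ ℕ) (P : MvPolynomial σ R) :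
    pderiv l (hasse μ P) = ((μ l + 1 : ℕ) : R) • hasse (μ + Finsupp.single l 1) P := by
  classical
  rw [pderiv_eq_hasse, hasse_hasse, add_comm (Finsupp.single l 1) μ]
  congr 1
  rw [Finset.prod_eq_single l]
  · simp
  · intro i _ hi
    simp [Finsupp.single_eq_of_ne hi]
  · simp

/-- The translate `P (X + ξ)`. -/
noncomputable def shift (ξ : σ → R) : MvPolynomial σ R →ₐ[R] MvPolynomial σ R :=
  aeval fun i => X i + C (ξ i)

lemma shift_shift_neg {σ R : Type*} [CommRing R] (ξ : σ → R) (P : MvPolynomial σ R) :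
    shift (fun i => -ξ i) (shift ξ P) = P := by
  have : (shift fun i => -ξ i).comp (shift ξ) = AlgHom.id R (MvPolynomial σ R) := by
    ext i
    simp [shift]
  exact congrArg (fun g : MvPolynomial σ R →ₐ[R] MvPolynomial σ R => g P) this

lemma shift_injective {σ R : Type*} [CommRing R] (ξ : σ → R) : Function.Injective (shift ξ) :=
  Function.LeftInverse.injective (shift_shift_neg ξ)

lemma coeff_shift (ξ : σ → R) (J : σ →₀ ℕ) (P : MvPolynomial σ R) :
    coeff J (shift ξ P) = eval ξ (hasse J P) := by
  classical
  induction P using MvPolynomial.induction_on' with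
  | add p q hp hq => simp only [map_add, coeff_add, hp, hq]
  | monomial e a =>
    have h1 : shift ξ (monomial e a) = C a * ∏ i, (X i + C (ξ i)) ^ e i := by
      rw [shift, aeval_monomial, Finsupp.prod_fintype _ _ (fun i => pow_zero _), algebraMap_eq]
    have h2 : ∏ i, (X i + C (ξ i) : MvPolynomial σ R) ^ e i =
        ∑ f ∈ Fintype.piFinset fun i => Finset.range (e i + 1),
          monomial (Finsupp.equivFunOnFinite.symm f)
            (∏ i, (ξ i ^ (e i - f i) * ((e i).choose (f i) : R))) := by
      simp only [add_pow]
      rw [Finset.prod_univ_sum]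
      refine Finset.sum_congr rfl fun f _ => ?_
      rw [monomial_eq, Finsupp.prod_fintype _ _ (fun i => pow_zero _), map_prod,
        ← Finset.prod_mul_distrib]
      refine Finset.prod_congr rfl fun i _ => ?_
      simp only [Finsupp.equivFunOnFinite_symm_apply_apply, C_mul, C_pow, map_natCast]
      ring
    rw [h1, h2, coeff_C_mul, coeff_sum, hasse_monomial, eval_monomial,
      Finsupp.prod_fintype _ _ (fun i => pow_zero _)]
    simp only [coeff_monomial]
    rw [mul_assoc, ← Finset.prod_mul_distrib]
    congr 1
    by_cases hJ : ∀ i, J i ≤ e i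
    · rw [Finset.sum_eq_single (J : σ → ℕ)]
      · rw [if_pos (by ext; simp)]
        refine Finset.prod_congr rfl fun i _ => ?_
        simp [mul_comm]
      · intro f _ hf
        rw [if_neg]
        rintro rfl
        exact hf (by ext; simp)
      · intro h
        exact absurd (by simpa [Fintype.mem_piFinset, Nat.lt_succ_iff] using hJ) h
    · push Not at hJ
      obtain ⟨i, hi⟩ := hJ
      rw [Finset.sum_eq_zero, Finset.prod_eq_zero (Finset.mem_univ i)]
      · simp [Nat.choose_eq_zero_of_lt hi]
      · intro f hf
        rw [if_neg]
        rintro rfl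
        have := Fintype.mem_piFinset.1 hf i
        simp at this hi
        omega

/-- All monomials of `P (X + ξ)` have `w`-weight at least `c`. -/
def IndexGE (w : σ → ℝ) (ξ : σ → R) (c : ℝ) (P : MvPolynomial σ R) : Prop :=
  ∀ J : σ →₀ ℕ, ∑ i, w i * J i < c → coeff J (shift ξ P) = 0

variable {w : σ → ℝ} {ξ : σ → R}

lemma IndexGE.zero (c : ℝ) : IndexGE w ξ c (0 : MvPolynomial σ R) := fun J _ => by simp

lemma IndexGE.of_nonpos (hw : ∀ i, 0 ≤ w i) {c : ℝ} (hc : c ≤ 0) (P : MvPolynomial σ R) :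
    IndexGE w ξ c P := fun J hJ => by
  have : 0 ≤ ∑ i, w i * J i := Finset.sum_nonneg fun i _ => mul_nonneg (hw i) (Nat.cast_nonneg _)
  linarith

lemma IndexGE.add {c : ℝ} {P Q : MvPolynomial σ R} (hP : IndexGE w ξ c P) (hQ : IndexGE w ξ c Q) :
    IndexGE w ξ c (P + Q) := fun J hJ => by
  rw [map_add, coeff_add, hP J hJ, hQ J hJ, add_zero]

lemma IndexGE.sum {ι : Type*} {c : ℝ} (s : Finset ι) {P : ι → MvPolynomial σ R}
    (hP : ∀ i ∈ s, IndexGE w ξ c (P i)) : IndexGE w ξ c (∑ i ∈ s, P i) := fun J hJ => by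
  rw [map_sum, coeff_sum]
  exact Finset.sum_eq_zero fun i hi => hP i hi J hJ

lemma IndexGE.mul {a b : ℝ} {P Q : MvPolynomial σ R} (hP : IndexGE w ξ a P)
    (hQ : IndexGE w ξ b Q) : IndexGE w ξ (a + b) (P * Q) := fun J hJ => by
  classical
  rw [map_mul, coeff_mul]
  refine Finset.sum_eq_zero fun x hx => ?_
  have hx' : x.1 + x.2 = J := Finset.HasAntidiagonal.mem_antidiagonal.1 hx
  have hsum : ∑ i, w i * x.1 i + ∑ i, w i * x.2 i = ∑ i, w i * J i := by
    rw [← Finset.sum_add_distrib, ← hx']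
    exact Finset.sum_congr rfl fun i _ => by rw [Finsupp.add_apply]; push_cast; ring
  by_cases h1 : ∑ i, w i * x.1 i < a
  · rw [hP _ h1, zero_mul]
  · rw [hQ x.2 (by linarith), mul_zero]

lemma IndexGE.prod {ι : Type*} (hw : ∀ i, 0 ≤ w i) (s : Finset ι) {c : ι → ℝ}
    {P : ι → MvPolynomial σ R} (hP : ∀ i ∈ s, IndexGE w ξ (c i) (P i)) :
    IndexGE w ξ (∑ i ∈ s, c i) (∏ i ∈ s, P i) := by
  classical
  induction s using Finset.induction_on with
  | empty => simpa using IndexGE.of_nonpos hw le_rfl 1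
  | insert a s ha ih =>
    rw [Finset.sum_insert ha, Finset.prod_insert ha]
    exact (hP a (by simp)).mul (ih fun i hi => hP i (by simp [hi]))

lemma IndexGE.det (hw : ∀ i, 0 ≤ w i) {s : ℕ} {c : Fin s → ℝ}
    {A : Matrix (Fin s) (Fin s) (MvPolynomial σ R)} (hA : ∀ i j, IndexGE w ξ (c j) (A i j)) :
    IndexGE w ξ (∑ j, c j) A.det := by
  rw [Matrix.det_apply]
  refine IndexGE.sum _ fun τ _ => ?_
  have h := IndexGE.prod hw Finset.univ (fun i _ => hA (τ i) i)
  intro J hJ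
  rw [Units.smul_def, map_zsmul, coeff_smul, h J hJ, smul_zero]

lemma IndexGE.hasse {c : ℝ} {P : MvPolynomial σ R} (hP : IndexGE w ξ c P) (μ : σ →₀ ℕ) :
    IndexGE w ξ (c - ∑ i, w i * μ i) (hasse μ P) := fun J hJ => by
  rw [coeff_shift, hasse_hasse, smul_eval, ← coeff_shift, hP, mul_zero]
  have : ∑ i, w i * ((J + μ) i : ℕ) = ∑ i, w i * J i + ∑ i, w i * μ i := by
    rw [← Finset.sum_add_distrib]
    exact Finset.sum_congr rfl fun i _ => by rw [Finsupp.add_apply]; push_cast; ring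
  linarith

end Hasse

end SUnitEquation

namespace SUnitEquation

open MvPolynomial Finset

/-! ### Generalized Wronskians -/

section Wronskian

variable {σ : Type*} [Fintype σ]

lemma coeff_shift_pderiv {R : Type*} [CommRing R] (ξ : σ → R) (J : σ →₀ ℕ) (l : σ)
    (P : MvPolynomial σ R) :
    coeff J (shift ξ (pderiv l P)) =
      ((J l + 1 : ℕ) : R) * coeff (J + Finsupp.single l 1) (shift ξ P) := by
  classical
  rw [coeff_shift, pderiv_eq_hasse, hasse_hasse, smul_eval, ← coeff_shift]
  congr 1
  rw [Finset.prod_eq_single l]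
  · simp
  · intro i _ hi
    simp [Finsupp.single_eq_of_ne hi]
  · simp

lemma eq_zero_of_mul_pderiv_eq {c g : MvPolynomial σ ℚ} {a : σ → ℚ} (hc : eval a c ≠ 0)
    (hg : eval a g = 0) (h : ∀ l, c * pderiv l g = g * pderiv l c) : g = 0 := by
  classical
  apply shift_injective a
  rw [map_zero]
  suffices H : ∀ n : ℕ, ∀ J : σ →₀ ℕ, J.degree ≤ n → coeff J (shift a g) = 0 by
    ext J
    rw [H _ J le_rfl, coeff_zero]
  intro n
  induction n with
  | zero =>
    intro J hJ
    have : J = 0 := by rwa [Nat.le_zero, Finsupp.degree_eq_zero_iff] at hJ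
    rw [this, coeff_shift, hasse_zero, hg]
  | succ n ih =>
    intro J hJ
    rcases Nat.lt_or_eq_of_le hJ with hJ | hJ
    · exact ih J (by omega)
    obtain ⟨l, hl⟩ : ∃ l, J l ≠ 0 := by
      by_contra! H
      have : J = 0 := by ext l; simp [H l]
      simp [this] at hJ
    obtain ⟨K, rfl⟩ : ∃ K, J = K + Finsupp.single l 1 :=
      ⟨J - Finsupp.single l 1, (tsub_add_cancel_of_le (by
        rw [Finsupp.single_le_iff]; omega)).symm⟩
    rw [map_add, Finsupp.degree_single] at hJ
    have h1 := congrArg (fun P => coeff K (shift a P)) (h l)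
    simp only [map_mul, coeff_mul] at h1
    have hz : ∀ x ∈ Finset.HasAntidiagonal.antidiagonal K, x.1 + x.2 = K :=
      fun x hx => Finset.HasAntidiagonal.mem_antidiagonal.1 hx
    have hd : ∀ x ∈ Finset.HasAntidiagonal.antidiagonal K, x.1.degree + x.2.degree = n :=
      fun x hx => by
        rw [← map_add, hz x hx]; omega
    rw [Finset.sum_eq_single ((0, K) : (σ →₀ ℕ) × (σ →₀ ℕ)),
      Finset.sum_eq_zero fun x hx => ?_] at h1
    · rw [coeff_shift_pderiv, coeff_shift, hasse_zero] at h1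
      simp only [mul_eq_zero, hc, false_or] at h1
      rcases h1 with h1 | h1
      · exact absurd h1 (by positivity)
      · exact h1
    · rw [ih x.1 (by have := hd x hx; omega), zero_mul]
    · intro x hx hx'
      have := hd x hx
      rw [coeff_shift_pderiv, ih, mul_zero, mul_zero]
      rw [map_add, Finsupp.degree_single]
      by_contra hlt
      have h0 : x.1 = 0 := by
        rw [← Finsupp.degree_eq_zero_iff]; omega
      have := hz x hx
      rw [h0, zero_add] at this
      exact hx' (Prod.ext h0 this)
    · intro h0
      exact absurd (Finset.HasAntidiagonal.mem_antidiagonal.2 (zero_add K)) h0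

lemma exists_eq_C_mul_of_mul_pderiv_eq {c g : MvPolynomial σ ℚ} (hc : c ≠ 0)
    (h : ∀ l, c * pderiv l g = g * pderiv l c) : ∃ r : ℚ, g = C r * c := by
  obtain ⟨a, ha⟩ : ∃ a, eval a c ≠ 0 := by
    by_contra! H
    exact hc (MvPolynomial.funext fun a => by rw [H a, map_zero])
  refine ⟨eval a g / eval a c, sub_eq_zero.1 (eq_zero_of_mul_pderiv_eq ha ?_ fun l => ?_)⟩
  · simp [ha]
  · rw [map_sub, pderiv_C_mul]
    linear_combination h l

theorem exists_wronskian_ne_zero (s : ℕ) (f : Fin s → MvPolynomial σ ℚ)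
    (hf : LinearIndependent ℚ f) :
    ∃ μ : Fin s → (σ →₀ ℕ), (∀ i, (μ i).degree < s) ∧
      (Matrix.of fun i j => hasse (μ i) (f j)).det ≠ 0 := by
  classical
  induction s with
  | zero => exact ⟨fun i => i.elim0, fun i => i.elim0, by simp⟩
  | succ s ih =>
    obtain ⟨μ, hμ, hD⟩ := ih (fun j => f j.castSucc)
      (hf.comp _ (Fin.castSucc_injective s))
    by_contra! H
    set c : Fin (s + 1) → MvPolynomial σ ℚ := fun j => (-1) ^ (s + (j : ℕ)) *
      (Matrix.of fun (i : Fin s) (k : Fin s) => hasse (μ i) (f (j.succAbove k))).det with hc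
    have hrel : ∀ ν : σ →₀ ℕ, ν.degree < s + 1 → ∑ j, c j * hasse ν (f j) = 0 := by
      intro ν hν
      have h := H (Fin.snoc μ ν : Fin (s + 1) → (σ →₀ ℕ)) (fun i => by
        refine Fin.lastCases ?_ (fun i => ?_) i
        · simpa using hν
        · simpa using (hμ i).trans (Nat.lt_succ_self s))
      rw [Matrix.det_succ_row _ (Fin.last s)] at h
      rw [← h]
      refine Finset.sum_congr rfl fun j _ => ?_
      have : (Matrix.of fun (i : Fin (s + 1)) (j : Fin (s + 1)) =>
          hasse ((Fin.snoc μ ν : Fin (s + 1) → (σ →₀ ℕ)) i) (f j)).submatrix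
            (Fin.last s).succAbove j.succAbove =
          Matrix.of fun (i : Fin s) (k : Fin s) => hasse (μ i) (f (j.succAbove k)) := by
        ext1 i k
        simp
      rw [this]
      simp only [hc, Matrix.of_apply, Fin.snoc_last, Fin.val_last]
      ring
    have hcl : c (Fin.last s) ≠ 0 := by
      simp only [hc, Fin.succAbove_last]
      exact mul_ne_zero (pow_ne_zero _ (by simp)) hD
    have hder : ∀ l, ∀ ν : σ →₀ ℕ, ν.degree < s → ∑ j, pderiv l (c j) * hasse ν (f j) = 0 := by
      intro l ν hν
      have h1 := congrArg (pderiv l) (hrel ν (by omega))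
      have h2 := hrel (ν + Finsupp.single l 1) (by
        rw [map_add, Finsupp.degree_single]; omega)
      rw [map_zero, map_sum] at h1
      simp only [Derivation.leibniz, pderiv_hasse, smul_eq_mul, Finset.sum_add_distrib,
        mul_smul_comm, ← Finset.smul_sum] at h1
      rw [h2, smul_zero, zero_add] at h1
      rw [← h1]
      exact Finset.sum_congr rfl fun j _ => mul_comm _ _
    have hprop : ∀ l j, c (Fin.last s) * pderiv l (c j) = c j * pderiv l (c (Fin.last s)) := by
      intro l
      have hv := Matrix.eq_zero_of_mulVec_eq_zero hD
        (v := fun j : Fin s => c (Fin.last s) * pderiv l (c j.castSucc) -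
          c j.castSucc * pderiv l (c (Fin.last s))) (by
        ext1 i
        have h1 := hder l (μ i) (hμ i)
        have h2 := hrel (μ i) ((hμ i).trans (Nat.lt_succ_self s))
        rw [Fin.sum_univ_castSucc] at h1 h2
        simp only [Matrix.mulVec, dotProduct, Matrix.of_apply, Pi.zero_apply]
        have : ∀ j : Fin s, hasse (μ i) (f j.castSucc) *
            (c (Fin.last s) * pderiv l (c j.castSucc) -
              c j.castSucc * pderiv l (c (Fin.last s))) =
            c (Fin.last s) * (pderiv l (c j.castSucc) * hasse (μ i) (f j.castSucc)) -
            pderiv l (c (Fin.last s)) * (c j.castSucc * hasse (μ i) (f j.castSucc)) :=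
          fun j => by ring
        rw [Finset.sum_congr rfl fun j _ => this j, Finset.sum_sub_distrib, ← Finset.mul_sum,
          ← Finset.mul_sum]
        linear_combination c (Fin.last s) * h1 - pderiv l (c (Fin.last s)) * h2)
      intro j
      refine Fin.lastCases rfl (fun j => ?_) j
      exact sub_eq_zero.1 (congrFun hv j)
    choose r hr using fun j => exists_eq_C_mul_of_mul_pderiv_eq hcl fun l => hprop l j
    have h0 := hrel 0 (by simp)
    simp only [hasse_zero] at h0
    rw [Finset.sum_congr rfl fun j _ => by rw [hr j, mul_right_comm, C_mul'], ← Finset.sum_mul]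
      at h0
    have h1 := Fintype.linearIndependent_iff.1 hf r
      ((mul_eq_zero.1 h0).resolve_right hcl) (Fin.last s)
    have h2 := hr (Fin.last s)
    rw [h1] at h2
    exact hcl (by simpa using h2)

end Wronskian

end SUnitEquation

namespace SUnitEquation

open MvPolynomial Finset

/-! ### Separating one variable -/

lemma exists_sum_lt_of_not_linearIndependent {K M N Q : Type*} [Field K] [AddCommGroup M]
    [AddCommGroup N] [AddCommGroup Q] [Module K M] [Module K N] [Module K Q]
    (B : M →ₗ[K] N →ₗ[K] Q) {s : ℕ} (f : Fin s → M) (g : Fin s → N)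
    (hf : ¬ LinearIndependent K f) :
    ∃ t < s, ∃ (f' : Fin t → M) (g' : Fin t → N),
      ∑ k, B (f' k) (g' k) = ∑ k, B (f k) (g k) := by
  rw [Fintype.linearIndependent_iff] at hf
  push Not at hf
  obtain ⟨r, hr, i, hi⟩ := hf
  obtain ⟨t, rfl⟩ : ∃ t, s = t + 1 := ⟨s - 1, by have := i.pos; omega⟩
  refine ⟨t, Nat.lt_succ_self t, fun k => f (i.succAbove k),
    fun k => g (i.succAbove k) - (r (i.succAbove k) / r i) • g i, ?_⟩
  rw [Fin.sum_univ_succAbove _ i] at hr ⊢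
  have hfi : f i = - ∑ k, (r (i.succAbove k) / r i) • f (i.succAbove k) := by
    have h : r i • f i = r i • (- ∑ k, (r (i.succAbove k) / r i) • f (i.succAbove k)) := by
      rw [smul_neg, Finset.smul_sum, eq_neg_iff_add_eq_zero, ← hr]
      congr 1
      exact Finset.sum_congr rfl fun k _ => by rw [smul_smul, mul_div_cancel₀ _ hi]
    exact smul_right_injective M hi h
  rw [hfi]
  simp only [map_sub, map_smul, map_neg, map_sum, LinearMap.neg_apply, LinearMap.sum_apply,
    LinearMap.smul_apply, Finset.sum_sub_distrib]
  abel

lemma exists_linearIndependent_sum {K M N Q : Type*} [Field K] [AddCommGroup M]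
    [AddCommGroup N] [AddCommGroup Q] [Module K M] [Module K N] [Module K Q]
    (B : M →ₗ[K] N →ₗ[K] Q) (s : ℕ) (f : Fin s → M) (g : Fin s → N) :
    ∃ t ≤ s, ∃ (f' : Fin t → M) (g' : Fin t → N), LinearIndependent K f' ∧
      LinearIndependent K g' ∧ ∑ k, B (f' k) (g' k) = ∑ k, B (f k) (g k) := by
  induction s using Nat.strong_induction_on with
  | _ s ih =>
    by_cases hf : LinearIndependent K f
    · by_cases hg : LinearIndependent K g
      · exact ⟨s, le_rfl, f, g, hf, hg, rfl⟩
      · obtain ⟨t, ht, g', f', h⟩ := exists_sum_lt_of_not_linearIndependent B.flip g f hg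
        obtain ⟨t', ht', f'', g'', h1, h2, h3⟩ := ih t ht f' g'
        exact ⟨t', by omega, f'', g'', h1, h2, h3.trans h⟩
    · obtain ⟨t, ht, f', g', h⟩ := exists_sum_lt_of_not_linearIndependent B f g hf
      obtain ⟨t', ht', f'', g'', h1, h2, h3⟩ := ih t ht f' g'
      exact ⟨t', by omega, f'', g'', h1, h2, h3.trans h⟩

section Separate

variable {R : Type*} [CommRing R] {m : ℕ}

/-- The product of a polynomial in the variables `1, …, m` and a polynomial in the variable `0`. -/
noncomputable def sepMul : MvPolynomial (Fin m) R →ₗ[R] MvPolynomial Unit R →ₗ[R]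
    MvPolynomial (Fin (m + 1)) R :=
  (LinearMap.mul R (MvPolynomial (Fin (m + 1)) R)).compl₁₂
    (rename Fin.succ : _ →ₐ[R] _).toLinearMap (rename fun _ => 0 : _ →ₐ[R] _).toLinearMap

lemma sepMul_apply (f : MvPolynomial (Fin m) R) (g : MvPolynomial Unit R) :
    sepMul f g = rename Fin.succ f * rename (fun _ => 0) g := rfl

lemma mapDomain_add_mapDomain (e : Fin m →₀ ℕ) (k : Unit →₀ ℕ) :
    e.mapDomain Fin.succ + k.mapDomain (fun _ => (0 : Fin (m + 1))) = Finsupp.cons (k ()) e := by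
  ext i
  refine Fin.cases ?_ (fun i => ?_) i
  · have h : k = Finsupp.single () (k ()) := by ext; simp
    rw [Finsupp.add_apply, Finsupp.cons_zero, Finsupp.mapDomain_of_notMem_range, zero_add, h,
      Finsupp.mapDomain_single]
    · simp
    · rintro ⟨j, hj⟩
      exact Fin.succ_ne_zero j hj
  · rw [Finsupp.add_apply, Finsupp.cons_succ, Finsupp.mapDomain_apply (Fin.succ_injective m),
      Finsupp.mapDomain_of_notMem_range, add_zero]
    rintro ⟨j, hj⟩
    exact Fin.succ_ne_zero i hj.symm

lemma coeff_sepMul (f : MvPolynomial (Fin m) R) (g : MvPolynomial Unit R) (n : ℕ)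
    (e : Fin m →₀ ℕ) :
    coeff (Finsupp.cons n e) (sepMul f g) = coeff e f * coeff (Finsupp.single () n) g := by
  classical
  induction f using MvPolynomial.induction_on' with
  | add p q hp hq => simp only [map_add, LinearMap.add_apply, coeff_add, hp, hq, add_mul]
  | monomial e' a =>
    induction g using MvPolynomial.induction_on' with
    | add p q hp hq => simp only [map_add, coeff_add, hp, hq, mul_add]
    | monomial k b =>
      rw [sepMul_apply, rename_monomial, rename_monomial, monomial_mul, mapDomain_add_mapDomain]
      simp only [coeff_monomial]
      have h : Finsupp.cons (k ()) e' = Finsupp.cons n e ↔ e' = e ∧ k = Finsupp.single () n := by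
        constructor
        · intro h
          refine ⟨by rw [← Finsupp.tail_cons (k ()) e', h, Finsupp.tail_cons], ?_⟩
          ext
          have := congrArg (fun z => z 0) h
          simpa using this
        · rintro ⟨rfl, rfl⟩
          simp
      simp only [h]
      by_cases h1 : e' = e <;> by_cases h2 : k = Finsupp.single () n <;> simp [h1, h2]

lemma ext_cons {P Q : MvPolynomial (Fin (m + 1)) R}
    (h : ∀ n e, coeff (Finsupp.cons n e) P = coeff (Finsupp.cons n e) Q) : P = Q := by
  ext J
  rw [← Finsupp.cons_tail J]
  exact h _ _

lemma eq_sum_sepMul (P : MvPolynomial (Fin (m + 1)) R) {d : ℕ} (hd : P.degreeOf 0 ≤ d) :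
    P = ∑ k : Fin (d + 1), sepMul ((finSuccEquiv R m P).coeff k)
      (monomial (Finsupp.single () (k : ℕ)) 1) := by
  classical
  refine ext_cons fun n e => ?_
  simp only [coeff_sum, coeff_sepMul, coeff_monomial, finSuccEquiv_coeff_coeff]
  have hinj : ∀ k : Fin (d + 1), (Finsupp.single () (k : ℕ) = Finsupp.single () n) ↔ (k : ℕ) = n :=
    fun k => (Finsupp.single_injective ()).eq_iff
  simp only [hinj]
  by_cases hn : n < d + 1
  · rw [Finset.sum_eq_single ⟨n, hn⟩]
    · simp
    · intro k _ hk
      rw [if_neg (fun h => hk (Fin.ext h)), mul_zero]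
    · simp
  · rw [Finset.sum_eq_zero]
    · by_contra h
      have := monomial_le_degreeOf 0 (mem_support_iff.2 h)
      rw [Finsupp.cons_zero] at this
      omega
    · intro k _
      rw [if_neg (by omega), mul_zero]

lemma shift_sepMul (ξ : Fin (m + 1) → R) (f : MvPolynomial (Fin m) R) (g : MvPolynomial Unit R) :
    shift ξ (sepMul f g) = sepMul (shift (fun i => ξ i.succ) f) (shift (fun _ => ξ 0) g) := by
  have h1 : (shift ξ).comp (rename Fin.succ : MvPolynomial (Fin m) R →ₐ[R] _) =
      (rename Fin.succ).comp (shift fun i => ξ i.succ) := by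
    ext i
    simp [shift]
  have h2 : (shift ξ).comp (rename (fun _ => 0) : MvPolynomial Unit R →ₐ[R] _) =
      (rename fun _ => 0).comp (shift fun _ => ξ 0) := by
    ext i
    simp [shift]
  rw [sepMul_apply, sepMul_apply, map_mul]
  exact congrArg₂ _ (DFunLike.congr_fun h1 f) (DFunLike.congr_fun h2 g)

variable {σ : Type*} [Fintype σ]

lemma coeff_hasse (μ J : σ →₀ ℕ) (P : MvPolynomial σ R) :
    coeff J (hasse μ P) = coeff (J + μ) P * ∏ i, (((J + μ) i).choose (μ i) : R) := by
  classical
  induction P using MvPolynomial.induction_on' with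
  | add p q hp hq => simp only [map_add, coeff_add, hp, hq, add_mul]
  | monomial e a =>
    rw [hasse_monomial, coeff_monomial, coeff_monomial]
    by_cases h : e = J + μ
    · simp [h]
    rw [if_neg h, zero_mul]
    split_ifs with h'
    · have : ¬ μ ≤ e := fun hle => h (by rw [← h', tsub_add_cancel_of_le hle])
      obtain ⟨i, hi⟩ : ∃ i, e i < μ i := by
        by_contra! H
        exact this H
      rw [Finset.prod_eq_zero (Finset.mem_univ i) (by rw [Nat.choose_eq_zero_of_lt hi,
        Nat.cast_zero]), mul_zero]
    · rfl

lemma hasse_sepMul (n : ℕ) (μ : Fin m →₀ ℕ) (f : MvPolynomial (Fin m) R)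
    (g : MvPolynomial Unit R) :
    hasse (Finsupp.cons n μ) (sepMul f g) =
      sepMul (hasse μ f) (hasse (Finsupp.single () n) g) := by
  refine ext_cons fun k e => ?_
  have h : Finsupp.cons k e + Finsupp.cons n μ = Finsupp.cons (k + n) (e + μ) := by
    ext i
    refine Fin.cases ?_ (fun i => ?_) i <;> simp
  rw [coeff_hasse, h, coeff_sepMul, coeff_sepMul, coeff_hasse, coeff_hasse, Fin.prod_univ_succ]
  simp [← Finsupp.single_add]
  ring

lemma map_hasse {S : Type*} [CommRing S] (φ : R →+* S) (μ : σ →₀ ℕ) (P : MvPolynomial σ R) :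
    map φ (hasse μ P) = hasse μ (map φ P) := by
  ext J
  simp [coeff_hasse, coeff_map]

lemma degreeOf_hasse_le (μ : σ →₀ ℕ) (P : MvPolynomial σ R) (i : σ) :
    (hasse μ P).degreeOf i ≤ P.degreeOf i := by
  rw [degreeOf_le_iff]
  intro J hJ
  have h : coeff (J + μ) P ≠ 0 := fun h => mem_support_iff.1 hJ (by rw [coeff_hasse, h, zero_mul])
  exact (by simp : J i ≤ (J + μ) i).trans (monomial_le_degreeOf i (mem_support_iff.2 h))

lemma length_hasse_le {σ : Type*} [Fintype σ] (μ : σ →₀ ℕ) (P : MvPolynomial σ ℤ) {d : σ → ℕ}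
    (hd : ∀ i, P.degreeOf i ≤ d i) : length (hasse μ P) ≤ 2 ^ (∑ i, d i) * length P := by
  have h : hasse μ P = ∑ e ∈ P.support, hasse μ (monomial e (coeff e P)) := by
    rw [← map_sum, ← P.as_sum]
  rw [h, length.eq_1 P, Finset.mul_sum]
  refine (length_sum_le _ _).trans (Finset.sum_le_sum fun e he => ?_)
  rw [hasse_monomial, length_monomial, mul_comm]
  refine (norm_mul_le _ _).trans ?_
  gcongr
  rw [← Nat.cast_prod, Int.norm_natCast]
  have : ∏ i, (e i).choose (μ i) ≤ 2 ^ ∑ i, d i := by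
    rw [← Finset.prod_pow_eq_pow_sum]
    refine Finset.prod_le_prod' fun i _ => ((e i).choose_le_two_pow _).trans ?_
    exact Nat.pow_le_pow_right (by norm_num) ((monomial_le_degreeOf i he).trans (hd i))
  exact_mod_cast this

end Separate

end SUnitEquation

namespace SUnitEquation

/-! ### The order of vanishing of a polynomial in one variable -/

section OneVariable

open Polynomial

lemma isPrimitive_linear {u w : ℤ} (h : IsCoprime u w) : (C w * X - C u : ℤ[X]).IsPrimitive := by
  intro r hr
  rw [C_dvd_iff_dvd_coeff] at hr
  have h0 := hr 0
  have h1 := hr 1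
  rw [coeff_sub, coeff_C_mul_X, coeff_C_zero, if_neg zero_ne_one, zero_sub, dvd_neg] at h0
  rw [coeff_sub, coeff_C_mul_X, coeff_C_succ, if_pos rfl, sub_zero] at h1
  exact h.isUnit_of_dvd' h0 h1

lemma pow_le_of_linear_pow_dvd {Q : ℤ[X]} (hQ : Q ≠ 0) {u w : ℤ} (hw : w ≠ 0) {n : ℕ}
    (h : (C w * X - C u) ^ n ∣ Q) {B : ℝ} (hB : ∀ k, (|Q.coeff k| : ℝ) ≤ B) :
    max |(u : ℝ)| |(w : ℝ)| ^ n ≤ B := by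
  obtain ⟨T, rfl⟩ := h
  have key : ∀ a b : ℤ, b ≠ 0 → ∀ k, a ^ n * b = ((C w * X - C u) ^ n * T).coeff k →
      |(a : ℝ)| ^ n ≤ B := by
    intro a b hb k hk
    refine le_trans ?_ (hB k)
    rw [← hk]
    push_cast
    rw [abs_mul, abs_pow]
    refine le_mul_of_one_le_right (by positivity) ?_
    exact_mod_cast Int.one_le_abs hb
  have hT : T ≠ 0 := right_ne_zero_of_mul hQ
  have hwn : |(w : ℝ)| ^ n ≤ B := by
    have hl : (C w * X - C u : ℤ[X]).leadingCoeff = w := by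
      rw [sub_eq_add_neg, ← C_neg]
      exact leadingCoeff_linear hw
    refine key w T.leadingCoeff (leadingCoeff_ne_zero.2 hT) ((C w * X - C u) ^ n * T).natDegree ?_
    rw [coeff_natDegree, leadingCoeff_mul, leadingCoeff_pow, hl]
  rcases eq_or_ne u 0 with rfl | hu
  · simpa using hwn
  rcases max_choice |(u : ℝ)| |(w : ℝ)| with h | h <;> rw [h]
  · have hl : (C w * X - C u : ℤ[X]).trailingCoeff = -u := by
      rw [trailingCoeff, natTrailingDegree_eq_zero.2 (Or.inr (by simpa using hu))]
      simp
    have hp : ∀ k : ℕ, ((C w * X - C u : ℤ[X]) ^ k).trailingCoeff = (-u) ^ k := by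
      intro k
      induction k with
      | zero => simp [trailingCoeff]
      | succ k ih => rw [pow_succ, trailingCoeff_mul, ih, hl, pow_succ]
    have := key (-u) T.trailingCoeff (trailingCoeff_nonzero_iff_nonzero.2 hT)
      ((C w * X - C u) ^ n * T).natTrailingDegree (by
        rw [← hp, ← trailingCoeff_mul]; rfl)
    simpa using this
  · exact hwn

lemma coeff_uniqueAlgEquiv {R : Type*} [CommRing R] (V : MvPolynomial Unit R) (n : ℕ) :
    (MvPolynomial.uniqueAlgEquiv R Unit V).coeff n = V.coeff (Finsupp.single () n) := by
  classical
  induction V using MvPolynomial.induction_on' with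
  | add p q hp hq => simp only [map_add, coeff_add, MvPolynomial.coeff_add, hp, hq]
  | monomial e a =>
    rw [MvPolynomial.uniqueAlgEquiv_monomial, coeff_monomial, MvPolynomial.coeff_monomial]
    congr 1
    rw [eq_iff_iff]
    constructor
    · rintro rfl
      ext
      simp
    · rintro rfl
      simp

lemma exists_coeff_shift_ne_zero {V : MvPolynomial Unit ℚ} (hV : V ≠ 0) {v : ℚ} (hv : v ≠ 0)
    {B : ℝ} (hB : ∀ n, ∃ z : ℤ, (z : ℚ) = v * V.coeff (Finsupp.single () n) ∧ |(z : ℝ)| ≤ B)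
    {u w : ℤ} (hc : IsCoprime u w) (hw : w ≠ 0) :
    ∃ n : ℕ, (shift (fun _ => (u / w : ℚ)) V).coeff (Finsupp.single () n) ≠ 0 ∧
      max |(u : ℝ)| |(w : ℝ)| ^ n ≤ B := by
  set p : ℚ[X] := MvPolynomial.uniqueAlgEquiv ℚ Unit V with hp
  have hp0 : p ≠ 0 := (map_ne_zero_iff _ (AlgEquiv.injective _)).2 hV
  set r : ℚ := u / w with hr
  have hw' : (w : ℚ) ≠ 0 := by exact_mod_cast hw
  have hcomp : MvPolynomial.uniqueAlgEquiv ℚ Unit (shift (fun _ => r) V) = p.comp (X + C r) := by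
    have : (MvPolynomial.uniqueAlgEquiv ℚ Unit).toAlgHom.comp (shift fun _ => r) =
        (aeval (X + C r)).comp (MvPolynomial.uniqueAlgEquiv ℚ Unit).toAlgHom := by
      ext i
      simp [shift]
    exact DFunLike.congr_fun this V
  refine ⟨p.rootMultiplicity r, ?_, ?_⟩
  · rw [← coeff_uniqueAlgEquiv, hcomp, rootMultiplicity_eq_natTrailingDegree]
    refine trailingCoeff_nonzero_iff_nonzero.2 fun h => hp0 ?_
    rcases comp_eq_zero_iff.1 h with h | h
    · exact h
    · have := congrArg (coeff · 1) h.2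
      simp at this
  · choose z hz hzB using hB
    obtain ⟨Q, hQ⟩ : ∃ Q : ℤ[X], Q.map (Int.castRingHom ℚ) = C v * p := by
      have : C v * p ∈ lifts (Int.castRingHom ℚ) := by
        rw [lifts_iff_coeff_lifts]
        intro n
        exact ⟨z n, by rw [coeff_C_mul, hp, coeff_uniqueAlgEquiv, ← hz]; rfl⟩
      exact (mem_lifts _).1 this
    have hQz : ∀ n, Q.coeff n = z n := by
      intro n
      have := congrArg (coeff · n) hQ
      simp only [coeff_map, coeff_C_mul, hp, coeff_uniqueAlgEquiv, ← hz] at this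
      rw [eq_intCast] at this
      exact_mod_cast this
    have hQ0 : Q ≠ 0 := by
      rintro rfl
      rw [Polynomial.map_zero] at hQ
      exact mul_ne_zero (C_ne_zero.2 hv) hp0 hQ.symm
    refine pow_le_of_linear_pow_dvd hQ0 hw ?_ (fun k => by rw [hQz]; exact hzB k)
    have hprim : ((C w * X - C u : ℤ[X]) ^ p.rootMultiplicity r).IsPrimitive := by
      generalize p.rootMultiplicity r = n
      induction n with
      | zero => rw [pow_zero]; exact isPrimitive_one
      | succ n ih => rw [pow_succ]; exact ih.mul (isPrimitive_linear hc)
    rw [IsPrimitive.Int.dvd_iff_map_cast_dvd_map_cast _ _ hprim, hQ]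
    have hlin : (C w * X - C u : ℤ[X]).map (Int.castRingHom ℚ) = C (w : ℚ) * (X - C r) := by
      rw [Polynomial.map_sub, Polynomial.map_mul, map_C, map_C, map_X, mul_sub, ← C_mul, hr,
        mul_div_cancel₀ _ hw']
      rfl
    rw [Polynomial.map_pow, hlin, mul_pow, ← C_pow]
    refine ((isUnit_C.2 (pow_ne_zero _ hw').isUnit).mul_left_dvd).2 ?_
    exact (pow_rootMultiplicity_dvd p r).mul_left _

end OneVariable

end SUnitEquation

namespace SUnitEquation

open MvPolynomial Finset

/-! ### Roth's lemma -/

lemma exists_det_eq_sepMul {m : ℕ} {P : MvPolynomial (Fin (m + 1)) ℚ} (hP : P ≠ 0) {d : ℕ}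
    (hd : P.degreeOf 0 ≤ d) :
    ∃ s : ℕ, 1 ≤ s ∧ s ≤ d + 1 ∧ ∃ (μ : Fin s → Fin m →₀ ℕ) (n : Fin s → Fin s)
      (U : MvPolynomial (Fin m) ℚ) (V : MvPolynomial Unit ℚ), (∀ i, (μ i).degree < s) ∧
      Function.Injective n ∧ U ≠ 0 ∧ V ≠ 0 ∧
      (Matrix.of fun i j => hasse (Finsupp.cons (n j : ℕ) (μ i)) P).det = sepMul U V := by
  classical
  obtain ⟨s, hs, f, g, hf, hg, h⟩ := exists_linearIndependent_sum (sepMul (R := ℚ) (m := m)) (d + 1)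
    (fun k => (finSuccEquiv ℚ m P).coeff k) (fun k => monomial (Finsupp.single () (k : ℕ)) 1)
  rw [← eq_sum_sepMul P hd] at h
  obtain ⟨μ, hμ, hU⟩ := exists_wronskian_ne_zero s f hf
  obtain ⟨ν, hν, hV⟩ := exists_wronskian_ne_zero s g hg
  have hν' : ∀ j, ν j () < s := fun j => by
    refine lt_of_le_of_lt ?_ (hν j)
    exact Finsupp.le_degree () (ν j)
  refine ⟨s, ?_, hs, μ, fun j => ⟨ν j (), hν' j⟩, _, _, hμ, ?_, hU, hV, ?_⟩
  · rcases Nat.eq_zero_or_pos s with rfl | h0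
    · exact absurd (by simpa using h.symm) hP
    · exact h0
  · intro i j hij
    by_contra hne
    refine hV (Matrix.det_zero_of_row_eq hne ?_)
    have : ν i = ν j := by
      ext
      simpa using hij
    ext1 k
    simp [this]
  · have hmat : (Matrix.of fun i j => hasse (Finsupp.cons (ν j ()) (μ i)) P) =
        (Matrix.of fun i k => rename Fin.succ (hasse (μ i) (f k))) *
          (Matrix.of fun j k => rename (fun _ : Unit => (0 : Fin (m + 1)))
            (hasse (ν j) (g k))).transpose := by
      ext1 i j
      have hj : ν j = Finsupp.single () (ν j ()) := by ext; simp
      rw [Matrix.mul_apply, Matrix.of_apply, ← h, map_sum]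
      refine Finset.sum_congr rfl fun k _ => ?_
      rw [hasse_sepMul, ← hj]
      rfl
    rw [show (Matrix.of fun i j => hasse (Finsupp.cons (((⟨ν j (), hν' j⟩ : Fin s) : ℕ)) (μ i)) P)
      = _ from hmat, Matrix.det_mul, Matrix.det_transpose, sepMul_apply, AlgHom.map_det,
      AlgHom.map_det]
    rfl

lemma length_det_le {σ : Type*} {s : ℕ} (A : Matrix (Fin s) (Fin s) (MvPolynomial σ ℤ)) {B : ℝ}
    (hA : ∀ i j, length (A i j) ≤ B) : length A.det ≤ (s * B) ^ s := by
  rw [Matrix.det_apply]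
  have hB : ∀ τ : Equiv.Perm (Fin s), length (Equiv.Perm.sign τ • ∏ i, A (τ i) i) ≤ B ^ s := by
    intro τ
    have h : length (Equiv.Perm.sign τ • ∏ i, A (τ i) i) = length (∏ i, A (τ i) i) := by
      rcases Int.units_eq_one_or (Equiv.Perm.sign τ) with h | h <;> rw [h]
      · rw [one_smul]
      · rw [Units.neg_smul, one_smul, length_neg]
    rw [h]
    refine (length_prod_le _ _).trans ?_
    refine (Finset.prod_le_prod (fun _ _ => length_nonneg _) fun i _ => hA (τ i) i).trans ?_
    simp
  refine (length_sum_le _ _).trans ((Finset.sum_le_sum fun τ _ => hB τ).trans ?_)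
  rw [Finset.sum_const, Finset.card_univ, Fintype.card_perm, Fintype.card_fin, nsmul_eq_mul,
    mul_pow]
  rcases Nat.eq_zero_or_pos s with rfl | hs
  · simp
  · have : 0 ≤ B := (length_nonneg _).trans (hA ⟨0, hs⟩ ⟨0, hs⟩)
    gcongr
    exact_mod_cast Nat.factorial_le_pow s

lemma degreeOf_det_le {σ : Type*} {s : ℕ} (A : Matrix (Fin s) (Fin s) (MvPolynomial σ ℤ)) (l : σ)
    {d : ℕ} (hA : ∀ i j, (A i j).degreeOf l ≤ d) : A.det.degreeOf l ≤ s * d := by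
  rw [Matrix.det_apply]
  refine (degreeOf_sum_le _ _ _).trans (Finset.sup_le fun τ _ => ?_)
  have h : degreeOf l (Equiv.Perm.sign τ • ∏ i, A (τ i) i) ≤ degreeOf l (∏ i, A (τ i) i) := by
    rcases Int.units_eq_one_or (Equiv.Perm.sign τ) with h | h <;> rw [h]
    · rw [one_smul]
    · rw [Units.neg_smul, one_smul, degreeOf_neg]
  refine h.trans ((degreeOf_prod_le _ _ _).trans ?_)
  refine (Finset.sum_le_sum fun i _ => hA (τ i) i).trans ?_
  simp

lemma length_coeff_finSuccEquiv_le {m : ℕ} (W : MvPolynomial (Fin (m + 1)) ℤ) (n : ℕ) :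
    length ((finSuccEquiv ℤ m W).coeff n) ≤ length W := by
  classical
  rw [length, length]
  simp only [finSuccEquiv_coeff_coeff]
  have hinj : Function.Injective fun e : Fin m →₀ ℕ => Finsupp.cons n e := fun a b h => by
    rw [← Finsupp.tail_cons n a, ← Finsupp.tail_cons n b]
    exact congrArg Finsupp.tail h
  refine (Finset.sum_map _ ⟨_, hinj⟩ fun e => ‖coeff e W‖).symm.trans_le ?_
  refine Finset.sum_le_sum_of_subset_of_nonneg ?_ fun _ _ _ => norm_nonneg _
  intro e he
  obtain ⟨e', he', rfl⟩ := Finset.mem_map.1 he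
  rw [mem_support_iff, finSuccEquiv_coeff_coeff] at he'
  exact mem_support_iff.2 he'

lemma sum_max_ge {s d : ℕ} (hd : 1 ≤ d) (hs : s ≤ d + 1) {A : ℝ} (hA : 0 ≤ A) (hA1 : A ≤ 1) :
    s * (A ^ 2 / 8) ≤ ∑ j : Fin s, max 0 (A - (1 / d : ℝ) * (j : ℕ)) := by
  have hd' : (1 : ℝ) ≤ d := by exact_mod_cast hd
  have hs' : (s : ℝ) ≤ d + 1 := by exact_mod_cast hs
  rw [Fin.sum_univ_eq_sum_range (fun j => max 0 (A - (1 / d : ℝ) * (j : ℕ)))]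
  set k := ⌈A * s / 4⌉₊ with hk
  have hks : k ≤ s := by
    rw [hk, Nat.ceil_le]
    nlinarith [(Nat.cast_nonneg s : (0 : ℝ) ≤ s)]
  calc s * (A ^ 2 / 8) = (A * s / 4) * (A / 2) := by ring
    _ ≤ k * (A / 2) := by gcongr; exact Nat.le_ceil _
    _ = ∑ _j ∈ range k, A / 2 := by simp
    _ ≤ ∑ j ∈ range k, max 0 (A - (1 / d : ℝ) * (j : ℕ)) := by
      refine Finset.sum_le_sum fun j hj => le_max_of_le_right ?_
      have h1 : (j : ℝ) < A * s / 4 := Nat.lt_ceil.1 (Finset.mem_range.1 hj)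
      have h2 : (1 / d : ℝ) * j ≤ A / 2 := by
        rw [one_div, inv_mul_le_iff₀ (by linarith)]
        nlinarith
      linarith
    _ ≤ _ := Finset.sum_le_sum_of_subset_of_nonneg
      (fun j hj => Finset.mem_range.2 ((Finset.mem_range.1 hj).trans_le hks))
      fun _ _ _ => le_max_left _ _

lemma IndexGE.mono {σ R : Type*} [Fintype σ] [CommRing R] {w : σ → ℝ} {ξ : σ → R} {a b : ℝ}
    {P : MvPolynomial σ R} (hP : IndexGE w ξ b P) (hab : a ≤ b) : IndexGE w ξ a P :=
  fun J hJ => hP J (hJ.trans_le hab)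

lemma exists_coeff_shift_ne_zero_of_not_indexGE {σ R : Type*} [Fintype σ] [CommRing R]
    {w : σ → ℝ} {ξ : σ → R} {c : ℝ} {P : MvPolynomial σ R} (hP : ¬ IndexGE w ξ c P) :
    ∃ J : σ →₀ ℕ, ∑ i, w i * J i < c ∧ coeff J (shift ξ P) ≠ 0 := by
  simpa [IndexGE] using hP

lemma indexGE_wronskian {m s : ℕ} {d : Fin (m + 1) → ℕ} (hd : ∀ j, 1 ≤ d j) {ε σ : ℝ}
    (hσ : 0 ≤ σ) (hs : s ≤ d 0 + 1) (hε1 : ε ≤ 1) (hσε : σ ≤ ε)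
    (hratio : ∀ j : Fin m, (d 0 : ℝ) ≤ σ * d j.succ)
    {P : MvPolynomial (Fin (m + 1)) ℚ} {ξ : Fin (m + 1) → ℚ}
    (hP : IndexGE (fun j => 1 / (d j : ℝ)) ξ ε P) {μ : Fin s → Fin m →₀ ℕ} {n : Fin s → Fin s}
    (hμ : ∀ i, (μ i).degree < s) (hn : Function.Injective n) :
    IndexGE (fun j => 1 / (d j : ℝ)) ξ (s * ((ε - σ) ^ 2 / 8))
      (Matrix.of fun i j => hasse (Finsupp.cons (n j : ℕ) (μ i)) P).det := by
  have hd0 : (0 : ℝ) < d 0 := by exact_mod_cast hd 0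
  refine (IndexGE.det (c := fun j => max 0 (ε - σ - (1 / d 0 : ℝ) * (n j : ℕ)))
    (fun j => by positivity) fun i j => ?_).mono ?_
  · rw [Matrix.of_apply]
    rcases max_choice 0 (ε - σ - (1 / d 0 : ℝ) * (n j : ℕ)) with h | h <;> rw [h]
    · exact IndexGE.of_nonpos (fun j => by positivity) le_rfl _
    refine (hP.hasse _).mono ?_
    rw [Fin.sum_univ_succ, Finsupp.cons_zero]
    simp only [Finsupp.cons_succ]
    have h1 : ∑ l : Fin m, 1 / (d l.succ : ℝ) * (μ i l : ℕ) ≤ σ := by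
      calc ∑ l : Fin m, 1 / (d l.succ : ℝ) * (μ i l : ℕ)
          ≤ ∑ l : Fin m, σ / d 0 * (μ i l : ℕ) := by
            refine Finset.sum_le_sum fun l _ => mul_le_mul_of_nonneg_right ?_ (Nat.cast_nonneg _)
            have : (0 : ℝ) < d l.succ := by exact_mod_cast hd _
            rw [div_le_div_iff₀ this hd0, one_mul]
            exact hratio l
        _ = σ / d 0 * ((μ i).degree : ℕ) := by
            rw [← Finset.mul_sum, Finsupp.degree_eq_sum]
            push_cast
            rfl
        _ ≤ σ / d 0 * d 0 := by
            have : (μ i).degree ≤ d 0 := by have := hμ i; omega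
            gcongr
        _ = σ := by field_simp
    linarith
  · have hb : Function.Bijective n := Finite.injective_iff_bijective.1 hn
    rw [hb.sum_comp fun j : Fin s => max 0 (ε - σ - (1 / d 0 : ℝ) * (j : ℕ))]
    exact sum_max_ge (hd 0) hs (by linarith) (by linarith)

theorem roth_lemma (m : ℕ) : ∀ ε : ℝ, 0 < ε → ∃ σ : ℝ, 0 < σ ∧ ∃ C : ℝ, 0 ≤ C ∧
    ∀ d : Fin m → ℕ, (∀ j, 1 ≤ d j) → (∀ i j, i < j → (d i : ℝ) ≤ σ * d j) →
    ∀ P : MvPolynomial (Fin m) ℤ, P ≠ 0 → (∀ j, P.degreeOf j ≤ d j) →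
    ∀ u w : Fin m → ℤ, (∀ j, IsCoprime (u j) (w j)) → (∀ j, w j ≠ 0) →
    (∀ j, Real.log (length P) + C * ∑ i, (d i : ℝ) ≤
      σ * d j * Real.log (max |(u j : ℝ)| |(w j : ℝ)|)) →
    ¬ IndexGE (fun j => 1 / (d j : ℝ)) (fun j => (u j / w j : ℚ)) ε
      (map (Int.castRingHom ℚ) P) := by
  induction m with
  | zero =>
    intro ε hε
    refine ⟨1, one_pos, 0, le_rfl, fun d _ _ P hP _ u w _ _ _ h => hP ?_⟩
    apply map_injective _ (RingHom.injective_int (Int.castRingHom ℚ))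
    apply shift_injective fun j => (u j / w j : ℚ)
    rw [map_zero, map_zero]
    ext J
    exact h J (by simpa using hε)
  | succ m ih =>
    intro ε₀ hε₀
    set ε := min ε₀ 1 with hεdef
    have hε : 0 < ε := lt_min hε₀ one_pos
    have hε1 : ε ≤ 1 := min_le_right _ _
    set ε' := ε ^ 2 / 128 with hε'
    have hε'0 : 0 < ε' := by positivity
    obtain ⟨σ', hσ', C', hC', IH⟩ := ih ε' hε'0
    set σ := min σ' ε' with hσdef
    have hσ : 0 < σ := lt_min hσ' hε'0
    refine ⟨σ, hσ, C' + 2, by linarith, fun d hd hratio P hP hdeg u w huw hw hlog hidx => ?_⟩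
    replace hidx := hidx.mono (min_le_left ε₀ 1)
    rw [← hεdef] at hidx
    set P' := map (Int.castRingHom ℚ) P with hP'
    set ξ : Fin (m + 1) → ℚ := fun j => u j / w j with hξ
    have hinj : Function.Injective (Int.castRingHom ℚ) := RingHom.injective_int _
    have hP'0 : P' ≠ 0 := (map_ne_zero_iff _ (map_injective _ hinj)).2 hP
    obtain ⟨s, hs1, hsd, μ, n, U, V, hμ, hn, hU, hV, hdet⟩ :=
      exists_det_eq_sepMul (d := d 0) hP'0 (by
        refine degreeOf_le_iff.2 fun e he => ?_
        exact (monomial_le_degreeOf 0 (support_map_subset _ _ he)).trans (hdeg 0))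
    have hWidx := indexGE_wronskian hd hσ.le hsd hε1 (by
      have : ε' ≤ ε := by rw [hε']; nlinarith
      exact (min_le_right _ _).trans this)
      (fun j => hratio 0 j.succ (Fin.succ_pos j)) hidx hμ hn
    rw [hdet] at hWidx
    set W : MvPolynomial (Fin (m + 1)) ℤ :=
      (Matrix.of fun i j => hasse (Finsupp.cons (n j : ℕ) (μ i)) P).det with hWdef
    have hmapW : map (Int.castRingHom ℚ) W = sepMul U V := by
      rw [← hdet, hWdef, RingHom.map_det]
      congr 1
      ext1 i j
      exact map_hasse _ _ _
    have hWcoeff : ∀ k e, ((coeff (Finsupp.cons k e) W : ℤ) : ℚ) =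
        coeff e U * coeff (Finsupp.single () k) V := by
      intro k e
      rw [← coeff_sepMul, ← hmapW, coeff_map]
      rfl
    set S : ℝ := ∑ i, (d i : ℝ) with hS
    have hS0 : (d 0 : ℝ) ≤ S :=
      Finset.single_le_sum (f := fun i => (d i : ℝ)) (fun i _ => Nat.cast_nonneg _)
        (Finset.mem_univ 0)
    have hs0 : (0 : ℝ) < s := by exact_mod_cast hs1
    have hΛ : 1 ≤ length P := one_le_length hP
    have hW0 : W ≠ 0 := by
      rintro h
      rw [h, map_zero] at hmapW
      obtain ⟨e, he⟩ := ne_zero_iff.1 hU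
      obtain ⟨k, hk⟩ := ne_zero_iff.1 hV
      have hk' : k = Finsupp.single () (k ()) := by ext; simp
      have := coeff_sepMul U V (k ()) e
      rw [← hmapW, coeff_zero, ← hk'] at this
      exact mul_ne_zero he hk this.symm
    have hWlen : Real.log (length W) ≤ s * (2 * S + Real.log (length P)) := by
      have h1 : length W ≤ (s * (2 ^ (∑ i, d i) * length P)) ^ s :=
        length_det_le _ fun i j => length_hasse_le _ _ hdeg
      refine (Real.log_le_log (length_pos hW0) h1).trans ?_
      rw [Real.log_pow, Real.log_mul (by positivity) (by positivity),
        Real.log_mul (by positivity) (by positivity), Real.log_pow]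
      have h2 : Real.log s ≤ S := by
        have := Real.log_le_sub_one_of_pos hs0
        have h3 : (s : ℝ) ≤ d 0 + 1 := by exact_mod_cast hsd
        linarith
      have h3 : ((∑ i, d i : ℕ) : ℝ) * Real.log 2 ≤ S := by
        rw [hS, Nat.cast_sum]
        have : Real.log 2 ≤ 1 := by linarith [Real.log_two_lt_d9]
        exact mul_le_of_le_one_right (Finset.sum_nonneg fun _ _ => Nat.cast_nonneg _) this
      exact mul_le_mul_of_nonneg_left (by linarith) hs0.le
    obtain ⟨e, he⟩ := ne_zero_iff.1 hU
    obtain ⟨k, hk⟩ := ne_zero_iff.1 hV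
    have hk' : k = Finsupp.single () (k ()) := by ext; simp
    -- the order of vanishing of `V`
    obtain ⟨l, hl, hlB⟩ := exists_coeff_shift_ne_zero hV he (B := length W)
      (fun q => ⟨coeff (Finsupp.cons q e) W, hWcoeff q e, by
        simpa [Int.norm_eq_abs] using norm_coeff_le_length W (Finsupp.cons q e)⟩) (huw 0) (hw 0)
    set L := Real.log (max |(u 0 : ℝ)| |(w 0 : ℝ)|) with hL
    have hmax : ∀ j, 1 ≤ max |(u j : ℝ)| |(w j : ℝ)| := fun j =>
      le_max_of_le_right (by exact_mod_cast Int.one_le_abs (hw j))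
    have hd0 : (0 : ℝ) < d 0 := by exact_mod_cast hd 0
    have hlσ : (l : ℝ) ≤ s * σ * d 0 := by
      have h1 : l * L ≤ s * (2 * S + Real.log (length P)) := by
        refine le_trans ?_ hWlen
        rw [hL, ← Real.log_pow]
        exact Real.log_le_log (pow_pos (one_pos.trans_le (hmax 0)) _) hlB
      have h2 := hlog 0
      have hCS : 0 ≤ C' * S := mul_nonneg hC' (hd0.le.trans hS0)
      have hlogP : 0 ≤ Real.log (length P) := Real.log_nonneg hΛ
      have hLpos : 0 < L := by
        by_contra hneg
        have : σ * d 0 * L ≤ 0 := mul_nonpos_of_nonneg_of_nonpos (by positivity) (not_lt.1 hneg)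
        nlinarith
      have h3 : l * L ≤ (s * σ * d 0) * L := by
        calc l * L ≤ s * (2 * S + Real.log (length P)) := h1
          _ ≤ s * (σ * d 0 * L) := by gcongr; linarith
          _ = _ := by ring
      exact le_of_mul_le_mul_right h3 hLpos
    -- the index of `U`
    set U' : MvPolynomial (Fin m) ℤ := (finSuccEquiv ℤ m W).coeff (k ()) with hU'
    have hmapU' : map (Int.castRingHom ℚ) U' = C (coeff k V) * U := by
      ext e'
      rw [coeff_map, hU', finSuccEquiv_coeff_coeff, coeff_C_mul, eq_intCast, hWcoeff, ← hk',
        mul_comm]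
    have hU'0 : U' ≠ 0 := by
      intro h
      rw [h, map_zero] at hmapU'
      exact mul_ne_zero (C_ne_zero.2 hk) hU hmapU'.symm
    obtain ⟨J, hJ, hJU⟩ := exists_coeff_shift_ne_zero_of_not_indexGE <|
      IH (fun j => s * d j.succ) (fun j => Nat.mul_pos hs1 (hd _))
      (fun i j hij => by
        have h1 := hratio i.succ j.succ (Fin.succ_lt_succ_iff.2 hij)
        have h2 : σ * (d j.succ : ℝ) ≤ σ' * d j.succ := by gcongr; exact min_le_left _ _
        push_cast
        nlinarith) U' hU'0
      (fun j => (degreeOf_coeff_finSuccEquiv _ _ _).trans <| degreeOf_det_le _ _ fun _ _ =>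
        (degreeOf_hasse_le _ _ _).trans (hdeg _))
      (fun j => u j.succ) (fun j => w j.succ) (fun j => huw _) (fun j => hw _)
      (fun j => by
        have h1 : Real.log (length U') ≤ s * (2 * S + Real.log (length P)) :=
          (Real.log_le_log (length_pos hU'0) (length_coeff_finSuccEquiv_le _ _)).trans hWlen
        have h2 : ∑ i : Fin m, ((s * d i.succ : ℕ) : ℝ) ≤ s * S := by
          push_cast
          rw [← Finset.mul_sum, hS, Fin.sum_univ_succ]
          gcongr
          linarith
        have h3 := hlog j.succ
        have h4 : C' * ∑ i : Fin m, ((s * d i.succ : ℕ) : ℝ) ≤ C' * (s * S) := by gcongr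
        have h5 : 0 ≤ Real.log (max |(u j.succ : ℝ)| |(w j.succ : ℝ)|) :=
          Real.log_nonneg (hmax _)
        have h6 : σ * d j.succ * Real.log (max |(u j.succ : ℝ)| |(w j.succ : ℝ)|) ≤
            σ' * d j.succ * Real.log (max |(u j.succ : ℝ)| |(w j.succ : ℝ)|) := by
          gcongr; exact min_le_left _ _
        push_cast at h4 ⊢
        have h7 : s * (Real.log (length P) + (C' + 2) * S) ≤
            s * (σ' * d j.succ * Real.log (max |(u j.succ : ℝ)| |(w j.succ : ℝ)|)) := by
          gcongr; exact h3.trans h6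
        linarith)
    rw [hmapU', map_mul, shift, aeval_C, algebraMap_eq, coeff_C_mul, ← shift] at hJU
    have hJU' := right_ne_zero_of_mul hJU
    refine mul_ne_zero hJU' hl ?_
    have hss : sepMul (shift (fun i : Fin m => (u i.succ / w i.succ : ℚ)) U)
        (shift (fun _ => (u 0 / w 0 : ℚ)) V) = shift ξ (sepMul U V) := (shift_sepMul ξ U V).symm
    rw [← coeff_sepMul, hss]
    refine hWidx _ ?_
    rw [Fin.sum_univ_succ, Finsupp.cons_zero]
    simp only [Finsupp.cons_succ]
    have h1 : 1 / (d 0 : ℝ) * l ≤ s * σ := by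
      rw [one_div, inv_mul_le_iff₀ hd0]
      linarith
    have h2 : ∑ i : Fin m, 1 / (d i.succ : ℝ) * (J i : ℕ) < s * ε' := by
      have : ∑ i : Fin m, 1 / (d i.succ : ℝ) * (J i : ℕ) =
          s * ∑ i : Fin m, 1 / ((s * d i.succ : ℕ) : ℝ) * (J i : ℕ) := by
        rw [Finset.mul_sum]
        refine Finset.sum_congr rfl fun i _ => ?_
        have : (d i.succ : ℝ) ≠ 0 := by have := hd i.succ; positivity
        push_cast
        field_simp
      rw [this]
      gcongr
    have h3 : σ ≤ ε' := min_le_right _ _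
    have h4 : σ + ε' ≤ (ε - σ) ^ 2 / 8 := by
      have : ε / 2 ≤ ε - σ := by
        have : ε' ≤ ε / 2 := by rw [hε']; nlinarith
        linarith
      have h5 : (ε / 2) ^ 2 ≤ (ε - σ) ^ 2 := by gcongr
      nlinarith
    nlinarith

end SUnitEquation

namespace SUnitEquation

open Finset

/-! ### Counting balanced exponents -/

lemma sum_piAntidiag_apply {n : ℕ} (d : ℕ) (i : Fin n) :
    n * ∑ a ∈ piAntidiag (univ : Finset (Fin n)) d, a i =
      d * (piAntidiag (univ : Finset (Fin n)) d).card := by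
  have hsymm : ∀ l : Fin n, ∑ a ∈ piAntidiag (univ : Finset (Fin n)) d, a l =
      ∑ a ∈ piAntidiag (univ : Finset (Fin n)) d, a i := by
    intro l
    refine Finset.sum_equiv (Equiv.arrowCongr (Equiv.swap l i) (Equiv.refl ℕ)) ?_ ?_
    · intro a
      have h : univ.sum (Equiv.arrowCongr (Equiv.swap l i) (Equiv.refl ℕ) a) = univ.sum a :=
        Equiv.sum_comp (Equiv.swap l i) a
      simp only [mem_piAntidiag, mem_univ, implies_true, and_true, h]
    · intro a _
      simp
  calc n * ∑ a ∈ piAntidiag (univ : Finset (Fin n)) d, a i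
      = ∑ l : Fin n, ∑ a ∈ piAntidiag (univ : Finset (Fin n)) d, a l := by
        rw [Finset.sum_congr rfl fun l _ => hsymm l]
        simp
    _ = ∑ a ∈ piAntidiag (univ : Finset (Fin n)) d, d := by
        rw [Finset.sum_comm]
        exact Finset.sum_congr rfl fun a ha => (mem_piAntidiag.1 ha).1
    _ = _ := by rw [Finset.sum_const, smul_eq_mul, mul_comm]

lemma sum_exp_piAntidiag_le {n d : ℕ} (hn : 1 ≤ n) (hd : 1 ≤ d) (i : Fin n) {t : ℝ} (ht : 0 ≤ t)
    (ht1 : t ≤ 1) :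
    ∑ a ∈ piAntidiag (univ : Finset (Fin n)) d, Real.exp (t * ((a i : ℕ) / d : ℝ)) ≤
      (piAntidiag (univ : Finset (Fin n)) d).card * Real.exp (t / n + t ^ 2) := by
  set E := piAntidiag (univ : Finset (Fin n)) d with hE
  have hd0 : (0 : ℝ) < d := by exact_mod_cast hd
  have hn0 : (0 : ℝ) < n := by exact_mod_cast hn
  have h1 : ∀ a ∈ E, Real.exp (t * ((a i : ℕ) / d : ℝ)) ≤ 1 + t ^ 2 + t / d * (a i : ℕ) := by
    intro a ha
    have hai : a i ≤ d := by
      rw [← (mem_piAntidiag.1 ha).1]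
      exact Finset.single_le_sum (fun _ _ => Nat.zero_le _) (Finset.mem_univ i)
    have hx : ((a i : ℕ) / d : ℝ) ≤ 1 := by
      rw [div_le_one hd0]
      exact_mod_cast hai
    have hx0 : (0 : ℝ) ≤ (a i : ℕ) / d := by positivity
    have htx : t * ((a i : ℕ) / d : ℝ) ≤ t := mul_le_of_le_one_right ht hx
    have htx0 : 0 ≤ t * ((a i : ℕ) / d : ℝ) := by positivity
    have := abs_le.1 (Real.abs_exp_sub_one_sub_id_le (x := t * ((a i : ℕ) / d : ℝ)) (by
      rw [abs_of_nonneg htx0]; linarith))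
    have h2 : (t * ((a i : ℕ) / d : ℝ)) ^ 2 ≤ t ^ 2 := by gcongr
    have h3 : t / d * (a i : ℕ) = t * ((a i : ℕ) / d : ℝ) := by ring
    linarith [this.2]
  refine (Finset.sum_le_sum h1).trans ?_
  rw [Finset.sum_add_distrib, Finset.sum_const, ← Finset.mul_sum, nsmul_eq_mul]
  have h2 : (∑ a ∈ E, ((a i : ℕ) : ℝ)) = d * E.card / n := by
    rw [eq_div_iff hn0.ne', mul_comm]
    exact_mod_cast sum_piAntidiag_apply d i
  rw [h2]
  have h3 := Real.add_one_le_exp (t / n + t ^ 2)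
  calc E.card * (1 + t ^ 2) + t / d * (d * E.card / n) = E.card * (t / n + t ^ 2 + 1) := by
        field_simp
        ring
    _ ≤ _ := by gcongr

/-- The exponents of the monomials of multidegree `d`. -/
def blockExponents {m n : ℕ} (d : Fin m → ℕ) : Finset (Fin m → Fin n → ℕ) :=
  Fintype.piFinset fun j => piAntidiag univ (d j)

lemma card_unbalanced_le {m n : ℕ} (hn : 1 ≤ n) {d : Fin m → ℕ} (hd : ∀ j, 1 ≤ d j) (i : Fin n)
    {ε : ℝ} (hε : 0 ≤ ε) (hε1 : ε ≤ 1) :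
    (((blockExponents d).filter fun e =>
      m * (1 / n + ε : ℝ) < ∑ j, (e j i / d j : ℝ)).card : ℝ) ≤
      Real.exp (-(m * ε ^ 2 / 4)) * (blockExponents (n := n) d).card := by
  set F := (blockExponents d).filter fun e => m * (1 / n + ε : ℝ) < ∑ j, (e j i / d j : ℝ) with hF
  have h1 : (F.card : ℝ) * Real.exp (ε / 2 * (m * (1 / n + ε : ℝ))) ≤
      ∑ e ∈ blockExponents d, Real.exp (ε / 2 * ∑ j, (e j i / d j : ℝ)) := by
    rw [← nsmul_eq_mul, ← Finset.sum_const]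
    refine (Finset.sum_le_sum fun e he => ?_).trans (Finset.sum_le_sum_of_subset_of_nonneg
      (Finset.filter_subset _ _) fun _ _ _ => (Real.exp_pos _).le)
    rw [Real.exp_le_exp]
    exact mul_le_mul_of_nonneg_left (Finset.mem_filter.1 he).2.le (by linarith)
  have h2 : ∑ e ∈ blockExponents d, Real.exp (ε / 2 * ∑ j, (e j i / d j : ℝ)) =
      ∏ j, ∑ a ∈ piAntidiag (univ : Finset (Fin n)) (d j),
        Real.exp (ε / 2 * (a i / d j : ℝ)) := by
    rw [Finset.prod_univ_sum]
    refine Finset.sum_congr rfl fun e _ => ?_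
    rw [Finset.mul_sum, Real.exp_sum]
  have h3 : ∏ j, ∑ a ∈ piAntidiag (univ : Finset (Fin n)) (d j),
      Real.exp (ε / 2 * (a i / d j : ℝ)) ≤
      (blockExponents (n := n) d).card * Real.exp (ε / 2 / n + (ε / 2) ^ 2) ^ m := by
    refine (Finset.prod_le_prod (fun j _ => Finset.sum_nonneg fun _ _ => (Real.exp_pos _).le)
      fun j _ => sum_exp_piAntidiag_le hn (hd j) i (by linarith) (by linarith)).trans ?_
    rw [Finset.prod_mul_distrib, blockExponents, Fintype.card_piFinset]
    simp
  rw [h2] at h1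
  have h4 := h1.trans h3
  rw [← Real.exp_nat_mul, ← le_div_iff₀ (Real.exp_pos _), mul_div_assoc, ← Real.exp_sub,
    mul_comm] at h4
  refine h4.trans (le_of_eq ?_)
  congr 2
  have : (n : ℝ) ≠ 0 := by positivity
  field_simp
  ring

lemma blockExponents_nonempty {m n : ℕ} (hn : 1 ≤ n) (d : Fin m → ℕ) :
    (blockExponents (n := n) d).Nonempty := by
  refine ⟨fun j => Pi.single ⟨0, hn⟩ (d j), ?_⟩
  simp [blockExponents, Fintype.mem_piFinset]

lemma card_blockExponents_le {m n : ℕ} (d : Fin m → ℕ) :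
    (blockExponents (n := n) d).card ≤ 2 ^ (n * ∑ j, d j) := by
  rw [blockExponents, Fintype.card_piFinset, Finset.mul_sum, ← Finset.prod_pow_eq_pow_sum]
  refine Finset.prod_le_prod' fun j _ => ?_
  have hsub : piAntidiag (univ : Finset (Fin n)) (d j) ⊆
      Fintype.piFinset fun _ => Finset.range (d j + 1) := by
    intro a ha
    rw [Fintype.mem_piFinset]
    intro i
    rw [Finset.mem_range, Nat.lt_succ_iff, ← (mem_piAntidiag.1 ha).1]
    exact Finset.single_le_sum (fun _ _ => Nat.zero_le _) (Finset.mem_univ i)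
  refine (Finset.card_le_card hsub).trans ?_
  rw [Fintype.card_piFinset]
  simp only [Finset.card_range, Finset.prod_const, Finset.card_univ, Fintype.card_fin]
  rw [mul_comm n, pow_mul]
  exact Nat.pow_le_pow_left (Nat.succ_le_of_lt Nat.lt_two_pow_self) n

end SUnitEquation

namespace SUnitEquation

open MvPolynomial Finset

/-! ### Blockwise linear substitutions -/

section BlockSubst

variable {R S : Type*} [CommRing R] [CommRing S] {m n : ℕ}

/-- The linear form given by row `p.2` of the matrix `A p.1`, in the variables of block `p.1`. -/
noncomputable def blockForm (A : Fin m → Matrix (Fin n) (Fin n) R) (p : Fin m × Fin n) :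
    MvPolynomial (Fin m × Fin n) R :=
  ∑ l, C (A p.1 p.2 l) * X (p.1, l)

/-- Substitute, in each block of variables, the linear forms given by the rows of a matrix. -/
noncomputable def blockSubst (A : Fin m → Matrix (Fin n) (Fin n) R) :
    MvPolynomial (Fin m × Fin n) R →ₐ[R] MvPolynomial (Fin m × Fin n) R :=
  aeval (blockForm A)

lemma blockSubst_comp (A B : Fin m → Matrix (Fin n) (Fin n) R)
    (P : MvPolynomial (Fin m × Fin n) R) :
    blockSubst B (blockSubst A P) = blockSubst (fun j => A j * B j) P := by
  rw [← AlgHom.comp_apply]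
  congr 1
  refine MvPolynomial.algHom_ext fun p => ?_
  simp only [blockSubst, AlgHom.comp_apply, aeval_X, blockForm, map_sum, map_mul,
    Matrix.mul_apply, Finset.sum_mul, Finset.mul_sum, algHom_C, algebraMap_eq, mul_assoc]
  rw [Finset.sum_comm]

lemma blockSubst_one (P : MvPolynomial (Fin m × Fin n) R) :
    blockSubst (fun _ => (1 : Matrix (Fin n) (Fin n) R)) P = P := by
  conv_rhs => rw [← AlgHom.id_apply (R := R) P]
  congr 1
  refine MvPolynomial.algHom_ext fun p => ?_
  simp [blockSubst, blockForm, Matrix.one_apply]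

lemma map_blockSubst (φ : R →+* S) (A : Fin m → Matrix (Fin n) (Fin n) R)
    (P : MvPolynomial (Fin m × Fin n) R) :
    map φ (blockSubst A P) = blockSubst (fun j => (A j).map φ) (map φ P) := by
  induction P using MvPolynomial.induction_on with
  | C a => simp [blockSubst]
  | add P Q hP hQ => simp only [map_add, hP, hQ]
  | mul_X P p hP =>
    rw [map_mul, map_mul, map_mul, map_mul, hP, map_X]
    simp [blockSubst, blockForm]

lemma blockSubst_eq_sum (A : Fin m → Matrix (Fin n) (Fin n) R)
    (P : MvPolynomial (Fin m × Fin n) R) :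
    blockSubst A P = ∑ f ∈ P.support, C (coeff f P) * ∏ p, blockForm A p ^ f p := by
  rw [blockSubst, aeval_def, eval₂_eq', algebraMap_eq]

/-- The multidegree of exponents with variables in blocks. -/
def blockWeight (p : Fin m × Fin n) : Fin m → ℕ := Pi.single p.1 1

lemma weight_blockWeight (e : Fin m × Fin n →₀ ℕ) (j : Fin m) :
    Finsupp.weight blockWeight e j = ∑ i, e (j, i) := by
  rw [Finsupp.weight_eq_sum, Finset.sum_apply, Fintype.sum_prod_type]
  rw [Finset.sum_eq_single j]
  · simp [blockWeight]
  · intro l _ hl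
    simp [blockWeight, Pi.single_eq_of_ne' hl]
  · simp

lemma _root_.MvPolynomial.IsWeightedHomogeneous.sum_eq {P : MvPolynomial (Fin m × Fin n) R}
    {d : Fin m → ℕ}
    (hP : IsWeightedHomogeneous blockWeight P d) {e : Fin m × Fin n →₀ ℕ} (he : coeff e P ≠ 0)
    (j : Fin m) : ∑ i, e (j, i) = d j := by
  rw [← weight_blockWeight, hP he]

lemma isWeightedHomogeneous_prod_blockForm (A : Fin m → Matrix (Fin n) (Fin n) R)
    (f : Fin m × Fin n →₀ ℕ) :
    IsWeightedHomogeneous blockWeight (∏ p, blockForm A p ^ f p)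
      (Finsupp.weight blockWeight f) := by
  rw [Finsupp.weight_eq_sum]
  refine IsWeightedHomogeneous.prod _ _ _ fun p _ => IsWeightedHomogeneous.pow ?_ _
  exact IsWeightedHomogeneous.sum _ _ _ fun l _ => (isWeightedHomogeneous_X R _ _).C_mul _

lemma isWeightedHomogeneous_blockSubst (A : Fin m → Matrix (Fin n) (Fin n) R)
    {P : MvPolynomial (Fin m × Fin n) R} {d : Fin m → ℕ}
    (hP : IsWeightedHomogeneous blockWeight P d) :
    IsWeightedHomogeneous blockWeight (blockSubst A P) d := by
  rw [blockSubst_eq_sum]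
  refine IsWeightedHomogeneous.sum _ _ _ fun f hf => IsWeightedHomogeneous.C_mul ?_ _
  rw [← hP (mem_support_iff.1 hf)]
  exact isWeightedHomogeneous_prod_blockForm A f

end BlockSubst

lemma length_prod_blockForm_le {R : Type*} [NormedCommRing R] [NormOneClass R] {m n : ℕ}
    (A : Fin m → Matrix (Fin n) (Fin n) R) (f : Fin m × Fin n →₀ ℕ) :
    length (∏ p, blockForm A p ^ f p) ≤ ∏ p : Fin m × Fin n, (∑ l, ‖A p.1 p.2 l‖) ^ f p := by
  refine (length_prod_le _ _).trans (Finset.prod_le_prod (fun _ _ => length_nonneg _) fun p _ => ?_)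
  refine (length_pow_le _ _).trans (pow_le_pow_left₀ (length_nonneg _) ?_ _)
  refine (length_sum_le _ _).trans (Finset.sum_le_sum fun l _ => ?_)
  refine (length_mul_le _ _).trans ?_
  rw [length_C, length_X, mul_one]

end SUnitEquation

namespace SUnitEquation

open MvPolynomial Finset

/-! ### Auxiliary polynomials -/

lemma exists_int_vec_le {α β : Type*} [Fintype α] [Fintype β] (A : Matrix α β ℤ)
    (hcard : 2 * Fintype.card α ≤ Fintype.card β) (hβ : 0 < Fintype.card β) {B : ℝ} (hB : 1 ≤ B)
    (hA : ∀ i j, |(A i j : ℝ)| ≤ B) :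
    ∃ t : β → ℤ, t ≠ 0 ∧ A.mulVec t = 0 ∧ ∀ j, |(t j : ℝ)| ≤ Fintype.card β * B := by
  classical
  have hN : (1 : ℝ) ≤ Fintype.card β := by exact_mod_cast hβ
  have hNB : 1 ≤ Fintype.card β * B := one_le_mul_of_one_le_of_one_le hN hB
  rcases Nat.eq_zero_or_pos (Fintype.card α) with hα | hα
  · have := Fintype.card_eq_zero_iff.1 hα
    obtain ⟨j₀⟩ := Fintype.card_pos_iff.1 hβ
    refine ⟨Pi.single j₀ 1, by simp, Subsingleton.elim _ _, fun j => ?_⟩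
    rcases eq_or_ne j j₀ with rfl | hj
    · simpa using hNB
    · simpa [Pi.single_eq_of_ne hj] using zero_le_one.trans hNB
  · let _ : SeminormedAddCommGroup (Matrix α β ℤ) := Matrix.seminormedAddCommGroup
    obtain ⟨t, ht, hAt, hle⟩ := Int.Matrix.exists_ne_zero_int_vec_norm_le A (by omega) hα
    refine ⟨t, ht, hAt, fun j => ?_⟩
    have h1 : ‖A‖ ≤ B := (Matrix.norm_le_iff (zero_le_one.trans hB)).2 fun i j => by
      rw [Int.norm_eq_abs]
      exact_mod_cast hA i j
    have h2 : |(t j : ℝ)| ≤ ‖t‖ := by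
      have := norm_le_pi_norm t j
      rwa [Int.norm_eq_abs] at this
    have h3 : (1 : ℝ) ≤ Fintype.card β * max 1 ‖A‖ :=
      one_le_mul_of_one_le_of_one_le hN (le_max_left _ _)
    have hc : 2 * (Fintype.card α : ℝ) ≤ Fintype.card β := by exact_mod_cast hcard
    have hα' : (0 : ℝ) < Fintype.card α := by exact_mod_cast hα
    have h4 : (Fintype.card α : ℝ) / (Fintype.card β - Fintype.card α) ≤ 1 := by
      rw [div_le_one (by linarith)]
      linarith
    refine h2.trans (hle.trans ((Real.rpow_le_rpow_of_exponent_le h3 h4).trans ?_))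
    rw [Real.rpow_one]
    exact mul_le_mul_of_nonneg_left (max_le hB h1) (by linarith)

/-- Curried exponents as a finitely supported function. -/
noncomputable def blockExponent {m n : ℕ} (e : Fin m → Fin n → ℕ) : Fin m × Fin n →₀ ℕ :=
  Finsupp.equivFunOnFinite.symm fun p => e p.1 p.2

@[simp] lemma blockExponent_apply {m n : ℕ} (e : Fin m → Fin n → ℕ) (p : Fin m × Fin n) :
    blockExponent e p = e p.1 p.2 := rfl

lemma blockExponent_injective {m n : ℕ} :
    Function.Injective (blockExponent : (Fin m → Fin n → ℕ) → _) := by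
  intro e f h
  funext j i
  simpa using DFunLike.congr_fun h (j, i)

lemma mem_blockExponents {m n : ℕ} {d : Fin m → ℕ} {e : Fin m → Fin n → ℕ} :
    e ∈ blockExponents d ↔ ∀ j, ∑ i, e j i = d j := by
  simp [blockExponents, Fintype.mem_piFinset]

theorem exists_auxiliary {n : ℕ} (hn : 1 ≤ n) {K : Type*} [Fintype K]
    (T : K → Matrix (Fin n) (Fin n) ℤ) {ε : ℝ} (hε : 0 < ε) (hε1 : ε ≤ 1) :
    ∃ m : ℕ, 1 ≤ m ∧ ∃ C : ℝ, 0 ≤ C ∧ ∀ d : Fin m → ℕ, (∀ j, 1 ≤ d j) →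
      ∃ P : MvPolynomial (Fin m × Fin n) ℤ, P ≠ 0 ∧ IsWeightedHomogeneous blockWeight P d ∧
        Real.log (length P) ≤ C * ∑ j, (d j : ℝ) ∧
        ∀ k e, coeff e (blockSubst (fun _ => T k) P) ≠ 0 → ∀ i,
          ∑ j, (e (j, i) / d j : ℝ) ≤ m * (1 / n + ε) := by
  classical
  set κ : ℝ := Fintype.card K * n with hκ
  have hκ0 : 0 ≤ κ := by positivity
  obtain ⟨m, hm⟩ := exists_nat_ge (max 1 (8 * κ / ε ^ 2))
  have hm1 : 1 ≤ m := by exact_mod_cast (le_max_left _ _).trans hm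
  have hm2 : 2 * κ ≤ m * ε ^ 2 / 4 := by
    have := (le_max_right _ _).trans hm
    rw [div_le_iff₀ (by positivity)] at this
    linarith
  set b : ℝ := 1 + ∑ k, ∑ i, ∑ l, ‖T k i l‖ with hb
  have hb1 : 1 ≤ b := by
    rw [hb]
    have : 0 ≤ ∑ k, ∑ i, ∑ l, ‖T k i l‖ := by positivity
    linarith
  have hbT : ∀ k i, ∑ l, ‖T k i l‖ ≤ b := by
    intro k i
    have h1 : ∑ l, ‖T k i l‖ ≤ ∑ i, ∑ l, ‖T k i l‖ :=
      Finset.single_le_sum (f := fun i => ∑ l, ‖T k i l‖) (fun _ _ => by positivity) (mem_univ i)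
    have h2 : ∑ i, ∑ l, ‖T k i l‖ ≤ ∑ k, ∑ i, ∑ l, ‖T k i l‖ :=
      Finset.single_le_sum (f := fun k => ∑ i, ∑ l, ‖T k i l‖) (fun _ _ => by positivity)
        (mem_univ k)
    linarith
  refine ⟨m, hm1, 2 * n * Real.log 2 + Real.log b,
    add_nonneg (by positivity) (Real.log_nonneg hb1), fun d hd => ?_⟩
  set E : Finset (Fin m → Fin n → ℕ) := blockExponents d with hE
  set U : Finset (Fin m → Fin n → ℕ) :=
    E.filter fun e => ∃ i, m * (1 / n + ε : ℝ) < ∑ j, (e j i / d j : ℝ) with hU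
  have hEpos : 0 < E.card := (blockExponents_nonempty hn d).card_pos
  have hUcard : 2 * (Fintype.card K * U.card) ≤ E.card := by
    have h1 : (U.card : ℝ) ≤ n * (Real.exp (-(m * ε ^ 2 / 4)) * E.card) := by
      have hsub : U ⊆ univ.biUnion fun i : Fin n =>
          E.filter fun e => m * (1 / n + ε : ℝ) < ∑ j, (e j i / d j : ℝ) := by
        intro e he
        obtain ⟨he, i, hi⟩ := mem_filter.1 he
        exact mem_biUnion.2 ⟨i, mem_univ i, mem_filter.2 ⟨he, hi⟩⟩
      have h2 : (U.card : ℝ) ≤ ∑ i : Fin n,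
          ((E.filter fun e => m * (1 / n + ε : ℝ) < ∑ j, (e j i / d j : ℝ)).card : ℝ) := by
        exact_mod_cast (card_le_card hsub).trans card_biUnion_le
      refine h2.trans ((Finset.sum_le_sum fun i _ => card_unbalanced_le hn hd i hε.le hε1).trans ?_)
      simp [hE]
    have h3 : 2 * κ * Real.exp (-(m * ε ^ 2 / 4)) ≤ 1 := by
      rw [Real.exp_neg, mul_inv_le_iff₀ (Real.exp_pos _), one_mul]
      linarith [Real.add_one_le_exp (m * ε ^ 2 / 4)]
    have h4 : (2 * (Fintype.card K * U.card) : ℝ) ≤ E.card := by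
      calc (2 * (Fintype.card K * U.card) : ℝ)
          ≤ 2 * (Fintype.card K * (n * (Real.exp (-(m * ε ^ 2 / 4)) * E.card))) := by gcongr
        _ = 2 * κ * Real.exp (-(m * ε ^ 2 / 4)) * E.card := by rw [hκ]; ring
        _ ≤ 1 * E.card := by gcongr
        _ = E.card := one_mul _
    exact_mod_cast h4
  have hEN : (E.card : ℝ) ≤ 2 ^ (n * ∑ j, d j) := by exact_mod_cast card_blockExponents_le d
  set s := ∑ j, d j with hs
  have hbound : ∀ k, ∀ e ∈ E, ∀ f, |((coeff f (blockSubst (fun _ => T k)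
      (monomial (blockExponent e) 1)) : ℤ) : ℝ)| ≤ b ^ s := by
    intro k e he f
    rw [← Int.norm_eq_abs]
    have hmon : blockSubst (fun _ : Fin m => T k) (monomial (blockExponent e) 1) =
        ∏ p, blockForm (fun _ => T k) p ^ blockExponent e p := by
      rw [blockSubst, aeval_monomial, map_one, one_mul, Finsupp.prod_fintype _ _ (by simp)]
    rw [hmon]
    refine (norm_coeff_le_length _ _).trans ((length_prod_blockForm_le _ _).trans ?_)
    refine (Finset.prod_le_prod (fun _ _ => by positivity) fun p _ =>
      pow_le_pow_left₀ (by positivity) (hbT k p.2) _).trans (le_of_eq ?_)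
    rw [Finset.prod_pow_eq_pow_sum, Fintype.sum_prod_type, hs]
    congr 1
    exact Finset.sum_congr rfl fun j _ => by simpa using mem_blockExponents.1 he j
  obtain ⟨t, ht, hAt, htle⟩ := exists_int_vec_le
    (Matrix.of fun (x : K × U) (e : E) => coeff (blockExponent x.2.1)
      (blockSubst (fun _ => T x.1) (monomial (blockExponent e.1) 1)))
    (by simpa using hUcard) (by simpa using hEpos) (one_le_pow₀ hb1)
    (fun x e => hbound x.1 e.1 e.2 _)
  simp only [Fintype.card_coe] at htle
  set P : MvPolynomial (Fin m × Fin n) ℤ := ∑ e : E, monomial (blockExponent e.1) (t e) with hP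
  have hcoeff : ∀ e : E, coeff (blockExponent e.1) P = t e := by
    intro e
    rw [hP, coeff_sum, Finset.sum_eq_single e]
    · simp
    · intro f _ hf
      rw [coeff_monomial, if_neg]
      exact fun h => hf (Subtype.ext (blockExponent_injective h))
    · simp
  have hP0 : P ≠ 0 := by
    rintro h
    refine ht (funext fun e => ?_)
    rw [← hcoeff e, h]
    simp
  have hPhom : IsWeightedHomogeneous blockWeight P d := by
    refine IsWeightedHomogeneous.sum _ _ _ fun e _ => isWeightedHomogeneous_monomial _ _ _ ?_
    funext j
    rw [weight_blockWeight]
    simpa using mem_blockExponents.1 e.2 j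
  refine ⟨P, hP0, hPhom, ?_, ?_⟩
  · have hlen : length P ≤ E.card * (E.card * b ^ s) := by
      refine (length_sum_le _ _).trans ((Finset.sum_le_sum (g := fun _ => E.card * b ^ s)
        fun e _ => ?_).trans ?_)
      · rw [length_monomial, Int.norm_eq_abs]
        exact_mod_cast htle e
      · simp
    have hlen2 : length P ≤ 2 ^ (n * s) * (2 ^ (n * s) * b ^ s) := hlen.trans (by gcongr)
    refine (Real.log_le_log (length_pos hP0) hlen2).trans (le_of_eq ?_)
    rw [Real.log_mul (by positivity) (by positivity), Real.log_mul (by positivity) (by positivity),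
      Real.log_pow, Real.log_pow, hs]
    push_cast
    ring
  · intro k e he i
    by_contra! hlt
    have hhom := isWeightedHomogeneous_blockSubst (fun _ => T k) hPhom
    set e' : Fin m → Fin n → ℕ := fun j i => e (j, i) with he'
    have hee : blockExponent e' = e := by
      ext p
      simp [he']
    have heU : e' ∈ U := mem_filter.2 ⟨mem_blockExponents.2 fun j => hhom.sum_eq he j, i, hlt⟩
    refine he ?_
    have := congrFun hAt (k, ⟨e', heU⟩)
    rw [Matrix.mulVec, dotProduct] at this
    simp only [Matrix.of_apply, hee, Pi.zero_apply] at this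
    rw [← this, hP, map_sum, coeff_sum]
    refine Finset.sum_congr rfl fun f _ => ?_
    rw [mul_comm, ← coeff_C_mul, ← algebraMap_eq, ← AlgHom.commutes (blockSubst fun _ => T k),
      ← map_mul, algebraMap_eq, C_mul_monomial, mul_one]

end SUnitEquation

namespace SUnitEquation

open MvPolynomial Finset

/-! ### From hyperplanes to points -/

section Section

variable {m k : ℕ}

/-- The exponents of the variables `(j, 0)`. -/
noncomputable def headExponent (e : Fin m × Fin (k + 2) →₀ ℕ) : Fin m →₀ ℕ :=
  Finsupp.equivFunOnFinite.symm fun j => e (j, 0)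

/-- The exponents of the variables `(j, i)` with `2 ≤ i`. -/
noncomputable def tailExponent (e : Fin m × Fin (k + 2) →₀ ℕ) : Fin m × Fin k →₀ ℕ :=
  Finsupp.equivFunOnFinite.symm fun p => e (p.1, p.2.succ.succ)

/-- The family of variables `(j, i)`, with those for `i = 0` replaced by `g j` and those for `i = 1`
replaced by `1`. -/
noncomputable def affineVar {A : Type*} [CommRing A] (g : Fin m → MvPolynomial (Fin m × Fin k) A)
    (p : Fin m × Fin (k + 2)) : MvPolynomial (Fin m × Fin k) A :=
  Fin.cases (g p.1) (fun i => Fin.cases 1 (fun i => X (p.1, i)) i) p.2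

lemma affineVar_monomial {A : Type*} [CommRing A]
    (g : Fin m → MvPolynomial (Fin m × Fin k) A)
    (e : Fin m × Fin (k + 2) →₀ ℕ) (a : ℤ) :
    eval₂Hom (Int.castRingHom _) (affineVar g) (monomial e a) =
      eval₂Hom (Int.castRingHom _) g (monomial (headExponent e) a) *
        monomial (tailExponent e) 1 := by
  rw [eval₂Hom_monomial, eval₂Hom_monomial, monomial_eq, C_1, one_mul, mul_assoc,
    Finsupp.prod_fintype _ _ (by simp), Finsupp.prod_fintype _ _ (by simp),
    Finsupp.prod_fintype _ _ (by simp), Fintype.prod_prod_type, Fintype.prod_prod_type,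
    ← Finset.prod_mul_distrib]
  congr 1
  refine Finset.prod_congr rfl fun j _ => ?_
  rw [Fin.prod_univ_succ, Fin.prod_univ_succ]
  have h0 : affineVar g (j, 0) = g j := rfl
  have h1 : affineVar g (j, Fin.succ 0) = 1 := rfl
  have h2 : ∀ i : Fin k, affineVar g (j, i.succ.succ) = X (j, i) := fun _ => rfl
  rw [h0, h1, one_pow, one_mul]
  simp only [h2]
  rfl

/-- The polynomial `P` with the variables `(j, 1)` set to `1`, as a polynomial in the variables
`(j, i)` with `2 ≤ i`. -/
noncomputable def dehomogenize (P : MvPolynomial (Fin m × Fin (k + 2)) ℤ) :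
    MvPolynomial (Fin m × Fin k) (MvPolynomial (Fin m) ℤ) :=
  eval₂Hom (Int.castRingHom _) (affineVar fun j => C (X j)) P

lemma coeff_dehomogenize (P : MvPolynomial (Fin m × Fin (k + 2)) ℤ) (s : Fin m × Fin k →₀ ℕ) :
    coeff s (dehomogenize P) = ∑ e ∈ P.support with tailExponent e = s,
      monomial (headExponent e) (coeff e P) := by
  classical
  conv_lhs => rw [P.as_sum]
  rw [dehomogenize, map_sum, coeff_sum, Finset.sum_filter]
  refine Finset.sum_congr rfl fun e _ => ?_
  rw [affineVar_monomial]
  have : eval₂Hom (Int.castRingHom _) (fun j => C (X j) :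
      Fin m → MvPolynomial (Fin m × Fin k) (MvPolynomial (Fin m) ℤ))
      (monomial (headExponent e) (coeff e P)) = C (monomial (headExponent e) (coeff e P)) := by
    rw [eval₂Hom_monomial, monomial_eq, map_mul, Finsupp.prod, Finsupp.prod, map_prod]
    simp
  rw [this, C_mul_monomial, mul_one, coeff_monomial]

lemma length_coeff_dehomogenize_le (P : MvPolynomial (Fin m × Fin (k + 2)) ℤ)
    (s : Fin m × Fin k →₀ ℕ) : length (coeff s (dehomogenize P)) ≤ length P := by
  rw [coeff_dehomogenize]
  refine (length_sum_le _ _).trans ?_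
  simp only [length_monomial]
  exact Finset.sum_le_sum_of_subset_of_nonneg (Finset.filter_subset _ _) fun _ _ _ => norm_nonneg _

lemma degreeOf_coeff_dehomogenize_le {P : MvPolynomial (Fin m × Fin (k + 2)) ℤ} {d : Fin m → ℕ}
    (hP : IsWeightedHomogeneous blockWeight P d) (s : Fin m × Fin k →₀ ℕ) (j : Fin m) :
    degreeOf j (coeff s (dehomogenize P)) ≤ d j := by
  rw [coeff_dehomogenize]
  refine (degreeOf_sum_le _ _ _).trans (Finset.sup_le fun e he => ?_)
  have he' := mem_support_iff.1 (Finset.mem_filter.1 he).1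
  rw [degreeOf_monomial_eq _ _ he', ← hP.sum_eq he' j]
  exact Finset.single_le_sum (f := fun i => e (j, i)) (fun _ _ => Nat.zero_le _) (mem_univ 0)

lemma dehomogenize_ne_zero {P : MvPolynomial (Fin m × Fin (k + 2)) ℤ} {d : Fin m → ℕ}
    (hP : IsWeightedHomogeneous blockWeight P d) (hP0 : P ≠ 0) : dehomogenize P ≠ 0 := by
  classical
  obtain ⟨e, he⟩ := MvPolynomial.ne_zero_iff.1 hP0
  intro h
  have h1 := coeff_dehomogenize P (tailExponent e)
  rw [h, coeff_zero] at h1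
  have h2 := congrArg (coeff (headExponent e)) h1
  rw [coeff_zero, coeff_sum, Finset.sum_eq_single e] at h2
  · exact he (by simpa using h2.symm)
  · intro f hf hne
    obtain ⟨hf, hft⟩ := Finset.mem_filter.1 hf
    rw [coeff_monomial, if_neg]
    intro hfh
    refine hne ?_
    have e0 : ∀ j, f (j, 0) = e (j, 0) := fun j => DFunLike.congr_fun hfh j
    have e2 : ∀ j (i : Fin k), f (j, i.succ.succ) = e (j, i.succ.succ) :=
      fun j i => DFunLike.congr_fun hft (j, i)
    ext ⟨j, i⟩
    refine Fin.cases (e0 j) (fun i => Fin.cases ?_ (e2 j) i) i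
    have hs := (hP.sum_eq (mem_support_iff.1 hf) j).trans (hP.sum_eq he j).symm
    rw [Fin.sum_univ_succ, Fin.sum_univ_succ, Fin.sum_univ_succ (n := k + 1),
      Fin.sum_univ_succ (n := k), e0 j, Finset.sum_congr rfl fun i _ => e2 j i] at hs
    omega
  · intro h
    exact absurd (by simpa using he) h

lemma eval₂Hom_affineVar_eq {A : Type*} [CommRing A] (g : Fin m → MvPolynomial (Fin m × Fin k) A)
    (P : MvPolynomial (Fin m × Fin (k + 2)) ℤ) :
    eval₂Hom (Int.castRingHom _) (affineVar g) P =
      eval₂Hom (eval₂Hom (Int.castRingHom _) g) X (dehomogenize P) := by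
  induction P using MvPolynomial.induction_on' with
  | add p q hp hq =>
    rw [map_add, hp, hq, dehomogenize, dehomogenize, dehomogenize, map_add, map_add]
  | monomial e a =>
    classical
    have h : dehomogenize (monomial e a : MvPolynomial (Fin m × Fin (k + 2)) ℤ) =
        monomial (tailExponent e) (monomial (headExponent e) a) := by
      ext1 s
      rw [coeff_dehomogenize, coeff_monomial]
      by_cases ha : a = 0
      · simp [ha]
      · rw [support_monomial, if_neg ha, Finset.sum_filter, Finset.sum_singleton, coeff_monomial,
          if_pos rfl]
    rw [affineVar_monomial, h, coe_eval₂Hom (f := eval₂Hom _ _), eval₂_monomial,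
      monomial_eq (a := (1 : A)), C_1, one_mul]

end Section

/-- A monomial of minimal degree is only affected through constant terms. -/
lemma coeff_eval₂Hom_of_forall_degree_le {τ A B : Type*} [CommRing A] [CommRing B]
    (ψ : A →+* MvPolynomial τ B) (F : MvPolynomial τ A) (s : τ →₀ ℕ)
    (hs : ∀ t ∈ F.support, s.degree ≤ t.degree) :
    coeff s (eval₂Hom ψ X F) = constantCoeff (ψ (coeff s F)) := by
  classical
  have h1 : eval₂Hom ψ X F = ∑ t ∈ F.support, ψ (coeff t F) * monomial t 1 := by
    rw [coe_eval₂Hom, eval₂_eq]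
    refine Finset.sum_congr rfl fun t _ => ?_
    rw [monomial_eq, C_1, one_mul, Finsupp.prod]
  rw [h1, coeff_sum]
  by_cases hF : s ∈ F.support
  · rw [Finset.sum_eq_single_of_mem s hF]
    · rw [coeff_mul_monomial', if_pos le_rfl, mul_one, tsub_self]
      rfl
    · intro t ht hts
      rw [coeff_mul_monomial', if_neg]
      intro hle
      refine hts ?_
      have h2 : (s - t) + t = s := tsub_add_cancel_of_le hle
      have h3 := congrArg Finsupp.degree h2
      rw [map_add] at h3
      have h4 : s - t = 0 := by
        rw [← Finsupp.degree_eq_zero_iff]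
        have := hs t ht
        omega
      rw [h4, zero_add] at h2
      exact h2
  · rw [notMem_support_iff.1 hF, map_zero, map_zero]
    refine Finset.sum_eq_zero fun t ht => ?_
    rw [coeff_mul_monomial', if_neg]
    intro hle
    refine hF ?_
    have h2 : (s - t) + t = s := tsub_add_cancel_of_le hle
    have h3 := congrArg Finsupp.degree h2
    rw [map_add] at h3
    have h4 : s - t = 0 := by
      rw [← Finsupp.degree_eq_zero_iff]
      have := hs t ht
      omega
    rw [h4, zero_add] at h2
    rwa [← h2]

theorem exists_indexGE_of_hyperplanes {m k : ℕ} {P : MvPolynomial (Fin m × Fin (k + 2)) ℤ}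
    (hP0 : P ≠ 0) {d : Fin m → ℕ} (hP : IsWeightedHomogeneous blockWeight P d)
    (M : Fin m → Matrix (Fin (k + 2)) (Fin (k + 2)) ℚ) (hM : ∀ j, IsUnit (M j).det)
    (p : Fin m → Fin (k + 2) → ℚ) (hp : ∀ j, p j 0 ≠ 0) (c : Fin (k + 2))
    (hc : ∀ j i, M j i c = if i = 0 then 1 else 0)
    (hV : ∀ j l, l ≠ c → ∑ i, p j i * M j i l = 0) (w : Fin m → ℝ) (hw : ∀ j, 0 ≤ w j) {ε : ℝ}
    (hzero : ∀ e : Fin m × Fin (k + 2) →₀ ℕ, ∑ j, w j * e (j, c) < ε →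
      coeff e (blockSubst M (map (Int.castRingHom ℚ) P)) = 0) :
    ∃ Q : MvPolynomial (Fin m) ℤ, Q ≠ 0 ∧ (∀ j, Q.degreeOf j ≤ d j) ∧ length Q ≤ length P ∧
      IndexGE w (fun j => -p j 1 / p j 0) ε (map (Int.castRingHom ℚ) Q) := by
  classical
  obtain ⟨s, hs, hmin⟩ := Finset.exists_min_image (dehomogenize P).support Finsupp.degree
    (support_nonempty.2 (dehomogenize_ne_zero hP hP0))
  refine ⟨coeff s (dehomogenize P), mem_support_iff.1 hs, degreeOf_coeff_dehomogenize_le hP s,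
    length_coeff_dehomogenize_le P s, ?_⟩
  set g : Fin m → MvPolynomial (Fin m × Fin k) (MvPolynomial (Fin m) ℚ) := fun j =>
    C (X j + C (-p j 1 / p j 0)) - ∑ i : Fin k, C (C (p j i.succ.succ / p j 0)) * X (j, i) with hg
  -- the substitution on the variables `z = M⁻¹ Y`
  let Ω : MvPolynomial (Fin m × Fin (k + 2)) ℚ →ₐ[ℚ]
      MvPolynomial (Fin m × Fin k) (MvPolynomial (Fin m) ℚ) :=
    aeval fun q => ∑ i, C (C ((M q.1)⁻¹ q.2 i)) * affineVar g (q.1, i)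
  have hΩ : Ω (blockSubst M (map (Int.castRingHom ℚ) P)) =
      eval₂Hom (Int.castRingHom _) (affineVar g) P := by
    have hcomp : ((Ω.comp (blockSubst M)).toRingHom.comp (map (Int.castRingHom ℚ))) =
        eval₂Hom (Int.castRingHom _) (affineVar g) := by
      refine MvPolynomial.ringHom_ext (fun r => by simp) fun q => ?_
      have h1 : ∀ i, ∑ l, C (C (M q.1 q.2 l)) * (C (C ((M q.1)⁻¹ l i)) * affineVar g (q.1, i)) =
          C (C ((1 : Matrix (Fin (k + 2)) (Fin (k + 2)) ℚ) q.2 i)) * affineVar g (q.1, i) := by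
        intro i
        rw [← Matrix.mul_nonsing_inv _ (hM q.1), Matrix.mul_apply, map_sum, map_sum,
          Finset.sum_mul]
        simp only [map_mul, mul_assoc]
      have h2 : Ω (blockSubst M (X q)) = ∑ l, C (C (M q.1 q.2 l)) *
          ∑ i, C (C ((M q.1)⁻¹ l i)) * affineVar g (q.1, i) := by
        simp only [blockSubst, aeval_X, blockForm, map_sum, map_mul, Ω, algHom_C]
        rfl
      simp only [RingHom.comp_apply, AlgHom.toRingHom_eq_coe, RingHom.coe_coe, AlgHom.comp_apply,
        map_X, eval₂Hom_X', h2]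
      simp only [Finset.mul_sum]
      rw [Finset.sum_comm, Finset.sum_congr rfl fun i _ => h1 i]
      simp [Matrix.one_apply]
    exact RingHom.congr_fun hcomp P
  have hΩc : ∀ j, Ω (X (j, c)) = C (X j) := by
    intro j
    have hrow : ∀ i, (M j)⁻¹ c i = p j i / p j 0 := by
      intro i
      have h1 : Matrix.vecMul (p j) (M j) = Pi.single c (p j 0) := by
        funext l
        rw [Matrix.vecMul, dotProduct]
        rcases eq_or_ne l c with rfl | hl
        · simp [hc]
        · rw [hV j l hl, Pi.single_eq_of_ne hl]
      have h2 : p j = Matrix.vecMul (Pi.single c (p j 0)) (M j)⁻¹ := by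
        rw [← h1, Matrix.vecMul_vecMul, Matrix.mul_nonsing_inv _ (hM j), Matrix.vecMul_one]
      have h3 := congrFun h2 i
      rw [Matrix.single_vecMul] at h3
      rw [eq_div_iff (hp j), h3, mul_comm]
      rfl
    simp only [Ω, aeval_X, hrow]
    rw [Fin.sum_univ_succ, Fin.sum_univ_succ]
    have h0 : affineVar g (j, 0) = g j := rfl
    have h1 : affineVar g (j, Fin.succ 0) = 1 := rfl
    have h2 : ∀ i : Fin k, affineVar g (j, i.succ.succ) = X (j, i) := fun _ => rfl
    simp only [h0, h1, h2]
    simp only [hg]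
    rw [div_self (hp j), neg_div]
    simp only [map_one, map_add, map_neg, one_mul, mul_one, Fin.succ_zero_eq_one]
    ring
  have hid : ∀ Q : MvPolynomial (Fin m) ℚ, shift 0 Q = Q := fun Q => by
    simp [shift]
  have hindex : ∀ t, IndexGE w 0 ε (coeff t (Ω (blockSubst M (map (Int.castRingHom ℚ) P)))) := by
    intro t
    rw [(blockSubst M (map (Int.castRingHom ℚ) P)).as_sum, map_sum, coeff_sum]
    refine IndexGE.sum _ fun e he => ?_
    have hle : ε ≤ ∑ j, w j * e (j, c) := not_lt.1 fun h => mem_support_iff.1 he (hzero e h)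
    rw [monomial_eq, map_mul, Finsupp.prod_fintype _ _ (by simp), Fintype.prod_prod_type]
    simp only [map_prod, map_pow]
    rw [Finset.prod_congr rfl fun j _ => (Finset.mul_prod_erase univ _ (mem_univ c)).symm,
      Finset.prod_mul_distrib, mul_left_comm]
    simp only [hΩc, ← map_pow, ← map_prod]
    rw [coeff_C_mul]
    have hX : IndexGE w 0 (∑ j, w j * e (j, c)) (∏ j, X j ^ e (j, c) : MvPolynomial (Fin m) ℚ) := by
      intro J hJ
      have hmon : (∏ j, X j ^ e (j, c) : MvPolynomial (Fin m) ℚ) =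
          monomial (Finsupp.equivFunOnFinite.symm fun j => e (j, c)) 1 := by
        rw [monomial_eq, C_1, one_mul, Finsupp.prod_fintype _ _ (by simp)]
        rfl
      rw [hid, hmon, coeff_monomial, if_neg]
      rintro rfl
      exact lt_irrefl _ hJ
    rw [← add_zero ε]
    exact (hX.mono hle).mul (IndexGE.of_nonpos hw le_rfl _)
  have hcoeff := coeff_eval₂Hom_of_forall_degree_le
    (eval₂Hom (Int.castRingHom _) g) (dehomogenize P) s hmin
  have hshift : constantCoeff (eval₂Hom (Int.castRingHom _) g (coeff s (dehomogenize P))) =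
      shift (fun j => -p j 1 / p j 0) (map (Int.castRingHom ℚ) (coeff s (dehomogenize P))) := by
    have hcomp : constantCoeff.comp (eval₂Hom (Int.castRingHom _) g) =
        (shift (fun j => -p j 1 / p j 0)).toRingHom.comp (map (Int.castRingHom ℚ)) := by
      refine MvPolynomial.ringHom_ext (fun r => by simp) fun j => ?_
      simp [hg, shift]
    exact RingHom.congr_fun hcomp _
  intro J hJ
  have h0 := hindex s J hJ
  rw [hΩ, eval₂Hom_affineVar_eq, hcoeff, hid, hshift] at h0
  exact h0

end SUnitEquation

namespace SUnitEquation

open MvPolynomial Finset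

/-! ### Size and integrality of coefficients after a substitution -/

lemma coeff_blockSubst_diagonal {R : Type*} [CommRing R] {m n : ℕ} (v : Fin m → Fin n → R)
    (P : MvPolynomial (Fin m × Fin n) R) (e : Fin m × Fin n →₀ ℕ) :
    coeff e (blockSubst (fun j => Matrix.diagonal (v j)) P) =
      (∏ p : Fin m × Fin n, v p.1 p.2 ^ e p) * coeff e P := by
  classical
  have hform : ∀ p, blockForm (fun j => Matrix.diagonal (v j)) p = C (v p.1 p.2) * X p := by
    intro p
    rw [blockForm, Finset.sum_eq_single p.2]
    · rw [Matrix.diagonal_apply_eq]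
    · intro l _ hl
      rw [Matrix.diagonal_apply_ne' _ hl, C_0, zero_mul]
    · simp
  induction P using MvPolynomial.induction_on' with
  | add p q hp hq => rw [map_add, coeff_add, coeff_add, hp, hq, mul_add]
  | monomial f a =>
    have h : blockSubst (fun j => Matrix.diagonal (v j)) (monomial f a) =
        C (∏ p : Fin m × Fin n, v p.1 p.2 ^ f p) * monomial f a := by
      rw [blockSubst, aeval_monomial, monomial_eq, Finsupp.prod_fintype _ _ (by simp),
        Finsupp.prod_fintype _ _ (by simp), algebraMap_eq, map_prod, mul_left_comm,
        ← Finset.prod_mul_distrib]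
      congr 1
      exact Finset.prod_congr rfl fun p _ => by rw [hform, mul_pow, C_pow]
    rw [h, coeff_C_mul, coeff_monomial]
    split_ifs with hfe
    · rw [hfe]
    · rw [mul_zero, mul_zero]

lemma abs_coeff_blockSubst_le {m n : ℕ} (A : Fin m → Matrix (Fin n) (Fin n) ℝ) (c : Fin n)
    (b : Fin m → Fin n → ℝ) (s : Fin m → ℝ) (hs : ∀ j, 0 < s j)
    (hA : ∀ j i l, l ≠ c → |A j i l| ≤ b j i) (hAc : ∀ j i, |A j i c| ≤ b j i * s j)
    (P : MvPolynomial (Fin m × Fin n) ℝ) {B : ℝ}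
    (hB : ∀ f, coeff f P ≠ 0 → ∏ p : Fin m × Fin n, (n * b p.1 p.2) ^ f p ≤ B)
    (e : Fin m × Fin n →₀ ℕ) :
    |coeff e (blockSubst A P)| ≤ (∏ j, s j ^ e (j, c)) * (length P * B) := by
  classical
  set v : Fin m → Fin n → ℝ := fun j => Function.update 1 c (s j) with hv
  set A' : Fin m → Matrix (Fin n) (Fin n) ℝ := fun j i l => A j i l / v j l with hA'
  have hv0 : ∀ j l, 0 < v j l := by
    intro j l
    rcases eq_or_ne l c with rfl | hl
    · simpa [hv] using hs j
    · simp [hv, hl]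
  have hAA' : A = fun j => A' j * Matrix.diagonal (v j) := by
    funext j i l
    rw [Matrix.mul_diagonal, hA', div_mul_cancel₀ _ (hv0 j l).ne']
  have hA'b : ∀ j i l, |A' j i l| ≤ b j i := by
    intro j i l
    rw [hA', abs_div, abs_of_pos (hv0 j l), div_le_iff₀ (hv0 j l)]
    rcases eq_or_ne l c with rfl | hl
    · simpa [hv] using hAc j i
    · simpa [hv, hl] using hA j i l hl
  have hprod : ∏ p : Fin m × Fin n, v p.1 p.2 ^ e p = ∏ j, s j ^ e (j, c) := by
    rw [Fintype.prod_prod_type]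
    refine Finset.prod_congr rfl fun j _ => ?_
    rw [Finset.prod_eq_single c]
    · simp [hv]
    · intro l _ hl
      simp [hv, hl]
    · simp
  rw [hAA', ← blockSubst_comp, coeff_blockSubst_diagonal, hprod, abs_mul,
    abs_of_pos (Finset.prod_pos fun j _ => pow_pos (hs j) _)]
  refine mul_le_mul_of_nonneg_left ?_ (Finset.prod_nonneg fun j _ => (pow_pos (hs j) _).le)
  rw [← Real.norm_eq_abs]
  refine (norm_coeff_le_length _ _).trans ?_
  rw [blockSubst_eq_sum]
  refine (length_sum_le _ _).trans ?_
  rw [length, Finset.sum_mul]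
  refine Finset.sum_le_sum fun f hf => (length_mul_le _ _).trans ?_
  rw [length_C]
  refine mul_le_mul_of_nonneg_left ?_ (norm_nonneg _)
  refine (length_prod_blockForm_le _ _).trans (le_trans ?_ (hB f (mem_support_iff.1 hf)))
  refine Finset.prod_le_prod (fun _ _ => by positivity) fun p _ => ?_
  refine pow_le_pow_left₀ (by positivity) ?_ _
  refine (Finset.sum_le_sum fun l _ => hA'b p.1 p.2 l).trans ?_
  simp

/-- A rational number without `q` in its denominator. -/
def IsIntegralAt (q : ℕ) (x : ℚ) : Prop := ∃ a b : ℤ, ¬ (q : ℤ) ∣ b ∧ x * b = a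

/-- The local ring of rational numbers integral at a prime. -/
def localIntegers (q : ℕ) (hq : q.Prime) : Subring ℚ where
  carrier := {x | IsIntegralAt q x}
  mul_mem' := by
    rintro x y ⟨a, b, hb, h⟩ ⟨a', b', hb', h'⟩
    refine ⟨a * a', b * b', (Nat.prime_iff_prime_int.1 hq).not_dvd_mul hb hb', ?_⟩
    push_cast
    rw [← h, ← h']
    ring
  add_mem' := by
    rintro x y ⟨a, b, hb, h⟩ ⟨a', b', hb', h'⟩
    refine ⟨a * b' + a' * b, b * b', (Nat.prime_iff_prime_int.1 hq).not_dvd_mul hb hb', ?_⟩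
    push_cast
    rw [← h, ← h']
    ring
  one_mem' := ⟨1, 1, (Nat.prime_iff_prime_int.1 hq).not_dvd_one, by simp⟩
  zero_mem' := ⟨0, 1, (Nat.prime_iff_prime_int.1 hq).not_dvd_one, by simp⟩
  neg_mem' := by
    rintro x ⟨a, b, hb, h⟩
    exact ⟨-a, b, hb, by push_cast; rw [← h]; ring⟩

lemma mem_localIntegers {q : ℕ} {hq : q.Prime} {x : ℚ} :
    x ∈ localIntegers q hq ↔ IsIntegralAt q x := Iff.rfl

lemma eq_intCast_of_forall_isIntegralAt {x : ℚ} (hx : ∀ q : ℕ, q.Prime → IsIntegralAt q x) :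
    ∃ a : ℤ, x = a := by
  refine ⟨x.num, ?_⟩
  have hden : x.den = 1 := by
    by_contra h
    obtain ⟨q, hq, hqd⟩ := Nat.exists_prime_and_dvd h
    obtain ⟨a, b, hb, hab⟩ := hx q hq
    have h1 : x.num * b = a * x.den := by
      have h2 : (x.num : ℚ) * b = a * x.den := by
        rw [← hab, mul_right_comm, Rat.mul_den_eq_num]
      exact_mod_cast h2
    have h2 : (x.den : ℤ) ∣ b := by
      refine Int.dvd_of_dvd_mul_right_of_gcd_one (b := x.num) (Dvd.intro_left a h1.symm) ?_
      rw [Int.gcd, Int.natAbs_natCast, Nat.gcd_comm]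
      exact x.reduced
    exact hb ((Int.natCast_dvd_natCast.2 hqd).trans h2)
  exact (Rat.den_eq_one_iff x).1 hden |>.symm

lemma mul_coeff_blockSubst_mem {m n : ℕ} (O : Subring ℚ) (A : Fin m → Matrix (Fin n) (Fin n) ℚ)
    (W : Fin m → Fin n → ℚ) (hW : ∀ j i l, W j i * A j i l ∈ O)
    (Q : MvPolynomial (Fin m × Fin n) ℤ) {N : ℚ}
    (hN : ∀ f, coeff f Q ≠ 0 → ∃ r ∈ O, N = r * ∏ p : Fin m × Fin n, W p.1 p.2 ^ f p)
    (e : Fin m × Fin n →₀ ℕ) :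
    N * coeff e (blockSubst A (map (Int.castRingHom ℚ) Q)) ∈ O := by
  classical
  have hker : ∀ P : MvPolynomial (Fin m × Fin n) ℚ, P ∈ (map O.subtype).range → coeff e P ∈ O := by
    rintro _ ⟨P, rfl⟩
    rw [coeff_map]
    exact (coeff e P).2
  have hC : ∀ r ∈ O, C r ∈ (map (σ := Fin m × Fin n) O.subtype).range := fun r hr =>
    ⟨C ⟨r, hr⟩, by simp⟩
  rw [← coeff_C_mul]
  refine hker _ ?_
  have hsum : blockSubst A (map (Int.castRingHom ℚ) Q) =
      ∑ f ∈ Q.support, C ((coeff f Q : ℤ) : ℚ) * ∏ p, blockForm A p ^ f p := by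
    rw [blockSubst_eq_sum]
    refine Finset.sum_subset_zero_on_sdiff (support_map_subset _ _) (fun f hf => ?_) fun f _ => ?_
    · have h0 := notMem_support_iff.1 (Finset.mem_sdiff.1 hf).2
      rw [coeff_map, eq_intCast] at h0
      rw [h0, C_0, zero_mul]
    · rw [coeff_map]
      rfl
  rw [hsum, Finset.mul_sum]
  refine Subring.sum_mem _ fun f hf => ?_
  obtain ⟨r, hr, hNr⟩ := hN f (mem_support_iff.1 hf)
  have h1 : C N * (C ((coeff f Q : ℤ) : ℚ) * ∏ p, blockForm A p ^ f p) =
      C (r * ((coeff f Q : ℤ) : ℚ)) * ∏ p, (C (W p.1 p.2) * blockForm A p) ^ f p := by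
    simp only [mul_pow, Finset.prod_mul_distrib, hNr, C_mul, map_prod, map_pow]
    ring
  rw [h1]
  refine Subring.mul_mem _ (hC _ (O.mul_mem hr (intCast_mem O _))) (Subring.prod_mem _ fun p _ =>
    Subring.pow_mem _ ?_ _)
  rw [blockForm, Finset.mul_sum]
  refine Subring.sum_mem _ fun l _ => ?_
  rw [← mul_assoc, ← C_mul]
  exact Subring.mul_mem _ (hC _ (hW _ _ _)) ⟨X _, map_X _ _⟩

end SUnitEquation

namespace SUnitEquation

open MvPolynomial Finset

/-! ### Vanishing of coefficients -/

/-- Data describing a hyperplane and a parallelepiped in it that is small for the real and the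
`S`-adic absolute values, at the scale `exp h`. -/
structure ApproxPoint (S : Finset ℕ) {n : ℕ} {K : Type*}
    (T : K → Matrix (Fin (n + 2)) (Fin (n + 2)) ℤ) (k : ℕ → K) (c : Fin (n + 2))
    (γ : ℕ → Fin (n + 2) → ℝ) (ρ : Fin (n + 2) → ℝ) (κ ε h : ℝ) where
  /-- A basis of the whole space, in columns; all but one lie in the hyperplane. -/
  M : Matrix (Fin (n + 2)) (Fin (n + 2)) ℚ
  /-- The coefficients of the hyperplane. -/
  p : Fin (n + 2) → ℚ
  /-- The numerator of `-p 1 / p 0`. -/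
  u : ℤ
  /-- The denominator of `-p 1 / p 0`. -/
  w : ℤ
  /-- The exponents of the denominators at primes in `S`. -/
  a : ℕ → Fin (n + 2) → ℕ
  /-- A common denominator away from `S`. -/
  C : ℕ
  isUnit_det : IsUnit M.det
  apply_c : ∀ i, M i c = if i = 0 then 1 else 0
  p_zero_ne : p 0 ≠ 0
  sum_eq_zero : ∀ l, l ≠ c → ∑ i, p i * M i l = 0
  isCoprime : IsCoprime u w
  w_ne : w ≠ 0
  eq_div : -p 1 / p 0 = u / w
  le_height : κ * h ≤ Real.log (max |(u : ℝ)| |(w : ℝ)|)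
  abs_le : ∀ i l, l ≠ c → |(M i l : ℝ)| ≤ Real.exp (-(h * (ρ i - ε)))
  a_le : ∀ q ∈ S, ∀ i, a q i * Real.log q ≤ h * (γ q i + ε)
  isIntegralAt : ∀ q ∈ S, ∀ i l,
    IsIntegralAt q (q ^ a q i * ((T (k q)).map (Int.castRingHom ℚ) * M) i l)
  one_le_C : 1 ≤ C
  log_C_le : Real.log C ≤ h * ε
  isIntegralAt_of_notMem : ∀ q, q.Prime → q ∉ S → ∀ i l, IsIntegralAt q (C * M i l)

lemma length_map_intCast_le {σ : Type*} (P : MvPolynomial σ ℤ) :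
    length (map (Int.castRingHom ℝ) P) ≤ length P := by
  rw [length_eq_sum_of_subset _ (support_map_subset _ _), length]
  refine Finset.sum_le_sum fun e _ => ?_
  rw [coeff_map, eq_intCast, Int.norm_eq_abs, Real.norm_eq_abs]

section Core

variable {S : Finset ℕ} {n : ℕ} {K : Type*}
  {T : K → Matrix (Fin (n + 2)) (Fin (n + 2)) ℤ} {k : ℕ → K} {c : Fin (n + 2)}
  {γ : ℕ → Fin (n + 2) → ℝ} {ρ : Fin (n + 2) → ℝ} {κ ε : ℝ}
  {m : ℕ} {h : Fin m → ℝ} {d : Fin m → ℕ} {D : ℝ}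

lemma sum_mul_le_of_sum_div_le (hd : ∀ j, 1 ≤ d j)
    (hdD : ∀ j, d j * h j ≤ (1 + ε) * D) (f : Fin m → ℕ) :
    ∑ j, h j * f j ≤ (1 + ε) * D * ∑ j, (f j / d j : ℝ) := by
  rw [Finset.mul_sum]
  refine Finset.sum_le_sum fun j _ => ?_
  have : (0 : ℝ) < d j := by exact_mod_cast hd j
  rw [mul_div_assoc', le_div_iff₀ this]
  nlinarith [hdD j, (Nat.cast_nonneg (f j) : (0 : ℝ) ≤ f j)]

lemma le_sum_mul_of_le_sum_div (hd : ∀ j, 1 ≤ d j)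
    (hdD : ∀ j, D ≤ d j * h j) (f : Fin m → ℕ) :
    D * ∑ j, (f j / d j : ℝ) ≤ ∑ j, h j * f j := by
  rw [Finset.mul_sum]
  refine Finset.sum_le_sum fun j _ => ?_
  have : (0 : ℝ) < d j := by exact_mod_cast hd j
  rw [mul_div_assoc', div_le_iff₀ this]
  nlinarith [hdD j, (Nat.cast_nonneg (f j) : (0 : ℝ) ≤ f j)]

/-- Exponents bounded above on average in each variable are bounded below as well. -/
lemma le_sum_div_of_sum_div_le {N : ℕ} (hN : 1 ≤ N) (hε : 0 ≤ ε) (hd : ∀ j, 1 ≤ d j)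
    {f : Fin m → Fin N → ℕ}
    (hf : ∀ j, ∑ i, f j i = d j) (hbal : ∀ i, ∑ j, (f j i / d j : ℝ) ≤ m * (1 / N + ε))
    (i : Fin N) :
    m * (1 / N - N * ε : ℝ) ≤ ∑ j, (f j i / d j : ℝ) := by
  have h1 : ∑ i, ∑ j, (f j i / d j : ℝ) = m := by
    rw [Finset.sum_comm]
    have : ∀ j, ∑ i, (f j i / d j : ℝ) = 1 := fun j => by
      have hj : (0 : ℝ) < d j := by exact_mod_cast hd j
      rw [← Finset.sum_div, div_eq_one_iff_eq hj.ne']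
      exact_mod_cast hf j
    simp [this]
  rw [← Finset.add_sum_erase univ _ (mem_univ i)] at h1
  have h2 : ∑ i' ∈ univ.erase i, ∑ j, (f j i' / d j : ℝ) ≤ (N - 1) * (m * (1 / N + ε)) := by
    refine (Finset.sum_le_sum fun i' _ => hbal i').trans ?_
    rw [Finset.sum_const, Finset.card_erase_of_mem (mem_univ i), Finset.card_univ, Fintype.card_fin,
      nsmul_eq_mul, Nat.cast_sub hN, Nat.cast_one]
  have hN' : (0 : ℝ) < N := by exact_mod_cast hN
  have h3 : (m : ℝ) - (N - 1) * (m * (1 / N + ε)) = m * (1 / N - N * ε) + m * ε := by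
    field_simp
    ring
  have h4 : 0 ≤ m * ε := by positivity
  linarith

lemma sum_blocks_mul (f : Fin m × Fin (n + 2) → ℕ) (y : Fin (n + 2) → ℝ) :
    ∑ p : Fin m × Fin (n + 2), f p * (h p.1 * y p.2) = ∑ i, y i * ∑ j, h j * f (j, i) := by
  rw [Fintype.sum_prod_type, Finset.sum_comm]
  refine Finset.sum_congr rfl fun i _ => ?_
  rw [Finset.mul_sum]
  exact Finset.sum_congr rfl fun j _ => by ring

lemma sum_blocks_mul_const (f : Fin m × Fin (n + 2) → ℕ) (hf : ∀ j, ∑ i, f (j, i) = d j) :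
    ∑ p : Fin m × Fin (n + 2), f p * h p.1 = ∑ j, d j * h j := by
  rw [Fintype.sum_prod_type]
  refine Finset.sum_congr rfl fun j _ => ?_
  rw [← hf j, Nat.cast_sum, Finset.sum_mul]

lemma sum_mul_le_card_mul (hε : ε ≤ 1) (hD : 0 ≤ D) (hdD : ∀ j, d j * h j ≤ (1 + ε) * D) :
    ∑ j, d j * h j ≤ 2 * (D * m) := by
  refine (Finset.sum_le_card_nsmul univ _ (2 * D) fun j _ => (hdD j).trans ?_).trans_eq ?_
  · nlinarith
  · simp only [card_univ, Fintype.card_fin, nsmul_eq_mul]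
    ring

/-- The size of the coefficients of low order after the substitution. -/
lemma abs_coeff_blockSubst_le_exp (pt : ∀ j, ApproxPoint S T k c γ ρ κ ε (h j))
    (hm : 1 ≤ m) (hε : 0 < ε) (hε1 : ε ≤ 1) (hρ : ∀ i, 0 ≤ ρ i) (hh : ∀ j, 0 < h j) (hD : 0 < D)
    (hd : ∀ j, 1 ≤ d j) (hDd : ∀ j, D ≤ d j * h j) (hdD : ∀ j, d j * h j ≤ (1 + ε) * D)
    {P : MvPolynomial (Fin m × Fin (n + 2)) ℤ} (hP0 : P ≠ 0)
    (hP : IsWeightedHomogeneous blockWeight P d) {C₀ : ℝ}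
    (hlen : Real.log (length P) ≤ C₀ * ∑ j, (d j : ℝ))
    (hbal : ∀ e, coeff e P ≠ 0 → ∀ i, ∑ j, (e (j, i) / d j : ℝ) ≤ m * (1 / (n + 2 : ℕ) + ε))
    {e : Fin m × Fin (n + 2) →₀ ℕ} (he : ∑ j, 1 / (d j : ℝ) * e (j, c) < ε) :
    |((coeff e (blockSubst (fun j => (pt j).M) (map (Int.castRingHom ℚ) P)) : ℚ) : ℝ)| ≤
      Real.exp ((C₀ + Real.log (n + 2 : ℕ)) * ∑ j, (d j : ℝ) +
        D * m * (-(∑ i, ρ i) / (n + 2 : ℕ) +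
          ε * ((n + 2 : ℕ) * ∑ i, ρ i + 2 + 2 * ∑ i, ρ i))) := by
  set R := ∑ i, ρ i with hR
  have hR0 : 0 ≤ R := Finset.sum_nonneg fun i _ => hρ i
  have hcast : ((coeff e (blockSubst (fun j => (pt j).M) (map (Int.castRingHom ℚ) P)) : ℚ) : ℝ) =
      coeff e (blockSubst (fun j => (pt j).M.map (Rat.castHom ℝ))
        (map (Int.castRingHom ℝ) P)) := by
    have h1 := map_blockSubst (Rat.castHom ℝ) (fun j => (pt j).M) (map (Int.castRingHom ℚ) P)
    rw [MvPolynomial.map_map, show (Rat.castHom ℝ).comp (Int.castRingHom ℚ) = Int.castRingHom ℝ from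
      RingHom.ext_int _ _] at h1
    rw [← h1, coeff_map]
    rfl
  rw [hcast]
  set B : ℝ := Real.exp (Real.log (n + 2 : ℕ) * ∑ j, (d j : ℝ)
    - D * m * ((1 / (n + 2 : ℕ) - (n + 2 : ℕ) * ε) * R)
    + 2 * ε * (D * m)) with hB
  have key := abs_coeff_blockSubst_le (fun j => (pt j).M.map (Rat.castHom ℝ)) c
    (fun j i => Real.exp (-(h j * (ρ i - ε)))) (fun j => Real.exp (h j * R))
    (fun j => Real.exp_pos _) (fun j i l hl => (pt j).abs_le i l hl) (fun j i => ?_)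
    (map (Int.castRingHom ℝ) P) (B := B) (fun f hf => ?_) e
  · refine key.trans ?_
    have h1 : ∏ j, Real.exp (h j * R) ^ e (j, c) ≤ Real.exp (D * m * (2 * ε * R)) := by
      simp_rw [← Real.exp_nat_mul]
      rw [← Real.exp_sum, Real.exp_le_exp]
      have h2 := sum_mul_le_of_sum_div_le hd hdD (fun j => e (j, c))
      have h3 : ∑ j, (e (j, c) / d j : ℝ) < ε := by
        refine lt_of_eq_of_lt (Finset.sum_congr rfl fun j _ => ?_) he
        ring
      have hm' : (1 : ℝ) ≤ m := by exact_mod_cast hm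
      have h4 : ∑ j, h j * e (j, c) ≤ D * m * (2 * ε) := by
        refine h2.trans ((mul_le_mul_of_nonneg_left h3.le (by positivity)).trans ?_)
        have : (1 + ε) * D * ε ≤ 2 * D * ε := by gcongr; linarith
        refine this.trans ?_
        nlinarith [mul_pos hD hε]
      calc ∑ j, (e (j, c) : ℝ) * (h j * R) = (∑ j, h j * e (j, c)) * R := by
            rw [Finset.sum_mul]; exact Finset.sum_congr rfl fun j _ => by ring
        _ ≤ D * m * (2 * ε) * R := mul_le_mul_of_nonneg_right h4 hR0
        _ = _ := by ring
    have h2 : length (map (Int.castRingHom ℝ) P) ≤ Real.exp (C₀ * ∑ j, (d j : ℝ)) := by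
      refine (length_map_intCast_le P).trans ?_
      rw [← Real.exp_log (length_pos hP0)]
      exact Real.exp_le_exp.2 hlen
    have hBp : 0 < B := Real.exp_pos _
    refine (mul_le_mul h1 (mul_le_mul_of_nonneg_right h2 hBp.le)
      (mul_nonneg (length_nonneg _) hBp.le) (Real.exp_pos _).le).trans ?_
    rw [hB, ← Real.exp_add, ← Real.exp_add, Real.exp_le_exp]
    refine le_of_eq ?_
    ring
  · rw [← Real.exp_add]
    have h1 : ρ i ≤ R := Finset.single_le_sum (fun i _ => hρ i) (mem_univ i)
    have h2 : 1 ≤ Real.exp (-(h j * (ρ i - ε)) + h j * R) := by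
      refine Real.one_le_exp ?_
      nlinarith [hh j, mul_pos (hh j) hε]
    rw [Matrix.map_apply, (pt j).apply_c]
    split_ifs
    · simpa using h2
    · simpa using (zero_le_one.trans h2)
  · have hf' : coeff f P ≠ 0 := by
      rintro h0
      rw [coeff_map, h0] at hf
      simp at hf
    have hsum : ∀ j, ∑ i, f (j, i) = d j := fun j => hP.sum_eq hf' j
    have hNpos : (0 : ℝ) < (n + 2 : ℕ) := by positivity
    have h1 : ∏ p : Fin m × Fin (n + 2), ((n + 2 : ℕ) * Real.exp (-(h p.1 * (ρ p.2 - ε)))) ^ f p =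
        Real.exp (Real.log (n + 2 : ℕ) * ∑ j, (d j : ℝ)
          - ∑ p : Fin m × Fin (n + 2), f p * (h p.1 * ρ p.2)
          + ε * ∑ p : Fin m × Fin (n + 2), f p * h p.1) := by
      have h2 : Real.log (n + 2 : ℕ) * ∑ j, (d j : ℝ) =
          ∑ p : Fin m × Fin (n + 2), f p * Real.log (n + 2 : ℕ) := by
        rw [← Finset.sum_mul, Fintype.sum_prod_type, mul_comm]
        congr 1
        refine Finset.sum_congr rfl fun j _ => ?_
        rw [← hsum j, Nat.cast_sum]
      rw [h2, Finset.mul_sum, ← Finset.sum_sub_distrib, ← Finset.sum_add_distrib, Real.exp_sum]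
      refine Finset.prod_congr rfl fun p _ => ?_
      conv_lhs => rw [← Real.exp_log hNpos]
      rw [← Real.exp_add, ← Real.exp_nat_mul]
      congr 1
      ring
    rw [h1, Real.exp_le_exp, sum_blocks_mul, sum_blocks_mul_const f hsum]
    have h3 : D * m * ((1 / (n + 2 : ℕ) - (n + 2 : ℕ) * ε) * R) ≤
        ∑ i, ρ i * ∑ j, h j * f (j, i) := by
      rw [hR, Finset.mul_sum, Finset.mul_sum]
      refine Finset.sum_le_sum fun i _ => ?_
      have h4 := le_sum_div_of_sum_div_le (f := fun j i => f (j, i)) (by omega) hε.le hd hsum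
        (hbal f hf') i
      have h5 := le_sum_mul_of_le_sum_div hd hDd (fun j => f (j, i))
      calc D * m * ((1 / (n + 2 : ℕ) - (n + 2 : ℕ) * ε) * ρ i)
          = ρ i * (D * (m * (1 / (n + 2 : ℕ) - (n + 2 : ℕ) * ε))) := by ring
        _ ≤ _ := mul_le_mul_of_nonneg_left
          ((mul_le_mul_of_nonneg_left h4 hD.le).trans h5) (hρ i)
    have h6 := mul_le_mul_of_nonneg_left (sum_mul_le_card_mul hε1 hD.le hdD) hε.le
    linarith

/-- The denominators of the coefficients after the substitution. -/
lemma exists_mul_coeff_blockSubst_eq_intCast (hS : ∀ q ∈ S, q.Prime)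
    (pt : ∀ j, ApproxPoint S T k c γ ρ κ ε (h j))
    (hT : ∀ k, T k * T k = 1) (hε : 0 < ε) (hε1 : ε ≤ 1) (hγ : ∀ q ∈ S, ∀ i, 0 ≤ γ q i)
    (hD : 0 < D) (hd : ∀ j, 1 ≤ d j) (hdD : ∀ j, d j * h j ≤ (1 + ε) * D)
    {P : MvPolynomial (Fin m × Fin (n + 2)) ℤ} (hP : IsWeightedHomogeneous blockWeight P d)
    (hbal : ∀ k e, coeff e (blockSubst (fun _ => T k) P) ≠ 0 →
      ∀ i, ∑ j, (e (j, i) / d j : ℝ) ≤ m * (1 / (n + 2 : ℕ) + ε))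
    (e : Fin m × Fin (n + 2) →₀ ℕ) :
    ∃ N : ℕ, 0 < N ∧ Real.log N ≤ D * m * ((∑ q ∈ S, ∑ i, γ q i) / (n + 2 : ℕ) +
        ε * (3 * (∑ q ∈ S, ∑ i, γ q i) + 2 * #S + 2)) ∧
      ∃ a : ℤ, N * coeff e (blockSubst (fun j => (pt j).M) (map (Int.castRingHom ℚ) P)) = a := by
  have hlog : ∀ q ∈ S, 0 < Real.log q := fun q hq =>
    Real.log_pos (by exact_mod_cast (hS q hq).one_lt)
  set Γ : ℕ → ℝ := fun q => ∑ i, γ q i with hΓ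
  have hΓ0 : ∀ q ∈ S, 0 ≤ Γ q := fun q hq => Finset.sum_nonneg fun i _ => hγ q hq i
  set E : ℕ → ℝ := fun q => D * m * ((1 / (n + 2 : ℕ) + 3 * ε) * Γ q + 2 * ε) with hE
  have hE0 : ∀ q ∈ S, 0 ≤ E q := fun q hq => by
    have := hΓ0 q hq
    positivity
  set A : ℕ → ℕ := fun q => ⌊E q / Real.log q⌋₊ with hA
  have hAE : ∀ q ∈ S, A q * Real.log q ≤ E q := fun q hq => by
    rw [← le_div_iff₀ (hlog q hq)]
    exact Nat.floor_le (div_nonneg (hE0 q hq) (hlog q hq).le)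
  set N₁ : ℕ := ∏ q ∈ S, q ^ A q with hN₁
  set N₂ : ℕ := ∏ j, (pt j).C ^ d j with hN₂
  have hN₁0 : 0 < N₁ := Finset.prod_pos fun q hq => pow_pos (hS q hq).pos _
  have hN₂0 : 0 < N₂ := Finset.prod_pos fun j _ => pow_pos (pt j).one_le_C _
  refine ⟨N₁ * N₂, Nat.mul_pos hN₁0 hN₂0, ?_, eq_intCast_of_forall_isIntegralAt fun q hq => ?_⟩
  · have h1 : Real.log N₁ ≤ ∑ q ∈ S, E q := by
      rw [hN₁, Nat.cast_prod, Real.log_prod fun q hq => by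
        exact_mod_cast (pow_pos (hS q hq).pos _).ne']
      refine Finset.sum_le_sum fun q hq => ?_
      rw [Nat.cast_pow, Real.log_pow]
      exact hAE q hq
    have h2 : Real.log N₂ ≤ 2 * ε * (D * m) := by
      rw [hN₂, Nat.cast_prod, Real.log_prod fun j _ => by
        exact_mod_cast (pow_pos (pt j).one_le_C _).ne']
      have h3 := mul_le_mul_of_nonneg_left (sum_mul_le_card_mul hε1 hD.le hdD) hε.le
      rw [Finset.mul_sum] at h3
      refine le_trans (Finset.sum_le_sum fun j _ => ?_) (h3.trans_eq (by ring))
      rw [Nat.cast_pow, Real.log_pow]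
      calc (d j : ℝ) * Real.log (pt j).C ≤ d j * (h j * ε) :=
            mul_le_mul_of_nonneg_left (pt j).log_C_le (Nat.cast_nonneg _)
        _ = _ := by ring
    rw [Nat.cast_mul, Real.log_mul (by exact_mod_cast hN₁0.ne') (by exact_mod_cast hN₂0.ne')]
    refine (add_le_add h1 h2).trans_eq ?_
    rw [hE, ← Finset.mul_sum, Finset.sum_add_distrib, ← Finset.mul_sum, Finset.sum_const,
      nsmul_eq_mul]
    ring
  · rw [← mem_localIntegers (hq := hq)]
    by_cases hqS : q ∈ S
    · set Q := blockSubst (fun _ => T (k q)) P with hQ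
      have hPQ : blockSubst (fun j => (pt j).M) (map (Int.castRingHom ℚ) P) =
          blockSubst (fun j => (T (k q)).map (Int.castRingHom ℚ) * (pt j).M)
            (map (Int.castRingHom ℚ) Q) := by
        have h1 : P = blockSubst (fun _ => T (k q)) Q := by
          rw [hQ, blockSubst_comp]
          simp only [hT]
          rw [blockSubst_one]
        conv_lhs => rw [h1]
        rw [map_blockSubst, blockSubst_comp]
      rw [hPQ]
      refine mul_coeff_blockSubst_mem _ _ (fun j i => (q : ℚ) ^ (pt j).a q i)
        (fun j i l => (pt j).isIntegralAt q hqS i l) Q (fun f hf => ?_) e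
      have hf1 : ∀ j, ∑ i, f (j, i) = d j :=
        fun j => (isWeightedHomogeneous_blockSubst _ hP).sum_eq hf j
      have hle : ∑ p : Fin m × Fin (n + 2), (pt p.1).a q p.2 * f p ≤ A q := by
        refine Nat.le_floor ?_
        rw [le_div_iff₀ (hlog q hqS), Nat.cast_sum, Finset.sum_mul]
        calc ∑ p : Fin m × Fin (n + 2), (((pt p.1).a q p.2 * f p : ℕ) : ℝ) * Real.log q
            ≤ ∑ p : Fin m × Fin (n + 2), f p * (h p.1 * (γ q p.2 + ε)) := by
              refine Finset.sum_le_sum fun p _ => ?_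
              rw [Nat.cast_mul, mul_right_comm, mul_comm]
              exact mul_le_mul_of_nonneg_left ((pt p.1).a_le q hqS p.2) (Nat.cast_nonneg _)
          _ = ∑ i, γ q i * ∑ j, h j * f (j, i) + ε * ∑ j, d j * h j := by
              rw [← sum_blocks_mul, ← sum_blocks_mul_const f hf1, Finset.mul_sum,
                ← Finset.sum_add_distrib]
              exact Finset.sum_congr rfl fun p _ => by ring
          _ ≤ ∑ i, γ q i * ((1 + ε) * D * (m * (1 / (n + 2 : ℕ) + ε))) + ε * (2 * (D * m)) := by
              refine add_le_add (Finset.sum_le_sum fun i _ => ?_)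
                (mul_le_mul_of_nonneg_left (sum_mul_le_card_mul hε1 hD.le hdD) hε.le)
              refine mul_le_mul_of_nonneg_left ?_ (hγ q hqS i)
              exact (sum_mul_le_of_sum_div_le hd hdD fun j => f (j, i)).trans
                (mul_le_mul_of_nonneg_left (hbal _ f hf i) (by positivity))
          _ = D * m * ((1 + ε) * (1 / (n + 2 : ℕ) + ε) * Γ q + 2 * ε) := by
              rw [← Finset.sum_mul]
              ring
          _ ≤ E q := by
              have hn : (1 / (n + 2 : ℕ) : ℝ) ≤ 1 :=
                (div_le_one (by positivity)).2
                  (by push_cast; linarith [(Nat.cast_nonneg n : (0:ℝ) ≤ n)])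
              have h5 : (1 + ε) * (1 / (n + 2 : ℕ) + ε) ≤ 1 / (n + 2 : ℕ) + 3 * ε := by nlinarith
              have h6 := mul_le_mul_of_nonneg_right h5 (hΓ0 q hqS)
              exact mul_le_mul_of_nonneg_left (by linarith) (by positivity)
      obtain ⟨t, ht⟩ := Nat.exists_eq_add_of_le hle
      refine ⟨((q ^ t * (∏ q' ∈ S.erase q, q' ^ A q') * N₂ : ℕ) : ℚ), natCast_mem _ _, ?_⟩
      have h7 : ∏ p : Fin m × Fin (n + 2), ((q : ℚ) ^ (pt p.1).a q p.2) ^ f p =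
          ((q ^ ∑ p : Fin m × Fin (n + 2), (pt p.1).a q p.2 * f p : ℕ) : ℚ) := by
        rw [Nat.cast_pow, ← Finset.prod_pow_eq_pow_sum]
        exact Finset.prod_congr rfl fun p _ => by rw [← pow_mul]
      rw [h7, ← Nat.cast_mul, hN₁, ← Finset.mul_prod_erase S _ hqS, ht, pow_add]
      congr 1
      ring
    · refine mul_coeff_blockSubst_mem _ _ (fun j _ => ((pt j).C : ℚ))
        (fun j i l => (pt j).isIntegralAt_of_notMem q hq hqS i l) P (fun f hf => ?_) e
      refine ⟨(N₁ : ℚ), natCast_mem _ _, ?_⟩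
      have h7 : ((N₂ : ℕ) : ℚ) = ∏ p : Fin m × Fin (n + 2), ((pt p.1).C : ℚ) ^ f p := by
        rw [hN₂, Nat.cast_prod, Fintype.prod_prod_type]
        refine Finset.prod_congr rfl fun j _ => ?_
        rw [Nat.cast_pow, ← hP.sum_eq hf j]
        exact (Finset.prod_pow_eq_pow_sum _ _ _).symm
      rw [Nat.cast_mul, h7]

/-- Coefficients of low order vanish after the substitution, being integers of absolute value
less than one up to a controlled denominator. -/
lemma coeff_blockSubst_eq_zero (hS : ∀ q ∈ S, q.Prime)
    (pt : ∀ j, ApproxPoint S T k c γ ρ κ ε (h j))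
    (hT : ∀ k, T k * T k = 1) {k₀ : K} (hk₀ : T k₀ = 1) (hm : 1 ≤ m)
    (hε : 0 < ε) (hε1 : ε ≤ 1) (hγ : ∀ q ∈ S, ∀ i, 0 ≤ γ q i) (hρ : ∀ i, 0 ≤ ρ i)
    (hh : ∀ j, 0 < h j) (hD : 0 < D)
    (hd : ∀ j, 1 ≤ d j) (hDd : ∀ j, D ≤ d j * h j) (hdD : ∀ j, d j * h j ≤ (1 + ε) * D)
    {P : MvPolynomial (Fin m × Fin (n + 2)) ℤ} (hP0 : P ≠ 0)
    (hP : IsWeightedHomogeneous blockWeight P d) {C₀ : ℝ}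
    (hlen : Real.log (length P) ≤ C₀ * ∑ j, (d j : ℝ))
    (hbal : ∀ k e, coeff e (blockSubst (fun _ => T k) P) ≠ 0 →
      ∀ i, ∑ j, (e (j, i) / d j : ℝ) ≤ m * (1 / (n + 2 : ℕ) + ε))
    (hneg : (C₀ + Real.log (n + 2 : ℕ)) * ∑ j, (d j : ℝ) + D * m *
      ((∑ q ∈ S, ∑ i, γ q i - ∑ i, ρ i) / (n + 2 : ℕ) +
        ε * (3 * (∑ q ∈ S, ∑ i, γ q i) + 2 * #S + (n + 4 : ℕ) * ∑ i, ρ i + 4)) < 0)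
    {e : Fin m × Fin (n + 2) →₀ ℕ} (he : ∑ j, 1 / (d j : ℝ) * e (j, c) < ε) :
    coeff e (blockSubst (fun j => (pt j).M) (map (Int.castRingHom ℚ) P)) = 0 := by
  have hbal₀ : ∀ e, coeff e P ≠ 0 → ∀ i, ∑ j, (e (j, i) / d j : ℝ) ≤ m * (1 / (n + 2 : ℕ) + ε) :=
    fun e he => hbal k₀ e (by rwa [hk₀, blockSubst_one])
  have h1 := abs_coeff_blockSubst_le_exp pt hm hε hε1 hρ hh hD hd hDd hdD hP0 hP hlen hbal₀ he
  obtain ⟨N, hN, hN1, a, ha⟩ := exists_mul_coeff_blockSubst_eq_intCast hS pt hT hε hε1 hγ hD hd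
    hdD hP hbal e
  set x := coeff e (blockSubst (fun j => (pt j).M) (map (Int.castRingHom ℚ) P)) with hx
  have hN' : (0 : ℝ) < N := by exact_mod_cast hN
  have h2 : |(a : ℝ)| < 1 := by
    have h3 : (a : ℝ) = N * (x : ℝ) := by exact_mod_cast ha.symm
    rw [h3, abs_mul, abs_of_pos hN', ← Real.exp_log hN']
    refine (mul_le_mul (Real.exp_le_exp.2 hN1) h1 (abs_nonneg _) (Real.exp_pos _).le).trans_lt ?_
    rw [← Real.exp_add, Real.exp_lt_one_iff]
    refine lt_of_eq_of_lt ?_ hneg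
    push_cast
    ring
  have h4 : a = 0 := by
    rw [← Int.abs_lt_one_iff]
    exact_mod_cast h2
  rw [h4, Int.cast_zero] at ha
  exact (mul_eq_zero.1 ha).resolve_left (by exact_mod_cast hN.ne')

end Core

end SUnitEquation

namespace SUnitEquation

open MvPolynomial Finset

/-! ### The parametric subspace theorem -/

lemma exists_lacunary_sequence {p : ℝ → Prop} (hp : ∀ X, ∃ h, X ≤ h ∧ p h) (X L : ℝ) (hX : 1 ≤ X)
    (hL : 1 ≤ L) :
    ∃ g : ℕ → ℝ, (∀ i, X ≤ g i) ∧ (∀ i, p (g i)) ∧ ∀ i j, i < j → L * g i ≤ g j := by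
  choose f hf hpf using hp
  set g : ℕ → ℝ := fun i => Nat.rec (f X) (fun _ y => f (max X (L * y))) i with hg
  have hgX : ∀ i, X ≤ g i := by
    intro i
    cases i with
    | zero => exact hf X
    | succ i => exact (le_max_left _ _).trans (hf _)
  have hsucc : ∀ i, L * g i ≤ g (i + 1) := fun i => (le_max_right _ _).trans (hf _)
  have hmono : Monotone g := monotone_nat_of_le_succ fun i => by
    nlinarith [hsucc i, hgX i]
  refine ⟨g, hgX, fun i => ?_, fun i j hij => (hsucc i).trans (hmono hij)⟩
  cases i with
  | zero => exact hpf X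
  | succ i => exact hpf _

/-- There are no arbitrarily large small parallelepipeds in hyperplanes of large height. -/
theorem not_forall_exists_approxPoint {S : Finset ℕ} (hS : ∀ q ∈ S, q.Prime) {n : ℕ} {K : Type*}
    [Fintype K] {T : K → Matrix (Fin (n + 2)) (Fin (n + 2)) ℤ} (hT : ∀ k, T k * T k = 1) {k₀ : K}
    (hk₀ : T k₀ = 1) {k : ℕ → K} {c : Fin (n + 2)} {γ : ℕ → Fin (n + 2) → ℝ} {ρ : Fin (n + 2) → ℝ}
    {κ : ℝ} (hκ : 0 < κ) (hγ : ∀ q ∈ S, ∀ i, 0 ≤ γ q i) (hρ : ∀ i, 0 ≤ ρ i)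
    (hlt : ∑ q ∈ S, ∑ i, γ q i < ∑ i, ρ i) :
    ¬ ∀ ε : ℝ, 0 < ε → ∀ X : ℝ, ∃ h, X ≤ h ∧ Nonempty (ApproxPoint S T k c γ ρ κ ε h) := by
  intro H
  set R := ∑ i, ρ i with hR
  set Γ := ∑ q ∈ S, ∑ i, γ q i with hΓ
  have hR0 : 0 ≤ R := Finset.sum_nonneg fun i _ => hρ i
  have hΓ0 : 0 ≤ Γ := Finset.sum_nonneg fun q hq => Finset.sum_nonneg fun i _ => hγ q hq i
  set δ : ℝ := (R - Γ) / (n + 2 : ℕ) with hδ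
  have hδ0 : 0 < δ := div_pos (by linarith) (by positivity)
  set B : ℝ := 3 * Γ + 2 * #S + (n + 4 : ℕ) * R + 4 with hB
  have hB0 : 0 < B := by positivity
  set ε : ℝ := min 1 (δ / (2 * B)) with hε
  have hε0 : 0 < ε := lt_min one_pos (by positivity)
  have hε1 : ε ≤ 1 := min_le_left _ _
  have hεB : ε * B ≤ δ / 2 := by
    have : ε ≤ δ / (2 * B) := min_le_right _ _
    rw [le_div_iff₀ (by positivity)] at this
    linarith
  obtain ⟨m, hm, C₀, hC₀, haux⟩ := exists_auxiliary (n := n + 2) (by omega) T hε0 hε1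
  obtain ⟨σ, hσ, C₁, hC₁, hroth⟩ := roth_lemma m ε hε0
  have hm' : (1 : ℝ) ≤ m := by exact_mod_cast hm
  have hlogn : 0 ≤ Real.log (n + 2 : ℕ) := Real.log_natCast_nonneg _
  set X : ℝ := 1 + 4 * (C₀ + Real.log (n + 2 : ℕ)) / δ + 2 * m * (C₀ + C₁) / (σ * κ) with hX
  have hX₁ : 0 ≤ 4 * (C₀ + Real.log (n + 2 : ℕ)) / δ := by positivity
  have hX₂ : 0 ≤ 2 * m * (C₀ + C₁) / (σ * κ) := by positivity
  obtain ⟨g, hgX, hgp, hgL⟩ := exists_lacunary_sequence (H ε hε0) X (max 1 (2 / σ)) (by linarith)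
    (le_max_left _ _)
  set h : Fin m → ℝ := fun j => g (Fin.rev j) with hh
  have hhX : ∀ j, X ≤ h j := fun j => hgX _
  have hX0 : 0 < X := by linarith
  have hh0 : ∀ j, 0 < h j := fun j => hX0.trans_le (hhX j)
  have pt : ∀ j, ApproxPoint S T k c γ ρ κ ε (h j) := fun j => (hgp _).some
  have : NeZero m := ⟨by omega⟩
  set D : ℝ := (∑ j, h j) / ε with hD
  have hhD : ∀ j, h j ≤ ε * D := fun j => by
    rw [hD, mul_div_cancel₀ _ hε0.ne']
    exact Finset.single_le_sum (fun i _ => (hh0 i).le) (mem_univ j)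
  have hD0 : 0 < D := div_pos (Finset.sum_pos (fun j _ => hh0 j) univ_nonempty) hε0
  set d : Fin m → ℕ := fun j => ⌈D / h j⌉₊ with hd
  have hd1 : ∀ j, 1 ≤ d j := fun j => Nat.one_le_ceil_iff.2 (div_pos hD0 (hh0 j))
  have hDd : ∀ j, D ≤ d j * h j := fun j => by
    rw [← div_le_iff₀ (hh0 j)]
    exact Nat.le_ceil _
  have hdD : ∀ j, d j * h j ≤ (1 + ε) * D := fun j => by
    have h1 := (Nat.ceil_lt_add_one (div_pos hD0 (hh0 j)).le).le
    have h2 := mul_le_mul_of_nonneg_right h1 (hh0 j).le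
    rw [add_mul, div_mul_cancel₀ _ (hh0 j).ne'] at h2
    linarith [hhD j]
  have hsum : X * ∑ j, (d j : ℝ) ≤ 2 * (D * m) := by
    refine le_trans ?_ (sum_mul_le_card_mul hε1 hD0.le hdD)
    rw [Finset.mul_sum]
    refine Finset.sum_le_sum fun j _ => ?_
    rw [mul_comm]
    exact mul_le_mul_of_nonneg_left (hhX j) (Nat.cast_nonneg _)
  have hsum0 : 0 ≤ ∑ j, (d j : ℝ) := Finset.sum_nonneg fun _ _ => Nat.cast_nonneg _
  obtain ⟨P, hP0, hP, hlen, hbal⟩ := haux d hd1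
  have hneg : (C₀ + Real.log (n + 2 : ℕ)) * ∑ j, (d j : ℝ) + D * m *
      ((Γ - R) / (n + 2 : ℕ) + ε * B) < 0 := by
    have h1 : 4 * (C₀ + Real.log (n + 2 : ℕ)) < X * δ := by
      rw [← div_lt_iff₀ hδ0]
      linarith
    have h2 : (Γ - R) / (n + 2 : ℕ) = -δ := by rw [hδ, ← neg_div, neg_sub]
    have hDm : 0 < D * m := by positivity
    have h3 : D * m * ((Γ - R) / (n + 2 : ℕ) + ε * B) ≤ D * m * (-(δ / 2)) :=
      mul_le_mul_of_nonneg_left (by linarith) hDm.le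
    have h4 : 0 < ∑ j, (d j : ℝ) :=
      Finset.sum_pos (fun j _ => by exact_mod_cast hd1 j) univ_nonempty
    have h5 := mul_lt_mul_of_pos_right h1 h4
    have h6 := mul_le_mul_of_nonneg_left hsum hδ0.le
    have h7 : X * δ * ∑ j, (d j : ℝ) = δ * (X * ∑ j, (d j : ℝ)) := by ring
    rw [h2] at h3 ⊢
    linarith
  have hzero := fun e he => coeff_blockSubst_eq_zero hS pt hT hk₀ hm hε0 hε1 hγ hρ hh0 hD0 hd1 hDd
    hdD hP0 hP hlen hbal hneg (e := e) he
  obtain ⟨Q, hQ0, hQd, hQlen, hQ⟩ := exists_indexGE_of_hyperplanes hP0 hP (fun j => (pt j).M)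
    (fun j => (pt j).isUnit_det) (fun j => (pt j).p) (fun j => (pt j).p_zero_ne) c
    (fun j => (pt j).apply_c) (fun j => (pt j).sum_eq_zero) (fun j => 1 / (d j : ℝ))
    (fun j => by positivity) hzero
  refine hroth d hd1 (fun i j hij => ?_) Q hQ0 hQd (fun j => (pt j).u) (fun j => (pt j).w)
    (fun j => (pt j).isCoprime) (fun j => (pt j).w_ne) (fun j => ?_) ?_
  · have h1 : 2 / σ * h j ≤ h i := by
      refine le_trans ?_ (hgL _ _ (Fin.rev_lt_rev.2 hij))
      exact mul_le_mul_of_nonneg_right (le_max_right _ _) (hh0 j).le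
    rw [div_mul_eq_mul_div, div_le_iff₀ hσ] at h1
    have h2 : (d i : ℝ) * h i ≤ 2 * (d j * h j) := by
      refine (hdD i).trans ((mul_le_mul_of_nonneg_right (by linarith) hD0.le).trans
        (mul_le_mul_of_nonneg_left (hDd j) zero_le_two))
    have h3 : (d i : ℝ) * h i ≤ σ * d j * h i := by
      refine h2.trans ((mul_left_comm _ _ _).trans_le ?_)
      refine (mul_le_mul_of_nonneg_left h1 (Nat.cast_nonneg (d j))).trans_eq ?_
      ring
    exact le_of_mul_le_mul_right h3 (hh0 i)
  · have h1 : Real.log (length Q) ≤ C₀ * ∑ j, (d j : ℝ) :=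
      (Real.log_le_log (length_pos hQ0) hQlen).trans hlen
    have h2 : 2 * m * (C₀ + C₁) ≤ X * (σ * κ) := by
      rw [← div_le_iff₀ (by positivity)]
      linarith
    have h3 : (C₀ + C₁) * ∑ j, (d j : ℝ) ≤ σ * κ * D := by
      have h4 : X * ((C₀ + C₁) * ∑ j, (d j : ℝ)) ≤ X * (σ * κ * D) := by
        calc X * ((C₀ + C₁) * ∑ j, (d j : ℝ)) = (C₀ + C₁) * (X * ∑ j, (d j : ℝ)) := by ring
          _ ≤ (C₀ + C₁) * (2 * (D * m)) := mul_le_mul_of_nonneg_left hsum (by positivity)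
          _ = D * (2 * m * (C₀ + C₁)) := by ring
          _ ≤ D * (X * (σ * κ)) := mul_le_mul_of_nonneg_left h2 hD0.le
          _ = _ := by ring
      exact le_of_mul_le_mul_left h4 hX0
    have h5 : σ * κ * D ≤ σ * d j * Real.log (max |((pt j).u : ℝ)| |((pt j).w : ℝ)|) := by
      calc σ * κ * D ≤ σ * κ * (d j * h j) := mul_le_mul_of_nonneg_left (hDd j) (by positivity)
        _ = σ * d j * (κ * h j) := by ring
        _ ≤ _ := mul_le_mul_of_nonneg_left (pt j).le_height (by positivity)
    linarith
  · have h1 : (fun j => -(pt j).p 1 / (pt j).p 0) = fun j => ((pt j).u / (pt j).w : ℚ) :=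
      funext fun j => (pt j).eq_div
    rwa [h1] at hQ

end SUnitEquation

namespace SUnitEquation

open Finset Filter Topology

/-! ### Limits of exponents -/

/-- Relaxing the exponents of an approximating parallelepiped. -/
def ApproxPoint.relax {S : Finset ℕ} {n : ℕ} {K : Type*}
    {T : K → Matrix (Fin (n + 2)) (Fin (n + 2)) ℤ} {k k' : ℕ → K} {c : Fin (n + 2)}
    {γ γ' : ℕ → Fin (n + 2) → ℝ} {ρ ρ' : Fin (n + 2) → ℝ} {κ ε ε' h : ℝ}
    (pt : ApproxPoint S T k c γ ρ κ ε h) (hh : 0 ≤ h) (hk : ∀ q ∈ S, k q = k' q)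
    (hγ : ∀ q ∈ S, ∀ i, γ q i + ε ≤ γ' q i + ε') (hρ : ∀ i, ρ' i - ε' ≤ ρ i - ε) (hε : ε ≤ ε') :
    ApproxPoint S T k' c γ' ρ' κ ε' h :=
  { pt with
    abs_le := fun i l hl => (pt.abs_le i l hl).trans <| Real.exp_le_exp.2 <|
      neg_le_neg (mul_le_mul_of_nonneg_left (hρ i) hh)
    a_le := fun q hq i => (pt.a_le q hq i).trans (mul_le_mul_of_nonneg_left (hγ q hq i) hh)
    isIntegralAt := fun q hq => hk q hq ▸ pt.isIntegralAt q hq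
    log_C_le := pt.log_C_le.trans (mul_le_mul_of_nonneg_left hε hh) }

lemma exists_tendsto_ultrafilter (U : Ultrafilter ℕ) {x : ℕ → ℝ} {B : ℝ}
    (hx : ∀ t, 0 ≤ x t ∧ x t ≤ B) : ∃ y, 0 ≤ y ∧ Tendsto x U (𝓝 y) := by
  have hle : (U.map x : Filter ℝ) ≤ 𝓟 (Set.Icc 0 B) := by
    rw [le_principal_iff]
    exact Filter.mem_map.2 (Filter.univ_mem' hx)
  obtain ⟨y, hy, h⟩ := isCompact_Icc.ultrafilter_le_nhds (U.map x) hle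
  exact ⟨y, hy.1, h⟩

lemma exists_eventually_eq_ultrafilter (U : Ultrafilter ℕ) {K : Type*} [Finite K] (x : ℕ → K) :
    ∃ y, ∀ᶠ t in U, x t = y := by
  by_contra! h
  obtain ⟨t, ht⟩ := (eventually_all.2 h).exists
  exact ht (x t) rfl

/-- The exponents in `not_forall_exists_approxPoint` may vary as long as they stay bounded. -/
theorem not_forall_exists_approxPoint_of_bounded {S : Finset ℕ} (hS : ∀ q ∈ S, q.Prime) {n : ℕ}
    {K : Type*} [Fintype K] {T : K → Matrix (Fin (n + 2)) (Fin (n + 2)) ℤ}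
    (hT : ∀ k, T k * T k = 1) {k₀ : K} (hk₀ : T k₀ = 1) {c : Fin (n + 2)} {κ B δ : ℝ}
    (hκ : 0 < κ) (hδ : 0 < δ) :
    ¬ ∀ ε : ℝ, 0 < ε → ∀ X : ℝ, ∃ h, X ≤ h ∧ ∃ (k : ℕ → K) (γ : ℕ → Fin (n + 2) → ℝ)
      (ρ : Fin (n + 2) → ℝ), (∀ q ∈ S, ∀ i, 0 ≤ γ q i ∧ γ q i ≤ B) ∧ (∀ i, 0 ≤ ρ i ∧ ρ i ≤ B) ∧
        ∑ q ∈ S, ∑ i, γ q i + δ ≤ ∑ i, ρ i ∧ Nonempty (ApproxPoint S T k c γ ρ κ ε h) := by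
  intro H
  have H' := fun t : ℕ => H (1 / (t + 1)) (by positivity) t
  choose h hX k γ ρ hγ hρ hlt pt using H'
  set U := hyperfilter ℕ
  have hlim : Tendsto (fun t : ℕ => (1 / (t + 1) : ℝ)) U (𝓝 0) :=
    tendsto_one_div_add_atTop_nhds_zero_nat.mono_left (Nat.hyperfilter_le_atTop)
  have hγ' : ∀ q i, ∃ y, q ∈ S → 0 ≤ y ∧ Tendsto (fun t => γ t q i) U (𝓝 y) := fun q i => by
    by_cases hq : q ∈ S
    · obtain ⟨y, hy⟩ := exists_tendsto_ultrafilter U fun t => hγ t q hq i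
      exact ⟨y, fun _ => hy⟩
    · exact ⟨0, fun h => absurd h hq⟩
  choose γ' hγ' using hγ'
  choose ρ' hρ'0 hρ' using fun i => exists_tendsto_ultrafilter U fun t => hρ t i
  choose k' hk' using fun q => exists_eventually_eq_ultrafilter U fun t => k t q
  refine not_forall_exists_approxPoint hS hT hk₀ (k := k') (c := c) (γ := γ') (ρ := ρ') hκ
    (fun q hq i => (hγ' q i hq).1) hρ'0 ?_ fun ε hε X => ?_
  · have h1 : Tendsto (fun t => ∑ q ∈ S, ∑ i, γ t q i + δ) U
        (𝓝 (∑ q ∈ S, ∑ i, γ' q i + δ)) :=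
      (tendsto_finsetSum _ fun q hq => tendsto_finsetSum _ fun i _ =>
        (hγ' q i hq).2).add_const _
    have h2 : Tendsto (fun t => ∑ i, ρ t i) U (𝓝 (∑ i, ρ' i)) :=
      tendsto_finsetSum _ fun i _ => hρ' i
    have h3 := le_of_tendsto_of_tendsto' h1 h2 hlt
    linarith
  · have hε2 : 0 < ε / 2 := by positivity
    have e1 : ∀ᶠ t : ℕ in U, (1 / (t + 1) : ℝ) < ε / 2 := hlim.eventually_lt_const hε2
    have e2 : ∀ᶠ t in U, ∀ q ∈ S, ∀ i, γ t q i < γ' q i + ε / 2 :=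
      (Filter.eventually_all_finset S).2 fun q hq => eventually_all.2 fun i =>
        (hγ' q i hq).2.eventually_lt_const (by linarith)
    have e3 : ∀ᶠ t in U, ∀ i, ρ' i - ε / 2 < ρ t i :=
      eventually_all.2 fun i => (hρ' i).eventually_const_lt (by linarith)
    have e4 : ∀ᶠ t in U, ∀ q ∈ S, k t q = k' q :=
      (Filter.eventually_all_finset S).2 fun q _ => hk' q
    have e5 : ∀ᶠ t : ℕ in U, X ≤ t :=
      Nat.hyperfilter_le_atTop (tendsto_natCast_atTop_atTop.eventually_ge_atTop X)
    obtain ⟨t, h1, h2, h3, h4, h5⟩ := (e1.and (e2.and (e3.and (e4.and e5)))).exists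
    refine ⟨h t, h5.trans (hX t), ⟨(pt t).some.relax ((Nat.cast_nonneg _).trans (hX t)) h4
      (fun q hq i => ?_) (fun i => ?_) ?_⟩⟩
    · linarith [h2 q hq i]
    · linarith [h3 i]
    · linarith

/-! ### Change of base point -/

/-- The substitution turning differences from one base point into differences from another one. -/
def baseChange {n : ℕ} (k : Option (Fin n)) : Matrix (Fin n) (Fin n) ℤ :=
  k.elim 1 fun k => 1 - Matrix.vecMulVec (1 + Pi.single k 1) (Pi.single k 1)

lemma baseChange_mul_self {n : ℕ} (k : Option (Fin n)) : baseChange k * baseChange k = 1 := by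
  cases k with
  | none => simp [baseChange]
  | some k =>
    simp only [baseChange, Option.elim_some]
    set u : Fin n → ℤ := 1 + Pi.single k 1 with hu
    set v : Fin n → ℤ := Pi.single k 1 with hv
    have h1 : Matrix.vecMulVec u v * Matrix.vecMulVec u v = (2 : ℤ) • Matrix.vecMulVec u v := by
      rw [Matrix.vecMulVec_mul_vecMulVec]
      have : v ⬝ᵥ u = 2 := by simp [hu, hv]
      rw [this]
      ext i j
      simp [Matrix.vecMulVec_apply]
      ring
    rw [sub_mul, one_mul, mul_sub, mul_one, h1, two_smul]
    abel

lemma baseChange_none_mul {n : ℕ} (M : Matrix (Fin n) (Fin n) ℚ) :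
    (baseChange none).map (Int.castRingHom ℚ) * M = M := by
  simp [baseChange]

lemma baseChange_some_mul {n : ℕ} (k : Fin n) (M : Matrix (Fin n) (Fin n) ℚ) (i l : Fin n) :
    ((baseChange (some k)).map (Int.castRingHom ℚ) * M) i l =
      M i l - (if i = k then 2 else 1) * M k l := by
  have h : ∀ j, ((baseChange (some k)).map (Int.castRingHom ℚ)) i j =
      (1 : Matrix (Fin n) (Fin n) ℚ) i j
        - (if i = k then 2 else 1) * Pi.single (M := fun _ => ℚ) k 1 j := by
    intro j
    simp only [baseChange, Option.elim_some, Matrix.map_apply, Matrix.sub_apply,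
      Matrix.vecMulVec_apply, Pi.add_apply, Pi.one_apply, Pi.single_apply, Matrix.one_apply]
    split_ifs <;> norm_num
  rw [Matrix.mul_apply]
  simp only [h, sub_mul, Finset.sum_sub_distrib]
  rw [← Matrix.mul_apply, one_mul]
  congr 1
  simp only [mul_assoc, ← Finset.mul_sum]
  simp [Pi.single_apply]

end SUnitEquation

namespace SUnitEquation

open Finset

/-! ### Points on the hyperplane of sum zero -/

lemma pow_padicValInt_div_mem_localIntegers {q : ℕ} (hq : q.Prime) {x : ℤ} (hx : x ≠ 0) :
    (q : ℚ) ^ padicValInt q x * (1 / x) ∈ localIntegers q hq := by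
  have : Fact q.Prime := ⟨hq⟩
  obtain ⟨b, hb⟩ := (padicValInt_dvd (p := q) x)
  refine ⟨1, b, fun hqb => ?_, ?_⟩
  · have h1 : (q : ℤ) ^ (padicValInt q x + 1) ∣ x := by
      rw [pow_succ]
      conv_rhs => rw [hb]
      exact mul_dvd_mul_left _ hqb
    rw [padicValInt_dvd_iff] at h1
    rcases h1 with h1 | h1
    · exact hx h1
    · omega
  · have hx' : (x : ℚ) ≠ 0 := by exact_mod_cast hx
    have hb' : (x : ℚ) = (q : ℚ) ^ padicValInt q x * b := by exact_mod_cast hb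
    rw [mul_one_div, div_mul_eq_mul_div, ← hb', div_self hx', Int.cast_one]

lemma sum_padicValInt_mul_log_le {S : Finset ℕ} (hS : ∀ q ∈ S, q.Prime) {x : ℤ} (hx : x ≠ 0) :
    ∑ q ∈ S, padicValInt q x * Real.log q ≤ Real.log |(x : ℝ)| := by
  have h1 : ∏ q ∈ S, q ^ padicValInt q x ∣ x.natAbs := by
    rw [← Int.natCast_dvd_natCast, Int.dvd_natAbs, Nat.cast_prod]
    refine Finset.prod_dvd_of_coprime (fun q hq q' hq' hne => ?_) fun q hq => ?_
    · exact Nat.isCoprime_iff_coprime.2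
        (((Nat.coprime_primes (hS q hq) (hS q' hq')).2 hne).pow _ _)
    · rw [Nat.cast_pow]
      have : Fact q.Prime := ⟨hS q hq⟩
      exact padicValInt_dvd x
  have h2 := Nat.le_of_dvd (Int.natAbs_pos.2 hx) h1
  have h3 : Real.log (∏ q ∈ S, q ^ padicValInt q x : ℕ) =
      ∑ q ∈ S, padicValInt q x * Real.log q := by
    rw [Nat.cast_prod, Real.log_prod fun q hq => by
      exact_mod_cast (pow_pos (hS q hq).pos _).ne']
    exact Finset.sum_congr rfl fun q _ => by rw [Nat.cast_pow, Real.log_pow]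
  rw [← h3, ← Int.cast_abs, Int.abs_eq_natAbs, Int.cast_natCast]
  refine Real.log_le_log ?_ (by exact_mod_cast h2)
  exact_mod_cast Finset.prod_pos fun q hq => pow_pos (hS q hq).pos _

/-- Integral vectors of sum zero give rise to approximating parallelepipeds. -/
lemma exists_approxPoint {S : Finset ℕ} (hS : ∀ q ∈ S, q.Prime) {n : ℕ} {p : Fin (n + 3) → ℤ}
    (hp : ∀ i, p i ≠ 0) (hcop : ∀ q : ℕ, q.Prime → ∃ i, ¬ (q : ℤ) ∣ p i) (hsum : ∑ i, p i = 0)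
    {c : Fin (n + 2)} {g : Fin (n + 2) → Fin (n + 3) → ℤ} (hg : ∀ l, ∑ i, g l i = 0) {h κ ε : ℝ}
    (hh : 0 < h) (hε : 0 < ε) (hlog : ∀ i, Real.log |(p i : ℝ)| ≤ h) {C : ℕ} (hC1 : 1 ≤ C)
    (hC : ∀ (q : ℕ) (hq : q.Prime), q ∉ S → ∀ i, (C : ℚ) * (1 / p i) ∈ localIntegers q hq)
    (hCh : Real.log C ≤ h * ε) {ρ : Fin (n + 2) → ℝ} {M : Matrix (Fin (n + 2)) (Fin (n + 2)) ℚ}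
    (hM : ∀ i l, M i l = if l = c then (if i = 0 then (1 : ℚ) else 0) else
      (g l i.succ : ℚ) * (1 / (p i.succ : ℚ)) - (g l 0 : ℚ) * (1 / (p 0 : ℚ))) (hdet : M.det ≠ 0)
    (habs : ∀ i l, l ≠ c → |(M i l : ℝ)| ≤ Real.exp (-(h * ρ i)))
    {u w : ℤ} (huw : IsCoprime u w) (hw : w ≠ 0) (heq : -(p 2 : ℚ) / p 1 = u / w)
    (hκ : κ * h ≤ Real.log (max |(u : ℝ)| |(w : ℝ)|)) :
    ∃ (k : ℕ → Option (Fin (n + 2))) (γ : ℕ → Fin (n + 2) → ℝ),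
      (∀ q ∈ S, ∀ i, 0 ≤ γ q i ∧ γ q i ≤ 2) ∧
      ∑ q ∈ S, ∑ i, γ q i ≤ (∑ i, Real.log |(p i : ℝ)|) / h ∧
      Nonempty (ApproxPoint S baseChange k c γ ρ κ ε h) := by
  have hlogq : ∀ q ∈ S, 0 < Real.log q := fun q hq =>
    Real.log_pos (by exact_mod_cast (hS q hq).one_lt)
  have hk : ∀ q : ℕ, ∃ k : Option (Fin (n + 2)), q.Prime → ¬ (q : ℤ) ∣ p (k.elim 0 Fin.succ) := by
    intro q
    by_cases hq : q.Prime
    · obtain ⟨i, hi⟩ := hcop q hq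
      rcases Fin.eq_zero_or_eq_succ i with rfl | ⟨j, rfl⟩
      · exact ⟨none, fun _ => hi⟩
      · exact ⟨some j, fun _ => hi⟩
    · exact ⟨none, fun h => absurd h hq⟩
  choose k hk using hk
  set a : ℕ → Fin (n + 2) → ℕ := fun q i =>
    padicValInt q (p i.succ) + if k q = some i then padicValInt q (p 0) else 0 with ha
  have hpad : ∀ q ∈ S, ∀ i, padicValInt q (p i) * Real.log q ≤ h := fun q hq i => by
    refine le_trans ?_ ((sum_padicValInt_mul_log_le hS (hp i)).trans (hlog i))
    exact Finset.single_le_sum (f := fun q : ℕ => padicValInt q (p i) * Real.log q)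
      (fun q hq => mul_nonneg (Nat.cast_nonneg _) (hlogq q hq).le) hq
  have hah : ∀ q ∈ S, ∀ i, a q i * Real.log q ≤ 2 * h := fun q hq i => by
    have h1 : (a q i : ℝ) ≤ padicValInt q (p i.succ) + padicValInt q (p 0) := by
      rw [ha]
      push_cast
      split_ifs <;> simp
    have h2 := mul_le_mul_of_nonneg_right h1 (hlogq q hq).le
    linarith [hpad q hq 0, hpad q hq i.succ]
  refine ⟨k, fun q i => a q i * Real.log q / h, fun q hq i => ⟨?_, ?_⟩, ?_, ⟨?_⟩⟩
  · exact div_nonneg (mul_nonneg (Nat.cast_nonneg _) (hlogq q hq).le) hh.le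
  · rw [div_le_iff₀ hh]
    exact hah q hq i
  · simp only [← Finset.sum_div]
    refine div_le_div_of_nonneg_right ?_ hh.le
    refine le_trans ?_ (Finset.sum_le_sum fun i _ => sum_padicValInt_mul_log_le hS (hp i))
    rw [Finset.sum_comm (s := (univ : Finset (Fin (n + 3))))]
    refine Finset.sum_le_sum fun q hq => ?_
    rw [← Finset.sum_mul, ← Finset.sum_mul]
    refine mul_le_mul_of_nonneg_right ?_ (hlogq q hq).le
    rw [Fin.sum_univ_succ (n := n + 2)]
    have h1 : ∑ i, ((if k q = some i then padicValInt q (p 0) else 0 : ℕ) : ℝ) ≤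
        padicValInt q (p 0) := by
      rw [← Nat.cast_sum]
      refine Nat.cast_le.2 ?_
      cases k q with
      | none => simp
      | some j => simp
    rw [ha]
    push_cast at h1 ⊢
    rw [Finset.sum_add_distrib]
    linarith
  · have hpq : ∀ i, (p i : ℚ) ≠ 0 := fun i => by exact_mod_cast hp i
    refine ⟨M, fun i => p i.succ, u, w, a, C, isUnit_iff_ne_zero.2 hdet, fun i => by simp [hM],
      hpq _, fun l hl => ?_, huw, hw, heq, hκ, fun i l hl => ?_, fun q hq i => ?_,
      fun q hq i l => ?_, hC1, hCh, fun q hq hqS i l => ?_⟩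
    · have h1 : ∀ i : Fin (n + 2), (p i.succ : ℚ) * M i l =
          g l i.succ - g l 0 * (1 / p 0) * p i.succ := fun i => by
        rw [hM, if_neg hl]
        field_simp [hpq i.succ, hpq 0]
      simp only [h1]
      rw [Finset.sum_sub_distrib, ← Finset.mul_sum]
      have h2 := hg l
      have h3 := hsum
      rw [Fin.sum_univ_succ] at h2 h3
      have h2' : ∑ i : Fin (n + 2), (g l i.succ : ℚ) = -g l 0 := by
        rw [eq_neg_iff_add_eq_zero, add_comm]
        exact_mod_cast h2
      have h3' : ∑ i : Fin (n + 2), (p i.succ : ℚ) = -p 0 := by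
        rw [eq_neg_iff_add_eq_zero, add_comm]
        exact_mod_cast h3
      rw [h2', h3']
      field_simp [hpq 0]
      ring
    · refine (habs i l hl).trans (Real.exp_le_exp.2 ?_)
      nlinarith
    · rw [mul_add, mul_div_cancel₀ _ hh.ne']
      exact le_add_of_nonneg_right (by positivity)
    · have hqp := hS q hq
      have hx := fun i => pow_padicValInt_div_mem_localIntegers hqp (hp i)
      set O := localIntegers q hqp
      rw [← mem_localIntegers (hq := hqp)]
      have hunit : (1 / (p ((k q).elim 0 Fin.succ) : ℚ)) ∈ O := by
        have h1 := hx ((k q).elim 0 Fin.succ)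
        rwa [padicValInt.eq_zero_of_not_dvd (hk q hqp), pow_zero, one_mul] at h1
      have hqO : ∀ t : ℕ, (q : ℚ) ^ t ∈ O := fun t => O.pow_mem (natCast_mem O q) t
      cases hkq : k q with
      | none =>
        rw [hkq] at hunit
        rw [baseChange_none_mul, hM]
        split_ifs with h1 h2
        · exact O.mul_mem (hqO _) O.one_mem
        · exact O.mul_mem (hqO _) O.zero_mem
        · have h3 : a q i = padicValInt q (p i.succ) := by simp [ha, hkq]
          rw [h3, mul_sub, mul_left_comm]
          exact O.sub_mem (O.mul_mem (intCast_mem O _) (hx _))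
            (O.mul_mem (hqO _) (O.mul_mem (intCast_mem O _) hunit))
      | some j =>
        rw [hkq] at hunit
        rw [baseChange_some_mul]
        by_cases hl : l = c
        · refine O.mul_mem (hqO _) (O.sub_mem ?_ (O.mul_mem ?_ ?_))
          · rw [hM, if_pos hl]
            split_ifs
            exacts [O.one_mem, O.zero_mem]
          · split_ifs
            exacts [ofNat_mem O 2, O.one_mem]
          · rw [hM, if_pos hl]
            split_ifs
            exacts [O.one_mem, O.zero_mem]
        · rw [hM, hM, if_neg hl, if_neg hl]
          by_cases hij : i = j
          · subst hij
            have h3 : a q i = padicValInt q (p 0) + padicValInt q (p i.succ) := by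
              simp [ha, hkq, add_comm]
            rw [if_pos rfl, h3, pow_add]
            have h4 : (q : ℚ) ^ padicValInt q (p 0) * (q : ℚ) ^ padicValInt q (p i.succ) *
                (g l i.succ * (1 / p i.succ) - g l 0 * (1 / p 0) -
                  2 * (g l i.succ * (1 / p i.succ) - g l 0 * (1 / p 0))) =
                (q : ℚ) ^ padicValInt q (p i.succ) *
                  (g l 0 * ((q : ℚ) ^ padicValInt q (p 0) * (1 / p 0))) -
                (q : ℚ) ^ padicValInt q (p 0) * (q : ℚ) ^ padicValInt q (p i.succ) *
                  (g l i.succ * (1 / p i.succ)) := by ring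
            rw [h4]
            exact O.sub_mem (O.mul_mem (hqO _) (O.mul_mem (intCast_mem O _) (hx _)))
              (O.mul_mem (O.mul_mem (hqO _) (hqO _)) (O.mul_mem (intCast_mem O _) hunit))
          · have h3 : a q i = padicValInt q (p i.succ) := by
              simp [ha, hkq, Ne.symm hij]
            rw [if_neg hij, h3, one_mul]
            have h4 : (q : ℚ) ^ padicValInt q (p i.succ) *
                (g l i.succ * (1 / p i.succ) - g l 0 * (1 / p 0) -
                  (g l j.succ * (1 / p j.succ) - g l 0 * (1 / p 0))) =
                g l i.succ * ((q : ℚ) ^ padicValInt q (p i.succ) * (1 / p i.succ)) -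
                (q : ℚ) ^ padicValInt q (p i.succ) * (g l j.succ * (1 / p j.succ)) := by ring
            rw [h4]
            exact O.sub_mem (O.mul_mem (intCast_mem O _) (hx _))
              (O.mul_mem (hqO _) (O.mul_mem (intCast_mem O _) hunit))
    · have hx := hC q hq hqS
      rw [← mem_localIntegers (hq := hq)]
      set O := localIntegers q hq
      rw [hM]
      split_ifs
      · exact O.mul_mem (natCast_mem O _) O.one_mem
      · exact O.mul_mem (natCast_mem O _) O.zero_mem
      · rw [mul_sub, mul_left_comm, mul_left_comm (C : ℚ)]
        exact O.sub_mem (O.mul_mem (intCast_mem O _) (hx _)) (O.mul_mem (intCast_mem O _) (hx _))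

end SUnitEquation

namespace SUnitEquation

open Finset

/-! ### Three integers of sum zero -/

lemma exists_not_dvd_of_isCoprime {N : ℕ} {p : Fin N → ℤ} {i j : Fin N}
    (h : IsCoprime (p i) (p j)) (q : ℕ) (hq : q.Prime) : ∃ i, ¬ (q : ℤ) ∣ p i := by
  by_contra! hall
  exact (Nat.prime_iff_prime_int.1 hq).not_isUnit (h.isUnit_of_dvd' (hall i) (hall j))

/-- Coprime integers of sum zero cannot be `S`-units up to a factor small compared to their
size. -/
theorem exists_lt_of_sum_three_eq_zero {S : Finset ℕ} (hS : ∀ q ∈ S, q.Prime) :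
    ∃ α : ℝ, 0 < α ∧ ∃ X : ℝ, ∀ p : Fin 3 → ℤ, (∀ i, p i ≠ 0) → IsCoprime (p 1) (p 2) →
      ∑ i, p i = 0 → (∀ i, |p i| ≤ |p 0|) → ∀ C : ℕ, 1 ≤ C →
      (∀ (q : ℕ) (hq : q.Prime), q ∉ S → ∀ i, (C : ℚ) * (1 / p i) ∈ localIntegers q hq) →
      X ≤ Real.log |(p 0 : ℝ)| → α * Real.log |(p 0 : ℝ)| < Real.log C := by
  by_contra! H
  refine not_forall_exists_approxPoint_of_bounded hS (n := 0) baseChange_mul_self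
    (k₀ := none) (by simp [baseChange]) (c := 1) (κ := 1 / 2) (B := 2) (δ := 1) (by norm_num)
    one_pos fun ε hε X => ?_
  obtain ⟨p, hp, hcop, hsum, hmax, C, hC1, hC, hX, hCε⟩ := H ε hε (max X 2)
  have hX2 : 2 ≤ Real.log |(p 0 : ℝ)| := (le_max_right _ _).trans hX
  have hsum' : p 0 + p 1 + p 2 = 0 := by rw [← hsum, Fin.sum_univ_three]
  have hcop' : IsCoprime (p 0) (p 1) := by
    have h1 : p 0 = -(p 2 + p 1) := by linarith
    obtain ⟨x, y, hxy⟩ := hcop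
    exact ⟨-y, x - y, by rw [h1]; linear_combination hxy⟩
  obtain ⟨a, b, hab⟩ := hcop'
  set h := Real.log |(p 0 : ℝ)| with hh
  have h0 : 0 < h := by linarith
  have hpq : ∀ i, (p i : ℚ) ≠ 0 := fun i => by exact_mod_cast hp i
  have hpr : ∀ i, 0 < |(p i : ℝ)| := fun i => abs_pos.2 (by exact_mod_cast hp i)
  have hp1 : ∀ i, 1 ≤ |(p i : ℝ)| := fun i => by
    rw [← Int.cast_abs]
    exact_mod_cast Int.one_le_abs (hp i)
  have hmaxr : ∀ i, |(p i : ℝ)| ≤ |(p 0 : ℝ)| := fun i => by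
    rw [← Int.cast_abs, ← Int.cast_abs]
    exact_mod_cast hmax i
  have hlog : ∀ i, Real.log |(p i : ℝ)| ≤ h := fun i => Real.log_le_log (hpr i) (hmaxr i)
  have hlog0 : ∀ i, 0 ≤ Real.log |(p i : ℝ)| := fun i => Real.log_nonneg (hp1 i)
  set M : Matrix (Fin 2) (Fin 2) ℚ := !![1 / (p 0 * p 1), 1; -1 / (p 0 * p 2), 0] with hM
  set ρ : Fin 2 → ℝ := ![(h + Real.log |(p 1 : ℝ)|) / h, (h + Real.log |(p 2 : ℝ)|) / h] with hρ
  have habQ : (a * p 0 + b * p 1 : ℚ) = 1 := by exact_mod_cast hab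
  have hsumQ : (p 2 : ℚ) = -p 0 - p 1 := by
    have : p 2 = -p 0 - p 1 := by linarith
    exact_mod_cast this
  have hM' : ∀ i l, M i l = if l = 1 then (if i = 0 then (1 : ℚ) else 0) else
      ((![-b, a, b - a] : Fin 3 → ℤ) i.succ : ℚ) * (1 / (p i.succ : ℚ)) -
        ((![-b, a, b - a] : Fin 3 → ℤ) 0 : ℚ) * (1 / (p 0 : ℚ)) := by
    intro i l
    have h1 : (1 : ℚ) / (p 0 * p 1) = a * (1 / p 1) - -b * (1 / p 0) := by
      field_simp [hpq 0, hpq 1]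
      linarith
    have h2 : (-1 : ℚ) / (p 0 * p 2) = (b - a) * (1 / p 2) - -b * (1 / p 0) := by
      field_simp [hpq 0, hpq 2]
      rw [hsumQ]
      linarith
    fin_cases i <;> fin_cases l <;> simp [hM]
    · simpa using h1
    · simpa using h2
  have hdet : M.det ≠ 0 := by
    rw [hM, Matrix.det_fin_two_of]
    simp [hpq 0, hpq 2]
  have habs : ∀ i l, l ≠ 1 → |(M i l : ℝ)| ≤ Real.exp (-(h * ρ i)) := by
    intro i l hl
    have hl0 : l = 0 := by omega
    subst hl0
    have h2 : ∀ j, Real.exp (-(h * ((h + Real.log |(p j : ℝ)|) / h))) =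
        1 / (|(p 0 : ℝ)| * |(p j : ℝ)|) := by
      intro j
      rw [mul_div_cancel₀ _ h0.ne', Real.exp_neg, Real.exp_add, hh, Real.exp_log (hpr 0),
        Real.exp_log (hpr j), one_div]
    fin_cases i
    · simp only [hM, hρ, Fin.zero_eta, Matrix.cons_val_zero, Matrix.of_apply, h2]
      push_cast
      rw [abs_div, abs_mul, abs_one]
    · simp only [hM, hρ, Fin.mk_one, Matrix.cons_val_zero, Matrix.cons_val_one,
        Matrix.cons_val_fin_one, Matrix.of_apply, h2]
      push_cast
      rw [abs_div, abs_mul, abs_neg, abs_one]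
  have hκ : 1 / 2 * h ≤ Real.log (max |((-p 2 : ℤ) : ℝ)| |(p 1 : ℝ)|) := by
    have h1 : |(p 0 : ℝ)| ≤ 2 * max |((-p 2 : ℤ) : ℝ)| |(p 1 : ℝ)| := by
      have h2 : (p 0 : ℝ) = -(p 2 : ℝ) - p 1 := by
        have : p 0 = -p 2 - p 1 := by linarith
        exact_mod_cast this
      push_cast
      rw [h2]
      refine (abs_sub _ _).trans ?_
      linarith [le_max_left |-(p 2 : ℝ)| |(p 1 : ℝ)|, le_max_right |-(p 2 : ℝ)| |(p 1 : ℝ)|]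
    have h2 : 0 < max |((-p 2 : ℤ) : ℝ)| |(p 1 : ℝ)| := (hpr 1).trans_le (le_max_right _ _)
    have h3 := Real.log_le_log (hpr 0) h1
    rw [Real.log_mul two_ne_zero h2.ne'] at h3
    have h4 := Real.log_two_lt_d9
    linarith
  obtain ⟨k, γ, hγ, hγsum, pt⟩ := exists_approxPoint hS hp (exists_not_dvd_of_isCoprime hcop) hsum
    (c := 1) (g := fun _ => ![-b, a, b - a]) (fun _ => by simp [Fin.sum_univ_three]) h0 hε hlog hC1
    hC (by linarith) hM' hdet habs (u := -p 2) (w := p 1)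
    ((IsCoprime.neg_left_iff _ _).2 hcop.symm) (hp 1) (by simp) hκ
  refine ⟨h, (le_max_left _ _).trans hX, k, γ, ρ, hγ, fun i => ?_, ?_, pt⟩
  · fin_cases i
    · simp only [hρ, Fin.zero_eta, Matrix.cons_val_zero]
      exact ⟨div_nonneg (by linarith [hlog0 1]) h0.le, by
        rw [div_le_iff₀ h0]; linarith [hlog 1]⟩
    · simp only [hρ, Fin.mk_one, Matrix.cons_val_one, Matrix.cons_val_fin_one]
      exact ⟨div_nonneg (by linarith [hlog0 2]) h0.le, by
        rw [div_le_iff₀ h0]; linarith [hlog 2]⟩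
  · have h1 : ∑ i, ρ i = (∑ i, Real.log |(p i : ℝ)|) / h + 1 := by
      rw [Fin.sum_univ_two, Fin.sum_univ_three, hρ, ← hh]
      simp only [Matrix.cons_val_zero, Matrix.cons_val_one, Matrix.cons_val_fin_one]
      field_simp
      ring
    rw [h1]
    linarith

end SUnitEquation

namespace SUnitEquation

open Finset

/-! ### Linear relations with small coefficients -/

lemma one_div_mem_localIntegers {q : ℕ} (hq : q.Prime) {x : ℤ} (hx : ¬ (q : ℤ) ∣ x) :
    (1 / x : ℚ) ∈ localIntegers q hq := by
  have h := pow_padicValInt_div_mem_localIntegers hq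
    (x := x) (by rintro rfl; exact hx (dvd_zero _))
  rwa [padicValInt.eq_zero_of_not_dvd hx, pow_zero, one_mul] at h

lemma isCoprime_of_forall_prime {x y : ℤ} (h : ∀ q : ℕ, q.Prime → (q : ℤ) ∣ x → ¬ (q : ℤ) ∣ y) :
    IsCoprime x y := by
  rw [Int.isCoprime_iff_gcd_eq_one, Nat.eq_one_iff_not_exists_prime_dvd]
  intro q hq hqd
  have h1 := Int.natCast_dvd_natCast.2 hqd
  exact h q hq (h1.trans (Int.gcd_dvd_left ..)) (h1.trans (Int.gcd_dvd_right ..))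

/-- Coprime `S`-integral units do not satisfy linear relations with three nonzero terms and
coefficients small compared to their size. -/
theorem exists_lt_of_relation_three {S : Finset ℕ} (hS : ∀ q ∈ S, q.Prime) :
    ∃ β : ℝ, 0 < β ∧ ∃ X : ℝ, ∀ x b : Fin 3 → ℤ,
      (∀ i, ∀ q : ℕ, q.Prime → (q : ℤ) ∣ x i → q ∈ S) →
      (∀ q : ℕ, q.Prime → ∃ i, ¬ (q : ℤ) ∣ x i) → (∀ i, x i ≠ 0) → (∀ i, b i ≠ 0) →
      ∑ i, b i * x i = 0 → ∀ B : ℝ, (∀ i, |(b i : ℝ)| ≤ B) →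
      ∀ i, X ≤ Real.log |(x i : ℝ)| → β * Real.log |(x i : ℝ)| < Real.log B := by
  obtain ⟨α, hα, X, hX⟩ := exists_lt_of_sum_three_eq_zero hS
  refine ⟨min (1 / 6) (α / 6), by positivity, max (2 * X) 1, ?_⟩
  intro x b hxS hcop hx hb hsum B hB i hi
  by_contra! hlt
  set L := Real.log |(x i : ℝ)| with hL
  have hL1 : 1 ≤ L := (le_max_right _ _).trans hi
  have hLX : 2 * X ≤ L := (le_max_left _ _).trans hi
  have hbx : ∀ i, b i * x i ≠ 0 := fun i => mul_ne_zero (hb i) (hx i)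
  have hb1 : ∀ i, 1 ≤ |(b i : ℝ)| := fun i => by
    rw [← Int.cast_abs]
    exact_mod_cast Int.one_le_abs (hb i)
  have hB1 : 1 ≤ B := (hb1 0).trans (hB 0)
  set c : ℤ := ∏ i, b i with hc
  have hc0 : c ≠ 0 := Finset.prod_ne_zero_iff.2 fun i _ => hb i
  have hcB : |(c : ℝ)| ≤ B ^ 3 := by
    rw [hc, Int.cast_prod, Finset.abs_prod]
    refine (Finset.prod_le_prod (fun _ _ => abs_nonneg _) fun i _ => hB i).trans ?_
    simp
  set g : ℤ := univ.gcd fun i => b i * x i with hg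
  have hgd : ∀ i, g ∣ b i * x i := fun i => Finset.gcd_dvd (mem_univ i)
  choose p hp using hgd
  have hg0 : g ≠ 0 := fun h => hbx 0 (by rw [hp, h, zero_mul])
  have hp0 : ∀ i, p i ≠ 0 := fun i h => hbx i (by rw [hp, h, mul_zero])
  have hpsum : ∑ i, p i = 0 := by
    have h1 : g * ∑ i, p i = 0 := by
      rw [Finset.mul_sum, ← hsum]
      exact Finset.sum_congr rfl fun i _ => (hp i).symm
    exact (mul_eq_zero.1 h1).resolve_left hg0
  have hgx : univ.gcd x = 1 := by
    rw [← Finset.normalize_gcd, normalize_eq_one, Int.isUnit_iff_natAbs_eq,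
      Nat.eq_one_iff_not_exists_prime_dvd]
    intro q hq hqd
    obtain ⟨i, hi⟩ := hcop q hq
    exact hi ((Int.natCast_dvd.2 hqd).trans (Finset.gcd_dvd (mem_univ i)))
  have hgc : g ∣ c := by
    have h1 : g ∣ univ.gcd fun i => c * x i := by
      refine Finset.dvd_gcd fun i _ => ((Finset.gcd_dvd (mem_univ i)).trans ?_)
      exact mul_dvd_mul_right (Finset.dvd_prod_of_mem _ (mem_univ i)) _
    rw [Finset.gcd_mul_left, hgx, mul_one] at h1
    exact (dvd_normalize_iff).1 h1
  have hpcop : ∀ q : ℕ, q.Prime → ∃ i, ¬ (q : ℤ) ∣ p i := by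
    intro q hq
    by_contra! hall
    have h1 : g * q ∣ g := by
      conv_rhs => rw [hg]
      refine Finset.dvd_gcd fun i _ => ?_
      rw [hp]
      exact mul_dvd_mul_left _ (hall i)
    have h2 : (q : ℤ) ∣ 1 := by
      rw [← mul_dvd_mul_iff_left hg0, mul_one]
      exact h1
    exact (Nat.prime_iff_prime_int.1 hq).not_isUnit (isUnit_of_dvd_one h2)
  obtain ⟨m, -, hm⟩ := Finset.exists_max_image univ (fun i => |p i|) univ_nonempty
  set σ := Equiv.swap 0 m with hσ
  have hσ0 : σ 0 = m := Equiv.swap_apply_left _ _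
  have hpm : |(x i : ℝ)| / B ^ 3 ≤ |(p m : ℝ)| := by
    have h1 : |(p i : ℝ)| ≤ |(p m : ℝ)| := by
      rw [← Int.cast_abs, ← Int.cast_abs]
      exact_mod_cast hm i (mem_univ i)
    refine le_trans ?_ h1
    have h2 : |(b i : ℝ)| * |(x i : ℝ)| = |(g : ℝ)| * |(p i : ℝ)| := by
      rw [← abs_mul, ← abs_mul]
      exact_mod_cast congrArg (fun t : ℤ => |(t : ℝ)|) (hp i)
    have h3 : |(g : ℝ)| ≤ B ^ 3 := by
      refine le_trans ?_ hcB
      rw [← Int.cast_abs, ← Int.cast_abs]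
      exact_mod_cast Int.le_of_dvd (abs_pos.2 hc0) ((abs_dvd_abs _ _).2 hgc)
    rw [div_le_iff₀ (by positivity)]
    have h4 := mul_le_mul_of_nonneg_right (hb1 i) (abs_nonneg (x i : ℝ))
    have h5 := mul_le_mul_of_nonneg_right h3 (abs_nonneg (p i : ℝ))
    linarith
  have hBL : Real.log B ≤ L / 6 := hlt.trans (by
    have := mul_le_mul_of_nonneg_right (min_le_left (1 / 6) (α / 6)) (zero_le_one.trans hL1)
    linarith)
  have hBα : Real.log B ≤ α / 6 * L := hlt.trans
    (mul_le_mul_of_nonneg_right (min_le_right (1 / 6) (α / 6)) (zero_le_one.trans hL1))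
  have hxi : 0 < |(x i : ℝ)| := abs_pos.2 (by exact_mod_cast hx i)
  have hlogm : L / 2 ≤ Real.log |(p m : ℝ)| := by
    have h1 := Real.log_le_log (by positivity) hpm
    rw [Real.log_div hxi.ne' (by positivity), Real.log_pow] at h1
    push_cast at h1
    linarith
  have key := hX (p ∘ σ) (fun i => hp0 _) ?_ ?_ (fun i => ?_) c.natAbs
    (Int.natAbs_pos.2 hc0) (fun q hq hqS i => ?_) ?_
  · simp only [Function.comp_apply, hσ0] at key
    have h1 : Real.log c.natAbs ≤ 3 * Real.log B := by
      rw [← Int.cast_natCast (R := ℝ), ← Int.abs_eq_natAbs, Int.cast_abs]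
      have h2 := Real.log_le_log (abs_pos.2 (by exact_mod_cast hc0)) hcB
      rw [Real.log_pow] at h2
      exact_mod_cast h2
    have h2 := mul_le_mul_of_nonneg_left hlogm hα.le
    linarith
  · have h3 : p (σ 0) + p (σ 1) + p (σ 2) = 0 := by
      rw [← hpsum, ← Equiv.sum_comp σ p, Fin.sum_univ_three]
    refine isCoprime_of_forall_prime fun q hq h1 h2 => ?_
    obtain ⟨i, hi⟩ := hpcop q hq
    have h4 : (q : ℤ) ∣ p (σ 0) := by
      rw [show p (σ 0) = -(p (σ 1) + p (σ 2)) by linarith]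
      exact (dvd_add h1 h2).neg_right
    obtain ⟨i, rfl⟩ := σ.surjective i
    fin_cases i
    exacts [hi h4, hi h1, hi h2]
  · rw [← hpsum]
    exact Equiv.sum_comp σ p
  · simp only [Function.comp_apply, hσ0]
    exact hm _ (mem_univ _)
  · set j := σ i with hj
    obtain ⟨c', hc'⟩ : b j ∣ c := Finset.dvd_prod_of_mem _ (mem_univ j)
    have h1 : (c : ℚ) * (1 / p j) ∈ localIntegers q hq := by
      have h2 : (c : ℚ) * (1 / p j) = ((c' * g : ℤ) : ℚ) * (1 / x j) := by
        have h3 : (p j : ℚ) ≠ 0 := by exact_mod_cast hp0 j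
        have h4 : (x j : ℚ) ≠ 0 := by exact_mod_cast hx j
        have h5 : (b j * x j : ℚ) = g * p j := by exact_mod_cast hp j
        rw [hc']
        push_cast
        field_simp
        linear_combination (c' : ℚ) * h5
      rw [h2]
      exact mul_mem (intCast_mem _ _) (one_div_mem_localIntegers hq fun h => hqS (hxS j q hq h))
    have h2 : ((c.natAbs : ℤ) : ℚ) = c ∨ ((c.natAbs : ℤ) : ℚ) = -c := by
      rcases Int.natAbs_eq c with h | h
      · left
        exact_mod_cast h.symm
      · right
        rw [← Int.cast_neg]
        congr 1
        omega
    rw [Int.cast_natCast] at h2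
    rcases h2 with h2 | h2
    · rwa [h2]
    · rw [h2, neg_mul]
      exact neg_mem h1
  · simp only [Function.comp_apply, hσ0]
    linarith

end SUnitEquation

namespace SUnitEquation

open Finset

/-! ### Nondegenerate relations of four coprime integers -/

lemma exists_forall_ne_or_eq (w : Fin 4 → ℤ) (hw : ∃ i, w i ≠ w 0) :
    (∃ l, ∀ i, i ≠ l → w i ≠ w l) ∨
      ∃ i j k l, i ≠ j ∧ w i = w j ∧ w k = w l ∧ w i ≠ w k ∧
        ∀ p : Fin 4 → ℤ, ∑ m, p m = p i + p j + p k + p l := by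
  by_cases h01 : w 1 = w 0 <;> by_cases h02 : w 2 = w 0 <;> by_cases h03 : w 3 = w 0
  · obtain ⟨i, hi⟩ := hw
    fin_cases i <;> simp_all
  · exact .inl ⟨3, by simp [Fin.forall_fin_succ]; omega⟩
  · exact .inl ⟨2, by simp [Fin.forall_fin_succ]; omega⟩
  · by_cases h : w 2 = w 3
    · exact .inr ⟨0, 1, 2, 3, by simp, h01.symm, h, Ne.symm h02, fun p => Fin.sum_univ_four p⟩
    · exact .inl ⟨2, by simp [Fin.forall_fin_succ]; omega⟩
  · exact .inl ⟨1, by simp [Fin.forall_fin_succ]; omega⟩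
  · by_cases h : w 1 = w 3
    · exact .inr ⟨0, 2, 1, 3, by simp, h02.symm, h, Ne.symm h01,
        fun p => by rw [Fin.sum_univ_four]; ring⟩
    · exact .inl ⟨1, by simp [Fin.forall_fin_succ]; omega⟩
  · by_cases h : w 1 = w 2
    · exact .inr ⟨0, 3, 1, 2, by simp, h03.symm, h, Ne.symm h01,
        fun p => by rw [Fin.sum_univ_four]; ring⟩
    · exact .inl ⟨1, by simp [Fin.forall_fin_succ]; omega⟩
  · exact .inl ⟨0, by simp [Fin.forall_fin_succ]; omega⟩

/-- Four coprime integers supported on `S` without vanishing subsums do not satisfy a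
second linear relation with small coefficients. -/
theorem exists_lt_of_relation_four {S : Finset ℕ} (hS : ∀ q ∈ S, q.Prime) :
    ∃ β : ℝ, 0 < β ∧ ∃ X : ℝ, ∀ p w : Fin 4 → ℤ,
      (∀ i, ∀ q : ℕ, q.Prime → (q : ℤ) ∣ p i → q ∈ S) →
      (∀ q : ℕ, q.Prime → ∃ i, ¬ (q : ℤ) ∣ p i) → (∀ i, p i ≠ 0) → ∑ i, p i = 0 →
      (∀ i j, i ≠ j → p i + p j ≠ 0) → (∀ i, |p i| ≤ |p 0|) → ∑ i, w i * p i = 0 →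
      (∃ i, w i ≠ w 0) → ∀ W : ℝ, (∀ i, |(w i : ℝ)| ≤ W) →
      X ≤ Real.log |(p 0 : ℝ)| → β * Real.log |(p 0 : ℝ)| < Real.log W := by
  obtain ⟨β, hβ, X, hX⟩ := exists_lt_of_relation_three hS
  refine ⟨β / 4, by positivity, max (2 * X) (max 4 (4 * Real.log 2 / β)), ?_⟩
  intro p w hpS hcop hp hsum hnd hmax hw hwne W hW hh
  set h := Real.log |(p 0 : ℝ)| with hh0
  simp only [max_le_iff, div_le_iff₀ hβ] at hh
  obtain ⟨hX2, h4, hlog2⟩ := hh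
  rcases exists_forall_ne_or_eq w hwne with ⟨l, hl⟩ | ⟨i, j, k, l, hij, h1, h2, h3, h5⟩
  · have hs : p l + ∑ i, p (l.succAbove i) = 0 := by rw [← hsum, Fin.sum_univ_succAbove _ l]
    have hs' : w l * p l + ∑ i, w (l.succAbove i) * p (l.succAbove i) = 0 := by
      rw [← hw, Fin.sum_univ_succAbove _ l]
    have hrel : ∑ i, (w (l.succAbove i) - w l) * p (l.succAbove i) = 0 := by
      simp only [sub_mul, Finset.sum_sub_distrib, ← Finset.mul_sum]
      linear_combination hs' - w l * hs
    have hbig : ∃ i, |(p 0 : ℝ)| ≤ 3 * |(p (l.succAbove i) : ℝ)| := by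
      by_cases hl0 : l = 0
      · by_contra! hlt
        have h6 : (p 0 : ℝ) = -∑ i, (p (l.succAbove i) : ℝ) := by
          rw [hl0] at hs ⊢
          rw [eq_neg_iff_add_eq_zero]
          exact_mod_cast hs
        have h7 : |(p 0 : ℝ)| ≤ ∑ i, |(p (l.succAbove i) : ℝ)| := by
          rw [h6, abs_neg]
          exact Finset.abs_sum_le_sum_abs _ _
        rw [Fin.sum_univ_three] at h7
        linarith [hlt 0, hlt 1, hlt 2]
      · obtain ⟨i, hi⟩ := Fin.exists_succAbove_eq (Ne.symm hl0)
        exact ⟨i, by rw [hi]; linarith [abs_nonneg (p 0 : ℝ)]⟩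
    obtain ⟨i, hi⟩ := hbig
    have hp0 : 0 < |(p 0 : ℝ)| := abs_pos.2 (by exact_mod_cast hp 0)
    have hpi : 0 < |(p (l.succAbove i) : ℝ)| := abs_pos.2 (by exact_mod_cast hp _)
    have hlogi : h / 2 ≤ Real.log |(p (l.succAbove i) : ℝ)| := by
      have h1 := Real.log_le_log hp0 hi
      rw [Real.log_mul (by norm_num) hpi.ne'] at h1
      have h2 : Real.log 3 ≤ 2 := by
        have := Real.log_le_sub_one_of_pos (x := 3) (by norm_num)
        linarith
      linarith
    have key := hX (fun i => p (l.succAbove i)) (fun i => w (l.succAbove i) - w l)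
      (fun i => hpS _) (fun q hq => ?_) (fun i => hp _)
      (fun i => sub_ne_zero.2 (hl _ (Fin.succAbove_ne l i))) hrel (2 * W) (fun i => ?_) i
      (by linarith)
    · have hW0 : 0 < W := by
        obtain ⟨i, hi⟩ := hwne
        by_contra! h0
        have h1 : ∀ i, w i = 0 := fun i => by
          have := abs_nonpos_iff.1 ((hW i).trans h0)
          exact_mod_cast this
        exact hi (by rw [h1, h1])
      rw [Real.log_mul two_ne_zero hW0.ne'] at key
      have h1 := mul_le_mul_of_nonneg_left hlogi hβ.le
      linarith
    · by_contra! hall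
      obtain ⟨i, hi⟩ := hcop q hq
      have h1 : ∀ i, i ≠ l → (q : ℤ) ∣ p i := fun i hi => by
        obtain ⟨j, rfl⟩ := Fin.exists_succAbove_eq hi
        exact hall j
      have h2 : (q : ℤ) ∣ p l := by
        rw [eq_neg_of_add_eq_zero_left hs]
        exact (Finset.dvd_sum fun i _ => hall i).neg_right
      by_cases hil : i = l
      · exact hi (hil ▸ h2)
      · exact hi (h1 i hil)
    · push_cast
      refine (abs_sub _ _).trans ?_
      linarith [hW l, hW (l.succAbove i)]
  · have h6 := h5 fun m => w m * p m
    rw [hw] at h6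
    have h7 := h5 p
    rw [hsum] at h7
    exact absurd (mul_eq_zero.1 (show (w i - w k) * (p i + p j) = 0 by
      rw [← h1, ← h2] at h6
      linear_combination w k * h7 - h6)) (not_or.2 ⟨sub_ne_zero.2 h3, hnd i j hij⟩)

end SUnitEquation

namespace SUnitEquation

open Finset

/-! ### Reduction of plane lattices -/

lemma exists_two_mul_abs_sub_le {x : ℤ} (hx : x ≠ 0) (z : ℤ) : ∃ k : ℤ, 2 * |z - k * x| ≤ |x| := by
  refine ⟨round (z / x : ℚ), ?_⟩
  have h1 := abs_sub_round (z / x : ℚ)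
  have hx' : (x : ℚ) ≠ 0 := by exact_mod_cast hx
  have h2 : ((z - round (z / x : ℚ) * x : ℤ) : ℚ) = (z / x - round (z / x : ℚ)) * x := by
    push_cast
    field_simp
  have h3 : (2 * |((z - round (z / x : ℚ) * x : ℤ) : ℚ)|) ≤ |(x : ℚ)| := by
    rw [h2, abs_mul]
    have := mul_le_mul_of_nonneg_right h1 (abs_nonneg (x : ℚ))
    linarith
  exact_mod_cast h3

lemma le_and_mul_le_of_reduced {N Δ x y z t : ℤ} (hN : 0 < N) (hx : |x| = N) (hy : |y| ≤ N)
    (hz : 2 * |z| ≤ N) (hmin : N ≤ max |z| |t|) (hΔ : |x * t - y * z| = Δ) :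
    N ≤ |t| ∧ |t| * N ≤ 2 * Δ := by
  have h1 : N ≤ |t| := by
    rcases le_max_iff.1 hmin with h | h
    · linarith [abs_nonneg z]
    · exact h
  refine ⟨h1, ?_⟩
  have h2 : |x * t| ≤ |x * t - y * z| + |y * z| := by
    simpa using abs_add_le (x * t - y * z) (y * z)
  rw [abs_mul, abs_mul, hx, hΔ] at h2
  have h3 : |y| * |z| ≤ N * |z| := mul_le_mul_of_nonneg_right hy (abs_nonneg z)
  have h4 : N * (2 * |z|) ≤ N * |t| := mul_le_mul_of_nonneg_left (hz.trans h1) hN.le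
  linarith

/-- Gauss reduction for the sup norm. -/
lemma exists_reduced_basis (x y : Fin 2 → ℤ) (hΔ : x 0 * y 1 - x 1 * y 0 ≠ 0) :
    ∃ a b c d : ℤ, a * d - b * c = 1 ∧ ∃ i : Fin 2, 0 < |a * x i + b * y i| ∧
      (∀ j, |a * x j + b * y j| ≤ |a * x i + b * y i|) ∧
      2 * |c * x i + d * y i| ≤ |a * x i + b * y i| ∧
      ∀ j, j ≠ i → |a * x i + b * y i| ≤ |c * x j + d * y j| ∧
        |c * x j + d * y j| * |a * x i + b * y i| ≤ 2 * |x 0 * y 1 - x 1 * y 0| := by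
  have hex : ∃ n : ℕ, ∃ a b c d : ℤ, a * d - b * c = 1 ∧
      max |a * x 0 + b * y 0| |a * x 1 + b * y 1| = n := by
    refine ⟨(max |1 * x 0 + 0 * y 0| |1 * x 1 + 0 * y 1|).toNat, 1, 0, 0, 1, by norm_num, ?_⟩
    rw [Int.toNat_of_nonneg (le_max_of_le_left (abs_nonneg _))]
  classical
  obtain ⟨a, b, c, d, hdet, hN⟩ := Nat.find_spec hex
  have hmin : ∀ a b c d : ℤ, a * d - b * c = 1 →
      (Nat.find hex : ℤ) ≤ max |a * x 0 + b * y 0| |a * x 1 + b * y 1| := by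
    intro a b c d h
    rw [← Int.toNat_of_nonneg (le_max_of_le_left (abs_nonneg (a * x 0 + b * y 0)))]
    refine Nat.cast_le.2 (Nat.find_min' hex ⟨a, b, c, d, h, ?_⟩)
    rw [Int.toNat_of_nonneg (le_max_of_le_left (abs_nonneg _))]
  obtain ⟨N, hNdef⟩ : ∃ N : ℤ, N = (Nat.find hex : ℕ) := ⟨_, rfl⟩
  rw [← hNdef] at hN
  simp only [← hNdef] at hmin
  obtain ⟨i, j, hij, hi, hj, hmax⟩ : ∃ i j : Fin 2, i ≠ j ∧ |a * x i + b * y i| = N ∧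
      |a * x j + b * y j| ≤ N ∧ ∀ z : Fin 2 → ℤ, max (z 0) (z 1) = max (z i) (z j) := by
    rcases le_total |a * x 0 + b * y 0| |a * x 1 + b * y 1| with h | h
    · rw [max_eq_right h] at hN
      exact ⟨1, 0, by simp, hN, hN ▸ h, fun z => max_comm _ _⟩
    · rw [max_eq_left h] at hN
      exact ⟨0, 1, by simp, hN, hN ▸ h, fun z => rfl⟩
  have huniv : ∀ k, k = i ∨ k = j := by omega
  have hΔij : ∀ a b c d : ℤ, a * d - b * c = 1 → |(a * x i + b * y i) * (c * x j + d * y j) -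
      (a * x j + b * y j) * (c * x i + d * y i)| = |x 0 * y 1 - x 1 * y 0| := by
    intro a b c d h
    have h1 : (a * x i + b * y i) * (c * x j + d * y j) -
      (a * x j + b * y j) * (c * x i + d * y i) = x i * y j - x j * y i := by
      linear_combination (x i * y j - x j * y i) * h
    rw [h1]
    obtain ⟨rfl, rfl⟩ | ⟨rfl, rfl⟩ : i = 0 ∧ j = 1 ∨ i = 1 ∧ j = 0 := by omega
    · rfl
    · rw [abs_sub_comm]
  have hN0 : 0 < N := by
    refine lt_of_le_of_ne (hi ▸ abs_nonneg _) fun h0 => hΔ ?_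
    rw [← abs_eq_zero, ← hΔij a b c d hdet, abs_eq_zero]
    rw [← h0] at hi hj
    rw [abs_eq_zero.1 hi, abs_nonpos_iff.1 hj]
    ring
  obtain ⟨k, hk⟩ := exists_two_mul_abs_sub_le (x := a * x i + b * y i)
    (fun h => by rw [h, abs_zero] at hi; omega) (c * x i + d * y i)
  rw [show c * x i + d * y i - k * (a * x i + b * y i) = (c - k * a) * x i + (d - k * b) * y i by
    ring, hi] at hk
  have hdet' : a * (d - k * b) - b * (c - k * a) = 1 := by linear_combination hdet
  have h1 := hmin (c - k * a) (d - k * b) (-a) (-b) (by linear_combination hdet)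
  rw [hmax fun l => |(c - k * a) * x l + (d - k * b) * y l|] at h1
  refine ⟨a, b, c - k * a, d - k * b, hdet', i, by rwa [hi], fun l => ?_, by rwa [hi],
    fun l hl => ?_⟩
  · rw [hi]
    rcases huniv l with rfl | rfl
    exacts [hi.le, hj]
  · obtain rfl := (huniv l).resolve_left hl
    rw [hi]
    exact le_and_mul_le_of_reduced hN0 hi hj hk h1 (hΔij _ _ _ _ hdet')

/-- Small vectors modulo `p`. -/
lemma exists_reduced_vectors {p : Fin 4 → ℤ} (hcop : ∀ q : ℕ, q.Prime → ∃ i, ¬ (q : ℤ) ∣ p i)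
    (hp0 : p 0 ≠ 0) (hsum : ∑ i, p i = 0) :
    ∃ g : Fin 2 → Fin 4 → ℤ, (∀ l, ∑ i, g l i = 0) ∧ ∃ D : Fin 2 → Fin 3 → ℤ,
      (∀ l i, D l i = g l i.succ * p 0 - g l 0 * p i.succ) ∧
      D 0 0 * D 1 1 - D 0 1 * D 1 0 = p 0 ∧ ∃ i : Fin 3, ∃ j : Fin 3, i ≠ j ∧ i ≠ 2 ∧ j ≠ 2 ∧
      0 < |D 0 i| ∧ |D 0 j| ≤ |D 0 i| ∧ 2 * |D 1 i| ≤ |D 0 i| ∧ |D 0 i| ≤ |D 1 j| ∧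
      |D 1 j| * |D 0 i| ≤ 2 * |p 0| := by
  have hd : (Int.gcd (p 0) (p 1) : ℤ) ≠ 0 := by
    exact_mod_cast fun h => hp0 (Int.gcd_eq_zero_iff.1 h).1
  obtain ⟨a, ha⟩ := Int.gcd_dvd_left (p 0) (p 1)
  obtain ⟨b, hb⟩ := Int.gcd_dvd_right (p 0) (p 1)
  have hbez := Int.gcd_eq_gcd_ab (p 0) (p 1)
  have hcop' : IsCoprime (Int.gcd (p 0) (p 1) : ℤ) (p 2) := by
    refine isCoprime_of_forall_prime fun q hq h1 h2 => ?_
    obtain ⟨i, hi⟩ := hcop q hq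
    rw [Fin.sum_univ_four] at hsum
    have h3 := h1.trans (Int.gcd_dvd_left (p 0) (p 1))
    have h4 := h1.trans (Int.gcd_dvd_right (p 0) (p 1))
    have h5 : (q : ℤ) ∣ p 3 := by
      rw [show p 3 = -(p 0 + p 1 + p 2) by linarith]
      exact (dvd_add (dvd_add h3 h4) h2).neg_right
    fin_cases i
    exacts [hi h3, hi h4, hi h2, hi h5]
  generalize Int.gcdA (p 0) (p 1) = r, Int.gcdB (p 0) (p 1) = s at hbez
  generalize (Int.gcd (p 0) (p 1) : ℤ) = d at *
  have hrs : r * a + s * b = 1 := by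
    apply mul_left_cancel₀ hd
    linear_combination -hbez - r * ha - s * hb
  obtain ⟨t, v, htv⟩ := hcop'
  set e : Fin 2 → Fin 4 → ℤ :=
    ![![-s, r, 0, s - r], ![-v * a, -v * b, t, v * a + v * b - t]] with he
  have he0 : ∀ l, ∑ i, e l i = 0 := fun l => by
    fin_cases l <;> simp [he, Fin.sum_univ_four]
    ring
  set E : Fin 2 → Fin 3 → ℤ := fun l i => e l i.succ * p 0 - e l 0 * p i.succ with hE
  have hdet : E 0 0 * E 1 1 - E 0 1 * E 1 0 = p 0 := by
    have h1 : E 0 0 = r * p 0 + s * p 1 := by simp [hE, he]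
    have h2 : E 0 1 = s * p 2 := by simp [hE, he]
    have h3 : E 1 0 = -v * b * p 0 + v * a * p 1 := by simp [hE, he]
    have h4 : E 1 1 = t * p 0 + v * a * p 2 := by simp [hE, he]
    have h5 : r * p 0 + s * p 1 = d := by linear_combination -hbez
    have h6 : b * p 0 = a * p 1 := by linear_combination b * ha - a * hb
    rw [h1, h2, h3, h4, h5]
    linear_combination p 0 * htv - v * p 2 * ha + s * p 2 * v * h6
  obtain ⟨m₁, m₂, m₃, m₄, hm, i, h1, h2, h3, h4⟩ :=
    exists_reduced_basis (fun k => E 0 k.castSucc) (fun k => E 1 k.castSucc) (hdet ▸ hp0)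
  simp only [Fin.castSucc_zero, Fin.castSucc_one] at h4
  rw [hdet] at h4
  obtain ⟨j, hj⟩ : ∃ j : Fin 2, j ≠ i := exists_ne i
  refine ⟨![fun k => m₁ * e 0 k + m₂ * e 1 k, fun k => m₃ * e 0 k + m₄ * e 1 k], fun l => ?_,
    ![fun k => m₁ * E 0 k + m₂ * E 1 k, fun k => m₃ * E 0 k + m₄ * E 1 k], fun l k => ?_, ?_,
    i.castSucc, j.castSucc, ?_, ?_, ?_, h1, h2 j, h3, h4 j hj⟩
  · fin_cases l <;> simp [Finset.sum_add_distrib, ← Finset.mul_sum, he0]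
  · fin_cases l <;> simp [hE] <;> ring
  · simp only [Matrix.cons_val_zero, Matrix.cons_val_one, Matrix.cons_val_fin_one]
    linear_combination (E 0 0 * E 1 1 - E 0 1 * E 1 0) * hm + hdet
  · simpa using hj.symm
  · exact Fin.castSucc_lt_last i |>.ne
  · exact Fin.castSucc_lt_last j |>.ne

end SUnitEquation

namespace SUnitEquation

open Finset

/-! ### Boundedness of nondegenerate solutions -/

lemma abs_div_le_exp {H x z N : ℝ} (hH : H ≠ 0) (hx : x ≠ 0) (hz : |z| ≤ N) {r : ℝ}
    (hN : Real.log N = Real.log |H| + Real.log |x| - r) (hN0 : 0 < N) :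
    |z / (H * x)| ≤ Real.exp (-r) := by
  rw [abs_div, abs_mul, div_le_iff₀ (by positivity)]
  refine hz.trans (le_of_eq ?_)
  rw [← Real.exp_log hN0, hN, Real.exp_sub, Real.exp_add, Real.exp_log (abs_pos.2 hH),
    Real.exp_log (abs_pos.2 hx), Real.exp_neg]
  ring

/-- Nondegenerate vanishing sums of four coprime integers supported on `S` are bounded. -/
theorem exists_log_lt_of_sum_four_eq_zero {S : Finset ℕ} (hS : ∀ q ∈ S, q.Prime) :
    ∃ X : ℝ, ∀ p : Fin 4 → ℤ,
      (∀ i, ∀ q : ℕ, q.Prime → (q : ℤ) ∣ p i → q ∈ S) →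
      (∀ q : ℕ, q.Prime → ∃ i, ¬ (q : ℤ) ∣ p i) → (∀ i, p i ≠ 0) → ∑ i, p i = 0 →
      (∀ i j, i ≠ j → p i + p j ≠ 0) → (∀ i, |p i| ≤ |p 0|) → Real.log |(p 0 : ℝ)| < X := by
  obtain ⟨β, hβ, X₁, hX₁⟩ := exists_lt_of_relation_four hS
  by_contra! H
  refine not_forall_exists_approxPoint_of_bounded hS (n := 1) baseChange_mul_self
    (k₀ := none) (by simp [baseChange]) (c := 2) (κ := β) (B := 3) (δ := β / 2) hβ
    (by positivity) fun ε hε X => ?_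
  obtain ⟨p, hpS, hcop, hp, hsum, hnd, hmax, hX⟩ :=
    H (max (max X 2) (max X₁ (max (2 * (5 * Real.log 2) / β) (3 * Real.log 2 / β))))
  set h := Real.log |(p 0 : ℝ)| with hh
  simp only [max_le_iff, div_le_iff₀ hβ] at hX
  obtain ⟨⟨hXh, h2⟩, hX1, hlog5, hlog3⟩ := hX
  have h0 : 0 < h := by linarith
  have hl2 : 0 < Real.log 2 := Real.log_pos one_lt_two
  have hl2' := Real.log_two_lt_d9
  have hpq : ∀ i, (p i : ℚ) ≠ 0 := fun i => by exact_mod_cast hp i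
  have hpr : ∀ i, 0 < |(p i : ℝ)| := fun i => abs_pos.2 (by exact_mod_cast hp i)
  have hmaxr : ∀ i, |(p i : ℝ)| ≤ |(p 0 : ℝ)| := fun i => by
    rw [← Int.cast_abs, ← Int.cast_abs]
    exact_mod_cast hmax i
  have hlog : ∀ i, Real.log |(p i : ℝ)| ≤ h := fun i => Real.log_le_log (hpr i) (hmaxr i)
  have hlog0 : ∀ i, 0 ≤ Real.log |(p i : ℝ)| := fun i => Real.log_nonneg (by
    rw [← Int.cast_abs]
    exact_mod_cast Int.one_le_abs (hp i))
  have hrel : ∀ w : Fin 4 → ℤ, ∑ i, w i * p i = 0 → (∃ i, w i ≠ w 0) → ∀ W : ℝ,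
      (∀ i, |(w i : ℝ)| ≤ W) → β * h < Real.log W := fun w hw hne W hW =>
    hX₁ p w hpS hcop hp hsum hnd hmax hw hne W hW hX1
  have hsum4 : p 0 + p 1 + p 2 + p 3 = 0 := by rw [← hsum, Fin.sum_univ_four]
  obtain ⟨g, hg, D, hD, hdet, i, j, hij, hi2, hj2, hN0, hji, h2i, hij', hjN⟩ :=
    exists_reduced_vectors hcop (hp 0) hsum
  set N : ℝ := |(D 0 i : ℝ)| with hN
  have hN0 : 0 < N := by
    rw [hN, ← Int.cast_abs]
    exact_mod_cast hN0
  have hji : |(D 0 j : ℝ)| ≤ N := by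
    rw [hN, ← Int.cast_abs, ← Int.cast_abs]
    exact_mod_cast hji
  have h2i : 2 * |(D 1 i : ℝ)| ≤ N := by
    rw [hN, ← Int.cast_abs, ← Int.cast_abs]
    exact_mod_cast h2i
  have hij' : N ≤ |(D 1 j : ℝ)| := by
    rw [hN, ← Int.cast_abs, ← Int.cast_abs]
    exact_mod_cast hij'
  have hjN : |(D 1 j : ℝ)| * N ≤ 2 * |(p 0 : ℝ)| := by
    rw [hN, ← Int.cast_abs, ← Int.cast_abs, ← Int.cast_abs]
    exact_mod_cast hjN
  have hDsum : ∀ l, D l 0 + D l 1 + D l 2 = 0 := by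
    intro l
    have h1 := hg l
    rw [Fin.sum_univ_four] at h1
    have e1 : D l 0 = g l 1 * p 0 - g l 0 * p 1 := hD l 0
    have e2 : D l 1 = g l 2 * p 0 - g l 0 * p 2 := hD l 1
    have e3 : D l 2 = g l 3 * p 0 - g l 0 * p 3 := hD l 2
    rw [e1, e2, e3]
    linear_combination p 0 * h1 - g l 0 * hsum4
  have hij01 : i = 0 ∧ j = 1 ∨ i = 1 ∧ j = 0 := by omega
  have hNβ : β * h < Real.log 2 + Real.log N := by
    rw [← Real.log_mul two_ne_zero hN0.ne']
    have e1 : D 0 0 = g 0 1 * p 0 - g 0 0 * p 1 := hD 0 0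
    have e2 : D 0 1 = g 0 2 * p 0 - g 0 0 * p 2 := hD 0 1
    have hD0 : |(D 0 0 : ℝ)| ≤ N ∧ |(D 0 1 : ℝ)| ≤ N := by
      obtain ⟨rfl, rfl⟩ | ⟨rfl, rfl⟩ := hij01
      exacts [⟨le_rfl, hji⟩, ⟨hji, le_rfl⟩]
    refine hrel ![p 1 * g 0 2 - p 2 * g 0 1, -D 0 1, D 0 0, 0] ?_ ?_ _ ?_
    · simp only [Fin.sum_univ_four, Matrix.cons_val]
      rw [e1, e2]
      ring
    · by_contra! hall
      have h1 := hall 1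
      have h2 := hall 2
      have h3 := hall 3
      simp only [Matrix.cons_val] at h1 h2 h3
      rw [← h3] at h1 h2
      have h4 : D 0 i = 0 := by
        obtain ⟨rfl, -⟩ | ⟨rfl, -⟩ := hij01
        · exact h2
        · exact neg_eq_zero.1 h1
      rw [hN, h4] at hN0
      simp at hN0
    · have h1 : |((p 1 * g 0 2 - p 2 * g 0 1 : ℤ) : ℝ)| ≤ 2 * N := by
        have h2 : (p 0 : ℝ) * ((p 1 * g 0 2 - p 2 * g 0 1 : ℤ) : ℝ) =
            p 1 * D 0 1 - p 2 * D 0 0 := by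
          have : p 0 * (p 1 * g 0 2 - p 2 * g 0 1) = p 1 * D 0 1 - p 2 * D 0 0 := by
            rw [e1, e2]
            ring
          exact_mod_cast this
        have h3 : |(p 0 : ℝ)| * |((p 1 * g 0 2 - p 2 * g 0 1 : ℤ) : ℝ)| ≤
            |(p 0 : ℝ)| * (2 * N) := by
          rw [← abs_mul, h2]
          refine (abs_sub _ _).trans ?_
          rw [abs_mul, abs_mul, two_mul, mul_add]
          exact add_le_add (mul_le_mul (hmaxr 1) hD0.2 (abs_nonneg _) (abs_nonneg _))
            (mul_le_mul (hmaxr 2) hD0.1 (abs_nonneg _) (abs_nonneg _))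
        exact le_of_mul_le_mul_left h3 (hpr 0)
      intro k
      fin_cases k
      · exact h1
      · simpa using hD0.2.trans (by linarith)
      · simpa using hD0.1.trans (by linarith)
      · simpa using hN0.le
  have hNh : 2 * Real.log N ≤ h + Real.log 2 := by
    have h1 : N * N ≤ 2 * |(p 0 : ℝ)| := (mul_le_mul_of_nonneg_right hij' hN0.le).trans hjN
    have h2 := Real.log_le_log (by positivity) h1
    rw [Real.log_mul hN0.ne' hN0.ne', Real.log_mul two_ne_zero (hpr 0).ne'] at h2
    linarith
  set ρ : Fin 3 → ℝ := fun k => (Real.log |(p k.succ : ℝ)| +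
    if k = i then h - Real.log N else Real.log N - 2 * Real.log 2) / h with hρ
  set M : Matrix (Fin 3) (Fin 3) ℚ := fun k l => if l = 2 then (if k = 0 then (1 : ℚ) else 0) else
    ((![g 0, g 1, 0] : Fin 3 → Fin 4 → ℤ) l k.succ : ℚ) * (1 / (p k.succ : ℚ)) -
      ((![g 0, g 1, 0] : Fin 3 → Fin 4 → ℤ) l 0 : ℚ) * (1 / (p 0 : ℚ)) with hM
  have hMD : ∀ k, ∀ l : Fin 2, M k l.castSucc = D l k / (p 0 * p k.succ) := by
    intro k l
    have e1 : (D l k : ℚ) = g l k.succ * p 0 - g l 0 * p k.succ := by exact_mod_cast hD l k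
    have e2 : (![g 0, g 1, 0] : Fin 3 → Fin 4 → ℤ) l.castSucc = g l := by fin_cases l <;> rfl
    rw [hM, e1]
    simp only [e2]
    rw [if_neg (show l.castSucc ≠ (2 : Fin 3) from (Fin.castSucc_lt_last l).ne)]
    field_simp [hpq 0, hpq k.succ]
  have hdetM : M.det ≠ 0 := by
    have e0 : ∀ k, M k 0 = D 0 k / (p 0 * p k.succ) := fun k => hMD k 0
    have e1 : ∀ k, M k 1 = D 1 k / (p 0 * p k.succ) := fun k => hMD k 1
    have e2 : ∀ k, M k 2 = if k = 0 then 1 else 0 := fun k => if_pos rfl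
    have h1 : (D 0 1 * D 1 2 - D 1 1 * D 0 2 : ℚ) = p 0 := by
      have : D 0 1 * D 1 2 - D 1 1 * D 0 2 = p 0 := by
        linear_combination hdet + D 0 1 * hDsum 1 - D 1 1 * hDsum 0
      exact_mod_cast this
    have h2 : M.det = 1 / (p 0 * p (Fin.succ 1) * p (Fin.succ 2)) := by
      rw [Matrix.det_fin_three]
      simp only [e0, e1, e2, one_ne_zero, if_true, if_false, Fin.reduceEq, mul_zero]
      have h3 := hpq (Fin.succ 1)
      have h4 := hpq (Fin.succ 2)
      have h5 := hpq 0
      generalize (p (Fin.succ 1) : ℚ) = x, (p (Fin.succ 2) : ℚ) = y at *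
      field_simp
      linear_combination h1
    rw [h2]
    exact one_div_ne_zero (mul_ne_zero (mul_ne_zero (hpq 0) (hpq _)) (hpq _))
  have hDN : ∀ l k, k ≠ i → |(D l k : ℝ)| ≤ 4 * |(p 0 : ℝ)| / N := by
    have h1 : |(D 1 j : ℝ)| ≤ 2 * |(p 0 : ℝ)| / N := (le_div_iff₀ hN0).2 hjN
    have h3 : 4 * |(p 0 : ℝ)| / N = 2 * |(p 0 : ℝ)| / N + 2 * |(p 0 : ℝ)| / N := by ring
    have h4 : ∀ l, |(D l j : ℝ)| ≤ 2 * |(p 0 : ℝ)| / N ∧ |(D l i : ℝ)| ≤ 2 * |(p 0 : ℝ)| / N := by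
      intro l
      fin_cases l
      · exact ⟨hji.trans (hij'.trans h1), hij'.trans h1⟩
      · exact ⟨h1, by
          show |(D 1 i : ℝ)| ≤ _
          linarith [abs_nonneg (D 1 i : ℝ)]⟩
    intro l k hk
    rw [h3]
    have h5 : k = j ∨ k = 2 := by omega
    rcases h5 with rfl | rfl
    · linarith [(h4 l).1, abs_nonneg (D l k : ℝ)]
    · have h6 : (D l 2 : ℝ) = -(D l i + D l j) := by
        have h7 : D l 2 = -(D l i + D l j) := by
          have := hDsum l
          obtain ⟨rfl, rfl⟩ | ⟨rfl, rfl⟩ := hij01 <;> linarith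
        exact_mod_cast h7
      rw [h6, abs_neg]
      exact (abs_add_le _ _).trans (add_le_add (h4 l).2 (h4 l).1)
  have habs : ∀ k l, l ≠ 2 → |(M k l : ℝ)| ≤ Real.exp (-(h * ρ k)) := by
    intro k l hl
    obtain ⟨l, rfl⟩ := Fin.exists_castSucc_eq.2 hl
    rw [hMD]
    push_cast
    have hp0 : (p 0 : ℝ) ≠ 0 := by exact_mod_cast hp 0
    have hpk : (p k.succ : ℝ) ≠ 0 := by exact_mod_cast hp k.succ
    by_cases hki : k = i
    · refine abs_div_le_exp hp0 hpk (N := N) ?_ ?_ hN0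
      · rw [hki]
        fin_cases l
        · exact le_rfl
        · show |(D 1 i : ℝ)| ≤ N
          linarith [abs_nonneg (D 1 i : ℝ)]
      · simp only [hρ, if_pos hki, mul_div_cancel₀ _ h0.ne']
        ring
    · refine abs_div_le_exp hp0 hpk (hDN l k hki) ?_ (div_pos (mul_pos four_pos (hpr 0)) hN0)
      have h4 : Real.log 4 = 2 * Real.log 2 := by
        rw [show (4 : ℝ) = 2 ^ 2 by norm_num, Real.log_pow]
        norm_num
      rw [Real.log_div (mul_pos four_pos (hpr 0)).ne' hN0.ne',
        Real.log_mul four_ne_zero (hpr 0).ne', h4]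
      simp only [hρ, if_neg hki, mul_div_cancel₀ _ h0.ne']
      ring
  obtain ⟨u, w, huw, hw, heq, hκ⟩ : ∃ u w : ℤ, IsCoprime u w ∧ w ≠ 0 ∧
      -(p 2 : ℚ) / p 1 = u / w ∧ β * h ≤ Real.log (max |(u : ℝ)| |(w : ℝ)|) := by
    obtain ⟨d, a, b, hd, hab, hpa, hpb⟩ :=
      Int.exists_gcd_one' (m := p 1) (n := p 2) (Int.gcd_pos_of_ne_zero_left _ (hp 1))
    have ha : a ≠ 0 := fun h => hp 1 (by rw [hpa, h, zero_mul])
    refine ⟨-b, a, ((Int.isCoprime_iff_gcd_eq_one).2 hab).symm.neg_left, ha, ?_, ?_⟩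
    · have ha' : (a : ℚ) ≠ 0 := by exact_mod_cast ha
      have hd' : (d : ℚ) ≠ 0 := by exact_mod_cast hd.ne'
      rw [hpa, hpb]
      push_cast
      field_simp
    · refine (hrel ![0, -b, a, 0] ?_ ⟨2, by simpa using ha⟩ _ fun k => ?_).le
      · simp only [Fin.sum_univ_four, Matrix.cons_val]
        rw [hpa, hpb]
        ring
      · fin_cases k <;> simp
  obtain ⟨k, γ, hγ, hγsum, pt⟩ := exists_approxPoint hS hp hcop hsum (c := 2)
    (g := ![g 0, g 1, 0]) (fun l => by fin_cases l <;> simp [hg]) h0 hε hlog le_rfl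
    (fun q hq hqS i => by
      rw [Nat.cast_one, one_mul]
      exact one_div_mem_localIntegers hq fun hd => hqS (hpS i q hq hd))
    (by simp; positivity) (fun _ _ => rfl) hdetM habs huw hw heq hκ
  refine ⟨h, hXh, k, γ, ρ, fun q hq i => ⟨(hγ q hq i).1, (hγ q hq i).2.trans (by norm_num)⟩,
    fun k => ?_, ?_, pt⟩
  · rw [hρ, le_div_iff₀ h0, zero_mul, div_le_iff₀ h0]
    have := hlog k.succ
    have := hlog0 k.succ
    split_ifs
    · constructor <;> linarith
    · constructor <;> linarith
  · have h1 : ∑ k, ρ k =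
        (∑ i, Real.log |(p i : ℝ)|) / h + (Real.log N - 4 * Real.log 2) / h := by
      rw [hρ, ← Finset.sum_div, ← add_div, Finset.sum_add_distrib,
        Fin.sum_univ_succ (fun i => Real.log |(p i : ℝ)|), ← hh]
      congr 1
      have : ∑ k, (if k = i then h - Real.log N else Real.log N - 2 * Real.log 2) =
          h - Real.log N + 2 * (Real.log N - 2 * Real.log 2) := by
        rw [Fin.sum_univ_three]
        obtain ⟨rfl, -⟩ | ⟨rfl, -⟩ := hij01 <;> simp <;> ring
      rw [this]
      ring
    rw [h1]
    have h3 : β / 2 ≤ (Real.log N - 4 * Real.log 2) / h := by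
      rw [le_div_iff₀ h0]
      linarith
    linarith

end SUnitEquation

namespace SUnitEquation

open Finset

/-- There are only finitely many nondegenerate vanishing sums of four coprime integers
supported on `S`. -/
theorem finite_sum_four_eq_zero {S : Finset ℕ} (hS : ∀ q ∈ S, q.Prime) :
    {p : Fin 4 → ℤ | (∀ i, ∀ q : ℕ, q.Prime → (q : ℤ) ∣ p i → q ∈ S) ∧
      (∀ q : ℕ, q.Prime → ∃ i, ¬ (q : ℤ) ∣ p i) ∧ (∀ i, p i ≠ 0) ∧ ∑ i, p i = 0 ∧
      ∀ i j, i ≠ j → p i + p j ≠ 0}.Finite := by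
  obtain ⟨X, hX⟩ := exists_log_lt_of_sum_four_eq_zero hS
  refine (Set.finite_Icc (fun _ => -⌈Real.exp X⌉ : Fin 4 → ℤ) fun _ => ⌈Real.exp X⌉).subset ?_
  rintro p ⟨hpS, hcop, hp, hsum, hnd⟩
  obtain ⟨m, -, hm⟩ := Finset.exists_max_image univ (fun i => |p i|) univ_nonempty
  set σ := Equiv.swap 0 m with hσ
  have hσ0 : σ 0 = m := Equiv.swap_apply_left _ _
  have key := hX (p ∘ σ) (fun i => hpS _) (fun q hq => ?_) (fun i => hp _)
    ((Equiv.sum_comp σ p).trans hsum) (fun i j hij => hnd _ _ (σ.injective.ne hij))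
    (fun i => by simpa only [Function.comp_apply, hσ0] using hm _ (mem_univ _))
  · rw [Function.comp_apply, hσ0, Real.log_lt_iff_lt_exp (abs_pos.2 (by exact_mod_cast hp m)),
      ← Int.cast_abs] at key
    have h1 : ∀ i, |p i| ≤ ⌈Real.exp X⌉ := fun i => (hm i (mem_univ i)).trans
      (by exact_mod_cast key.le.trans (Int.le_ceil _))
    exact ⟨fun i => (abs_le.1 (h1 i)).1, fun i => (abs_le.1 (h1 i)).2⟩
  · obtain ⟨i, hi⟩ := hcop q hq
    exact ⟨σ.symm i, by simpa using hi⟩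

/-- A vector of nonzero integers is proportional to a vector of coprime ones. -/
lemma exists_coprime_eq_mul {n : ℕ} (P : Fin n → ℤ) {i : Fin n} (hi : P i ≠ 0) :
    ∃ d : ℤ, d ≠ 0 ∧ ∃ p : Fin n → ℤ, (∀ i, P i = d * p i) ∧
      ∀ q : ℕ, q.Prime → ∃ i, ¬ (q : ℤ) ∣ p i := by
  have hgd : ∀ i, univ.gcd P ∣ P i := fun i => Finset.gcd_dvd (mem_univ i)
  choose p hp using hgd
  have hg0 : univ.gcd P ≠ 0 := fun h => hi (by rw [hp, h, zero_mul])
  refine ⟨univ.gcd P, hg0, p, hp, fun q hq => ?_⟩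
  by_contra! hall
  have h1 : univ.gcd P * q ∣ univ.gcd P * 1 := by
    rw [mul_one]
    refine Finset.dvd_gcd fun i _ => ?_
    conv_rhs => rw [hp]
    exact mul_dvd_mul_left _ (hall i)
  exact (Nat.prime_iff_prime_int.1 hq).not_isUnit
    (isUnit_of_dvd_one ((mul_dvd_mul_iff_left hg0).1 h1))

end SUnitEquation

theorem stmt_14 (S : Finset ℕ) (hS : S.Nonempty) (hP : ∀ p ∈ S, p.Prime) :
    {t : ℚ × ℚ × ℚ | IsSUnit S t.1 ∧ IsSUnit S t.2.1 ∧ IsSUnit S t.2.2 ∧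
      1 + t.1 = t.2.1 + t.2.2 ∧
      ¬(t.2.1 = 1 ∧ t.2.2 = t.1) ∧ ¬(t.2.1 = t.1 ∧ t.2.2 = 1) ∧
      ¬(t.1 = -1 ∧ t.2.2 = -t.2.1)}.Finite := by
  refine ((SUnitEquation.finite_sum_four_eq_zero hP).image fun p =>
    ((p 1 / p 0, -p 2 / p 0, -p 3 / p 0) : ℚ × ℚ × ℚ)).subset ?_
  rintro ⟨x, y, z⟩ ⟨⟨hx, hxS⟩, ⟨hy, hyS⟩, ⟨hz, hzS⟩, hsum, h1, h2, h3⟩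
  dsimp only at *
  have hxd : (x.den : ℤ) ≠ 0 := by exact_mod_cast x.den_nz
  have hyd : (y.den : ℤ) ≠ 0 := by exact_mod_cast y.den_nz
  have hzd : (z.den : ℤ) ≠ 0 := by exact_mod_cast z.den_nz
  set P : Fin 4 → ℤ := ![x.den * y.den * z.den, x.num * y.den * z.den, -(x.den * y.num * z.den),
    -(x.den * y.den * z.num)] with hP'
  have hP0 : P 0 ≠ 0 := mul_ne_zero (mul_ne_zero hxd hyd) hzd
  have hPS : ∀ i, ∀ q : ℕ, q.Prime → (q : ℤ) ∣ P i → q ∈ S := by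
    have hmul : ∀ q : ℕ, q.Prime → ∀ a b c : ℤ, (q : ℤ) ∣ a * b * c →
        ((q : ℤ) ∣ a ∨ (q : ℤ) ∣ b) ∨ (q : ℤ) ∣ c := fun q hq a b c h =>
      ((Nat.prime_iff_prime_int.1 hq).dvd_or_dvd h).imp_left
        (Nat.prime_iff_prime_int.1 hq).dvd_or_dvd
    intro i q hq hd
    have hd' : ∀ u : ℚ, (q : ℤ) ∣ u.den → q ∣ u.den := fun u h => by exact_mod_cast h
    fin_cases i
    · rcases hmul q hq _ _ _ hd with (h | h) | h
      exacts [hxS q hq (.inr (hd' _ h)), hyS q hq (.inr (hd' _ h)), hzS q hq (.inr (hd' _ h))]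
    · rcases hmul q hq _ _ _ hd with (h | h) | h
      exacts [hxS q hq (.inl h), hyS q hq (.inr (hd' _ h)), hzS q hq (.inr (hd' _ h))]
    · rcases hmul q hq _ _ _ (dvd_neg.1 hd) with (h | h) | h
      exacts [hxS q hq (.inr (hd' _ h)), hyS q hq (.inl h), hzS q hq (.inr (hd' _ h))]
    · rcases hmul q hq _ _ _ (dvd_neg.1 hd) with (h | h) | h
      exacts [hxS q hq (.inr (hd' _ h)), hyS q hq (.inr (hd' _ h)), hzS q hq (.inl h)]
  obtain ⟨d, hd, p, hp, hcop⟩ := SUnitEquation.exists_coprime_eq_mul P hP0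
  have hp0 : (p 0 : ℚ) ≠ 0 := by
    have : p 0 ≠ 0 := fun h => hP0 (by rw [hp, h, mul_zero])
    exact_mod_cast this
  have hdQ : (d : ℚ) ≠ 0 := by exact_mod_cast hd
  have hP0Q : ((P 0 : ℤ) : ℚ) = d * p 0 := by exact_mod_cast hp 0
  have hratio : ∀ i (u : ℚ), (P i : ℚ) = P 0 * u → (p i : ℚ) = p 0 * u := fun i u h => by
    have h4 : (P i : ℚ) = d * p i := by exact_mod_cast hp i
    rw [h4, hP0Q] at h
    exact mul_left_cancel₀ hdQ (by rw [h, mul_assoc])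
  have hp1 : (p 1 : ℚ) = p 0 * x := hratio 1 x (by
    simp only [hP', Matrix.cons_val]
    push_cast
    nth_rewrite 1 [← Rat.den_mul_eq_num x]
    ring)
  have hp2 : (p 2 : ℚ) = p 0 * -y := hratio 2 (-y) (by
    simp only [hP', Matrix.cons_val]
    push_cast
    nth_rewrite 1 [← Rat.den_mul_eq_num y]
    ring)
  have hp3 : (p 3 : ℚ) = p 0 * -z := hratio 3 (-z) (by
    simp only [hP', Matrix.cons_val]
    push_cast
    nth_rewrite 1 [← Rat.den_mul_eq_num z]
    ring)
  have hv : ∀ i, (p i : ℚ) = p 0 * (![1, x, -y, -z] : Fin 4 → ℚ) i := by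
    intro i
    fin_cases i
    exacts [(mul_one _).symm, hp1, hp2, hp3]
  refine ⟨p, ⟨fun i q hq h => hPS i q hq (by rw [hp]; exact h.mul_left _), hcop, fun i h => ?_, ?_,
    fun i j hij h => ?_⟩, ?_⟩
  · have h4 := hv i
    rw [h, Int.cast_zero, eq_comm, mul_eq_zero, or_iff_right hp0] at h4
    fin_cases i
    exacts [one_ne_zero h4, hx h4, hy (neg_eq_zero.1 h4), hz (neg_eq_zero.1 h4)]
  · have h4 : ((∑ i, p i : ℤ) : ℚ) = 0 := by
      rw [Fin.sum_univ_four]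
      push_cast
      rw [hp1, hp2, hp3]
      linear_combination (p 0 : ℚ) * hsum
    exact_mod_cast h4
  · have h4 : (p i : ℚ) + p j = 0 := by exact_mod_cast h
    rw [hv i, hv j, ← mul_add, mul_eq_zero, or_iff_right hp0] at h4
    fin_cases i <;> fin_cases j <;> simp at h4 hij <;> first
      | exact h1 ⟨by linarith, by linarith⟩
      | exact h2 ⟨by linarith, by linarith⟩
      | exact h3 ⟨by linarith, by linarith⟩
  · simp only [hp1, hp2, hp3]
    ext <;> field_simp
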